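/- Modified Rayleigh Conjecture (Theorem 4.4, sup-norm form). Let u₀(x,y) = e^{ik(x cos θ − y sin θ)} and let v be a scattered field: v is continuous on the closure of D, twice continuously differentiable in D, quasiperiodic, outgoing, satisfies Δv + k²v = 0 in D and v = −u₀ on S. Fix R > M. There exists a constant c > 0, independent of ε, p and the coefficients, such that: whenever ε > 0, p ∈ ℕ, and coefficients c_j ∈ ℂ (|j| ≤ p) satisfy ( ∫_{S_L} | u₀(x,f(x)) + Σ_{|j|≤p} c_j e^{iμ_j f(x)} φ_j(x) |² ds )^{1/2} ≤ ε, then | v(x,y) − Σ_{|j|≤p} c_j e^{iμ_j y} φ_j(x) | ≤ c ε for every (x,y) ∈ D with y ≥ R. -/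

import Mathlib

open MeasureTheory

namespace Rayleigh

/-- Approximate solvability of the dual problem for a bounded sesquilinear form that satisfies an
inf-sup condition on a semi-inner product space. -/
theorem exists_approx_dual {V : Type*} [AddCommGroup V] [Module ℂ V]
    (core : PreInnerProductSpace.Core ℂ V) (N : V → ℝ)
    (hN : ∀ v, N v = Real.sqrt (core.inner v v).re)
    (a : V → V → ℂ)
    (hadd : ∀ v w z, a (v + w) z = a v z + a w z) (hsmul : ∀ (c : ℂ) v z, a (c • v) z = c * a v z)
    (hadd' : ∀ v w z, a v (w + z) = a v w + a v z)
    (hsmul' : ∀ (c : ℂ) v z, a v (c • z) = (starRingEnd ℂ) c * a v z)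
    (B : ℝ) (hB : 0 ≤ B) (hbound : ∀ v z, ‖a v z‖ ≤ B * N v * N z)
    (C : ℝ) (hC : 0 ≤ C)
    (hinf : ∀ v ε, 0 ≤ ε → (∀ z, ‖a v z‖ ≤ ε * N z) → N v ≤ C * ε)
    (G : V →ₗ[ℂ] ℂ) (γ : ℝ) (hγ : 0 ≤ γ) (hG : ∀ z, ‖G z‖ ≤ γ * N z) (ε : ℝ) (hε : 0 < ε) :
    ∃ u, N u ≤ γ * C + 1 ∧ ∀ z, ‖a z u - G z‖ ≤ ε * N z := by
  let := core
  let : SeminormedAddCommGroup V :=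
    @InnerProductSpace.Core.toSeminormedAddCommGroup ℂ V _ _ _ core
  let : InnerProductSpace ℂ V := InnerProductSpace.ofCore core
  have hnorm : ∀ v : V, ‖v‖ = N v := fun v => (hN v).symm
  let E := UniformSpace.Completion V
  -- the Riesz representative of the form in its first argument
  let ell : V → (V →L[ℂ] ℂ) := fun z => LinearMap.mkContinuous
    { toFun := fun u => (starRingEnd ℂ) (a z u)
      map_add' := by intro x y; simp [hadd']
      map_smul' := by intro c x; simp [hsmul'] } (B * N z) (by
        intro x
        have := hbound z x
        simpa [hnorm] using this)
  have hell : ∀ z u, ell z u = (starRingEnd ℂ) (a z u) := fun z u => rfl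
  have hext : ∀ z, ∃ x : E, ∀ u : V, inner ℂ (u : E) x = a z u := by
    intro z
    let F : E →L[ℂ] ℂ := (ell z).extend (UniformSpace.Completion.toComplL (𝕜 := ℂ) (E := V))
    have hF : ∀ u : V, F (u : E) = (starRingEnd ℂ) (a z u) := by
      intro u
      exact ContinuousLinearMap.extend_eq (ell z) (e := UniformSpace.Completion.toComplL)
        UniformSpace.Completion.denseRange_coe
        (UniformSpace.Completion.isUniformInducing_coe V) u
    refine ⟨(InnerProductSpace.toDual ℂ E).symm F, fun u => ?_⟩
    rw [← inner_conj_symm, InnerProductSpace.toDual_symm_apply, hF]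
    simp
  choose r0 hr0 using hext
  have huniq : ∀ x y : E, (∀ u : V, inner ℂ (u : E) x = inner ℂ (u : E) y) → x = y := by
    intro x y h
    refine ext_inner_left ℂ fun w => ?_
    refine UniformSpace.Completion.induction_on w ?_ h
    exact isClosed_eq (by fun_prop) (by fun_prop)
  let r : V →ₗ[ℂ] E :=
    { toFun := r0
      map_add' := by
        intro x y
        refine huniq _ _ fun u => ?_
        rw [inner_add_right, hr0, hr0, hr0, hadd]
      map_smul' := by
        intro c x
        refine huniq _ _ fun u => ?_
        rw [inner_smul_right, hr0, hr0, hsmul]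
        rfl }
  have hr : ∀ z (u : V), inner ℂ (u : E) (r z) = a z u := hr0
  have hzr : ∀ z, N z ≤ C * ‖r z‖ := by
    intro z
    refine hinf z _ (norm_nonneg _) fun u => ?_
    rw [← hr]
    calc _ ≤ ‖(u : E)‖ * ‖r z‖ := norm_inner_le_norm _ _
      _ = ‖r z‖ * N u := by rw [UniformSpace.Completion.norm_coe, hnorm, mul_comm]
  have hrz : ∀ z, ‖r z‖ ≤ B * N z := by
    intro z
    have key : ∀ w : E, ‖inner ℂ w (r z)‖ ≤ B * N z * ‖w‖ := by
      intro w
      refine UniformSpace.Completion.induction_on w ?_ ?_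
      · exact isClosed_le (by fun_prop) (by fun_prop)
      · intro u
        rw [hr, UniformSpace.Completion.norm_coe, hnorm]
        exact hbound z u
    have h1 := key (r z)
    rw [inner_self_eq_norm_sq_to_K] at h1
    have h2 : ‖r z‖ ^ 2 ≤ B * N z * ‖r z‖ := by simpa using h1
    by_contra hlt
    push Not at hlt
    have : 0 ≤ B * N z := by rw [← hnorm]; positivity
    nlinarith
  -- the functional induced by `G` on the range of `r`
  have hGr : ∀ z, ‖G z‖ ≤ γ * C * ‖r z‖ := fun z => (hG z).trans (by
    rw [mul_assoc]; exact mul_le_mul_of_nonneg_left (hzr z) hγ)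
  have hker : LinearMap.ker r ≤ LinearMap.ker G := by
    intro z hz
    have := hGr z
    rw [LinearMap.mem_ker] at hz ⊢
    rw [hz] at this
    simpa using this
  let q : LinearMap.range r →ₗ[ℂ] ℂ :=
    ((LinearMap.ker r).liftQ G hker).comp r.quotKerEquivRange.symm.toLinearMap
  have hq : ∀ z, q ⟨r z, LinearMap.mem_range_self r z⟩ = G z := by
    intro z
    have : r.quotKerEquivRange.symm ⟨r z, LinearMap.mem_range_self r z⟩
        = (LinearMap.ker r).mkQ z := by
      rw [LinearEquiv.symm_apply_eq]
      rfl
    change ((LinearMap.ker r).liftQ G hker) (r.quotKerEquivRange.symm _) = _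
    rw [this]
    rfl
  let qc : StrongDual ℂ (LinearMap.range r) := q.mkContinuous (γ * C) (by
    rintro ⟨x, z, rfl⟩
    rw [hq]
    exact hGr z)
  obtain ⟨Q, hQ, hQn⟩ := exists_extension_norm_eq (LinearMap.range r) qc
  let U : E := (InnerProductSpace.toDual ℂ E).symm Q
  have hU : ∀ z, inner ℂ U (r z) = G z := by
    intro z
    rw [InnerProductSpace.toDual_symm_apply]
    exact (hQ ⟨r z, LinearMap.mem_range_self r z⟩).trans (hq z)
  have hUn : ‖U‖ ≤ γ * C := by
    rw [LinearIsometryEquiv.norm_map, hQn]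
    exact LinearMap.mkContinuous_norm_le _ (by positivity) _
  let δ := min 1 (ε / (B + 1))
  have hδ : 0 < δ := by positivity
  obtain ⟨u, hu⟩ := UniformSpace.Completion.denseRange_coe.exists_dist_lt U hδ
  rw [dist_eq_norm] at hu
  refine ⟨u, ?_, fun z => ?_⟩
  · rw [← hnorm, ← UniformSpace.Completion.norm_coe]
    calc ‖(u : E)‖ = ‖U - (U - u)‖ := by congr 1; abel
      _ ≤ ‖U‖ + ‖U - u‖ := norm_sub_le _ _
      _ ≤ γ * C + 1 := add_le_add hUn (hu.le.trans (min_le_left _ _))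
  · rw [← hr, ← hU, ← inner_sub_left]
    have hz : 0 ≤ N z := by rw [← hnorm]; positivity
    calc _ ≤ ‖(u : E) - U‖ * ‖r z‖ := norm_inner_le_norm _ _
      _ ≤ (ε / (B + 1)) * (B * N z) := by
        refine mul_le_mul ?_ (hrz z) (norm_nonneg _) (by positivity)
        rw [norm_sub_rev]
        exact hu.le.trans (min_le_right _ _)
      _ ≤ ε * N z := by
        rw [← mul_assoc]
        refine mul_le_mul_of_nonneg_right ?_ hz
        rw [div_mul_eq_mul_div, div_le_iff₀ (by positivity)]
        nlinarith

open scoped ComplexConjugate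

/-! ### Elementary calculus -/

theorem hasDerivAt_max_sq (y : ℝ) : HasDerivAt (fun y : ℝ => (max y 0) ^ 2) (2 * max y 0) y := by
  rcases lt_trichotomy y 0 with h | h | h
  · have : (fun y : ℝ => (max y 0) ^ 2) =ᶠ[nhds y] fun _ => 0 := by
      filter_upwards [Iio_mem_nhds h] with z hz
      rw [max_eq_right (le_of_lt hz)]; simp
    rw [max_eq_right h.le, mul_zero]
    exact (hasDerivAt_const y (0 : ℝ)).congr_of_eventuallyEq this
  · subst h
    rw [hasDerivAt_iff_isLittleO_nhds_zero]
    simp only [zero_add, max_self, mul_zero, smul_zero, sub_zero]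
    refine Asymptotics.IsBigO.trans_isLittleO (g := fun h : ℝ => h ^ 2) ?_ ?_
    · refine Asymptotics.IsBigO.of_bound 1 (Filter.Eventually.of_forall fun h => ?_)
      simp only [ne_eq, OfNat.ofNat_ne_zero, not_false_eq_true, zero_pow, sub_zero, norm_pow,
        Real.norm_eq_abs, one_mul, sq_abs]
      rcases le_total h 0 with h0 | h0
      · rw [max_eq_right h0]; nlinarith [sq_nonneg h]
      · rw [max_eq_left h0]
    · simpa using Asymptotics.isLittleO_pow_pow (𝕜 := ℝ) (m := 1) (n := 2) (by norm_num)
  · have : (fun y : ℝ => (max y 0) ^ 2) =ᶠ[nhds y] fun y => y ^ 2 := by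
      filter_upwards [Ioi_mem_nhds h] with z hz
      rw [max_eq_left (le_of_lt hz)]
    rw [max_eq_left h.le]
    simpa using (hasDerivAt_pow 2 y).congr_of_eventuallyEq this

theorem sq_integral_mul_le {α : Type*} [MeasurableSpace α] {μ : Measure α} {f g : α → ℝ}
    (hf : Integrable (fun x => f x ^ 2) μ) (hg : Integrable (fun x => g x ^ 2) μ)
    (hfg : Integrable (fun x => f x * g x) μ) :
    (∫ x, f x * g x ∂μ) ^ 2 ≤ (∫ x, f x ^ 2 ∂μ) * ∫ x, g x ^ 2 ∂μ := by
  have h : ∀ t : ℝ, 0 ≤ (∫ x, f x ^ 2 ∂μ) * (t * t) + (2 * ∫ x, f x * g x ∂μ) * t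
      + ∫ x, g x ^ 2 ∂μ := by
    intro t
    have : (∫ x, f x ^ 2 ∂μ) * (t * t) + (2 * ∫ x, f x * g x ∂μ) * t + ∫ x, g x ^ 2 ∂μ
        = ∫ x, (t * f x + g x) ^ 2 ∂μ := by
      have e : (fun x => (t * f x + g x) ^ 2)
          = fun x => (t * t) * f x ^ 2 + (2 * t) * (f x * g x) + g x ^ 2 := by
        funext x; ring
      rw [e, integral_add (f := fun x => (t * t) * f x ^ 2 + (2 * t) * (f x * g x))
        ((hf.const_mul _).add (hfg.const_mul _)) hg,
        integral_add (hf.const_mul _) (hfg.const_mul _), integral_const_mul, integral_const_mul]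
      ring
    rw [this]
    exact integral_nonneg fun x => sq_nonneg _
  have := discrim_le_zero h
  rw [discrim] at this
  nlinarith

theorem sq_intervalIntegral_mul_le {f g : ℝ → ℝ} {a b : ℝ} (hab : a ≤ b)
    (hf : ContinuousOn f (Set.Icc a b)) (hg : ContinuousOn g (Set.Icc a b)) :
    (∫ x in a..b, f x * g x) ^ 2 ≤ (∫ x in a..b, f x ^ 2) * ∫ x in a..b, g x ^ 2 := by
  simp only [intervalIntegral.integral_of_le hab]
  have key : ∀ F : ℝ → ℝ, ContinuousOn F (Set.Icc a b) →
      Integrable F (volume.restrict (Set.Ioc a b)) := fun F hF =>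
    (hF.integrableOn_compact isCompact_Icc).mono_set Set.Ioc_subset_Icc_self
  exact sq_integral_mul_le (key _ (hf.pow 2)) (key _ (hg.pow 2)) (key _ (hf.mul hg))

/-- `‖∫ F‖² ≤ (b - a) ∫ ‖F‖²`. -/
theorem sq_norm_intervalIntegral_le {F : ℝ → ℂ} {a b : ℝ} (hab : a ≤ b)
    (hF : ContinuousOn F (Set.Icc a b)) :
    ‖∫ x in a..b, F x‖ ^ 2 ≤ (b - a) * ∫ x in a..b, ‖F x‖ ^ 2 := by
  have h1 : ‖∫ x in a..b, F x‖ ≤ ∫ x in a..b, 1 * ‖F x‖ := by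
    simpa using intervalIntegral.norm_integral_le_integral_norm (f := F) hab
  have h2 := sq_intervalIntegral_mul_le (f := fun _ => 1) (g := fun x => ‖F x‖) hab
    continuousOn_const hF.norm
  calc _ ≤ (∫ x in a..b, 1 * ‖F x‖) ^ 2 := pow_le_pow_left₀ (norm_nonneg _) h1 2
    _ ≤ _ := h2
    _ = _ := by simp

theorem continuous_intervalIntegral_param {E : Type*} [NormedAddCommGroup E] [NormedSpace ℝ E]
    {F : ℝ × ℝ → E} (hF : Continuous F) (a b : ℝ) :
    Continuous fun y => ∫ x in a..b, F (x, y) :=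
  intervalIntegral.continuous_parametric_intervalIntegral_of_continuous' (μ := volume)
    (f := fun y x => F (x, y)) (by fun_prop) a b

/-- The real part of `z * conj w`. -/
theorem norm_add_sq_complex (z w : ℂ) :
    ‖z + w‖ ^ 2 = ‖z‖ ^ 2 + ‖w‖ ^ 2 + 2 * (z * conj w).re := by
  rw [← Complex.normSq_eq_norm_sq, ← Complex.normSq_eq_norm_sq, ← Complex.normSq_eq_norm_sq,
    Complex.normSq_add]

theorem norm_add_sq_le (z w : ℂ) : ‖z + w‖ ^ 2 ≤ 2 * ‖z‖ ^ 2 + 2 * ‖w‖ ^ 2 := by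
  have h := norm_add_le z w
  have h0 := norm_nonneg (z + w)
  nlinarith [sq_nonneg (‖z‖ - ‖w‖)]

theorem norm_sub_sq_le (z w : ℂ) : ‖z - w‖ ^ 2 ≤ 2 * ‖z‖ ^ 2 + 2 * ‖w‖ ^ 2 := by
  simpa [sub_eq_add_neg] using norm_add_sq_le z (-w)

theorem polarization (z w : ℂ) : z * conj w
    = ((‖z + w‖ ^ 2 : ℝ) - (‖z - w‖ ^ 2 : ℝ) + Complex.I * (‖z + Complex.I * w‖ ^ 2 : ℝ)
      - Complex.I * (‖z - Complex.I * w‖ ^ 2 : ℝ)) / 4 := by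
  simp only [← Complex.normSq_eq_norm_sq]
  apply Complex.ext <;>
  simp [Complex.normSq_apply] <;> ring

/-! ### The geometric setting -/

/-- The data of the problem: period `L`, wave number `k`, quasi-momentum `β`, profile `f` below
the height `M`, and two further heights `M < b < H`. -/
structure Geo where
  L : ℝ
  k : ℝ
  β : ℝ
  M : ℝ
  b : ℝ
  H : ℝ
  f : ℝ → ℝ
  K : NNReal
  L_pos : 0 < L
  k_pos : 0 < k
  nonres : ∀ j : ℤ, (β + 2 * Real.pi * j / L) ^ 2 ≠ k ^ 2
  lip : LipschitzWith K f
  per : ∀ x, f (x + L) = f x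
  nonneg : ∀ x, 0 ≤ f x
  le_M : ∀ x, f x ≤ M
  M_lt_b : M < b
  b_lt_H : b < H

namespace Geo

variable (g : Geo)

theorem b_pos : 0 < g.b := ((g.nonneg 0).trans (g.le_M 0)).trans_lt g.M_lt_b
theorem H_pos : 0 < g.H := g.b_pos.trans g.b_lt_H

/-- The quasi-periodicity factor. -/
noncomputable def nu : ℂ := Complex.exp (Complex.I * (g.β * g.L : ℝ))

noncomputable def lam (j : ℤ) : ℝ := g.β + 2 * Real.pi * j / g.L

noncomputable def phi (j : ℤ) (x : ℝ) : ℂ :=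
  Complex.exp (Complex.I * (g.lam j * x : ℝ)) / (Real.sqrt g.L : ℝ)

/-- `m j = √(λ_j² - k²)` with the branch `-i√(k² - λ_j²)` for propagating modes. -/
noncomputable def m (j : ℤ) : ℂ :=
  if g.k ^ 2 < g.lam j ^ 2 then (Real.sqrt (g.lam j ^ 2 - g.k ^ 2) : ℝ)
  else -Complex.I * (Real.sqrt (g.k ^ 2 - g.lam j ^ 2) : ℝ)

noncomputable def coef (u : ℝ → ℂ) (j : ℤ) : ℂ := ∫ x in (0 : ℝ)..g.L, u x * conj (g.phi j x)

@[fun_prop]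
theorem continuous_phi (j : ℤ) : Continuous (g.phi j) := by unfold phi; fun_prop

theorem norm_nu : ‖g.nu‖ = 1 := by
  rw [nu, mul_comm]; exact Complex.norm_exp_ofReal_mul_I _

theorem nu_mul_conj : g.nu * conj g.nu = 1 := by
  rw [Complex.mul_conj, Complex.normSq_eq_norm_sq, norm_nu]; simp

theorem sqrt_L_pos : 0 < Real.sqrt g.L := Real.sqrt_pos.2 g.L_pos

theorem norm_phi (j : ℤ) (x : ℝ) : ‖g.phi j x‖ = 1 / Real.sqrt g.L := by
  rw [phi, norm_div, mul_comm, Complex.norm_exp_ofReal_mul_I, Complex.norm_real, Real.norm_eq_abs,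
    abs_of_pos g.sqrt_L_pos]

theorem phi_add_L (j : ℤ) (x : ℝ) : g.phi j (x + g.L) = g.nu * g.phi j x := by
  have hL := g.L_pos.ne'
  rw [phi, phi, nu, ← mul_div_assoc, ← Complex.exp_add]
  congr 1
  rw [Complex.exp_eq_exp_iff_exists_int]
  refine ⟨j, ?_⟩
  rw [lam]
  push_cast
  have : (g.L : ℂ) ≠ 0 := by exact_mod_cast hL
  field_simp
  ring

theorem hasDerivAt_phi (j : ℤ) (x : ℝ) :
    HasDerivAt (g.phi j) (Complex.I * g.lam j * g.phi j x) x := by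
  have h1 : HasDerivAt (fun x : ℝ => ((g.lam j * x : ℝ) : ℂ)) ((g.lam j * 1 : ℝ) : ℂ) x :=
    ((hasDerivAt_id x).const_mul (g.lam j)).ofReal_comp
  have h := (((h1.const_mul Complex.I).cexp).div_const ((Real.sqrt g.L : ℝ) : ℂ))
  refine h.congr_deriv ?_
  rw [phi]; simp; ring

theorem lam_sq_ne (j : ℤ) : g.lam j ^ 2 ≠ g.k ^ 2 := g.nonres j

theorem m_sq (j : ℤ) : g.m j ^ 2 = ((g.lam j ^ 2 - g.k ^ 2 : ℝ) : ℂ) := by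
  unfold m
  split_ifs with h
  · rw [← Complex.ofReal_pow, Real.sq_sqrt (by linarith)]
  · rw [mul_pow, ← Complex.ofReal_pow, Real.sq_sqrt (by linarith)]
    simp

theorem m_re_nonneg (j : ℤ) : 0 ≤ (g.m j).re := by
  unfold m
  split_ifs with h
  · simp [Real.sqrt_nonneg]
  · simp

theorem m_evan {j : ℤ} (h : g.k ^ 2 < g.lam j ^ 2) :
    0 < (g.m j).re ∧ (g.m j).im = 0 := by
  unfold m
  rw [if_pos h]
  simp [Real.sqrt_pos, h]

theorem m_prop {j : ℤ} (h : ¬ g.k ^ 2 < g.lam j ^ 2) :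
    (g.m j).re = 0 ∧ (g.m j).im < 0 := by
  have h1 : g.lam j ^ 2 < g.k ^ 2 := lt_of_le_of_ne (not_lt.1 h) (g.lam_sq_ne j)
  unfold m
  rw [if_neg h]
  simp [Real.sqrt_pos, h1]

theorem m_im_nonpos (j : ℤ) : (g.m j).im ≤ 0 := by
  by_cases h : g.k ^ 2 < g.lam j ^ 2
  · exact (g.m_evan h).2.le
  · exact (g.m_prop h).2.le

theorem norm_m_sq (j : ℤ) : ‖g.m j‖ ^ 2 = |g.lam j ^ 2 - g.k ^ 2| := by
  rw [← norm_pow, m_sq, Complex.norm_real, Real.norm_eq_abs]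

theorem norm_m_sq_le (j : ℤ) : ‖g.m j‖ ^ 2 ≤ g.lam j ^ 2 + g.k ^ 2 := by
  rw [norm_m_sq]
  exact abs_le.2 ⟨by nlinarith [sq_nonneg (g.lam j), sq_nonneg g.k],
    by nlinarith [sq_nonneg (g.lam j), sq_nonneg g.k]⟩

/-! ### Fourier series -/

theorem coef_add {u w : ℝ → ℂ} (hu : Continuous u) (hw : Continuous w) (j : ℤ) :
    g.coef (fun x => u x + w x) j = g.coef u j + g.coef w j := by
  unfold coef
  rw [← intervalIntegral.integral_add]
  · simp only [add_mul]
  all_goals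
    apply Continuous.intervalIntegrable
    fun_prop

theorem coef_const_mul (c : ℂ) (u : ℝ → ℂ) (j : ℤ) :
    g.coef (fun x => c * u x) j = c * g.coef u j := by
  unfold coef
  rw [← intervalIntegral.integral_const_mul]
  simp only [mul_assoc]

theorem hasSum_norm_coef_sq {u : ℝ → ℂ} (hu : ContinuousOn u (Set.Icc 0 g.L)) :
    HasSum (fun j => ‖g.coef u j‖ ^ 2) (∫ x in (0 : ℝ)..g.L, ‖u x‖ ^ 2) := by
  have hL := g.L_pos
  let G : ℝ → ℂ := fun x => u x * Complex.exp (-Complex.I * (g.β * x : ℝ))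
  have hGc : ContinuousOn G (Set.Icc 0 g.L) := by
    refine hu.mul ?_
    fun_prop
  have hGn : ∀ x, ‖G x‖ = ‖u x‖ := by
    intro x
    have : -Complex.I * (g.β * x : ℝ) = ((-(g.β * x) : ℝ) : ℂ) * Complex.I := by push_cast; ring
    simp only [G]
    rw [norm_mul, this, Complex.norm_exp_ofReal_mul_I, mul_one]
  have hm : MemLp G 2 (volume.restrict (Set.Ioc 0 g.L)) := by
    obtain ⟨B, hB⟩ := isCompact_Icc.exists_bound_of_continuousOn hGc
    refine MemLp.of_bound ((hGc.mono Set.Ioc_subset_Icc_self).aestronglyMeasurable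
      measurableSet_Ioc) B ?_
    filter_upwards [ae_restrict_mem measurableSet_Ioc] with x hx
    exact hB x (Set.Ioc_subset_Icc_self hx)
  have h := hasSum_sq_fourierCoeffOn hL hm
  have hc : ∀ j : ℤ, fourierCoeffOn hL G j = (1 / (Real.sqrt g.L : ℝ) : ℂ) * g.coef u j := by
    intro j
    rw [fourierCoeffOn_eq_integral, coef, ← intervalIntegral.integral_const_mul,
      ← intervalIntegral.integral_smul]
    refine intervalIntegral.integral_congr fun x _ => ?_
    have hsq : ((Real.sqrt g.L : ℝ) : ℂ) * (Real.sqrt g.L : ℝ) = g.L := by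
      rw [← Complex.ofReal_mul, Real.mul_self_sqrt hL.le]
    have hs0 : ((Real.sqrt g.L : ℝ) : ℂ) ≠ 0 := by exact_mod_cast g.sqrt_L_pos.ne'
    have hL0 : (g.L : ℂ) ≠ 0 := by exact_mod_cast hL.ne'
    have e : Complex.exp (2 * Real.pi * Complex.I * (-j : ℤ) * x / (g.L - 0 : ℝ))
        * Complex.exp (-Complex.I * (g.β * x : ℝ))
        = conj (Complex.exp (Complex.I * (g.lam j * x : ℝ))) := by
      rw [← Complex.exp_add, ← Complex.exp_conj]
      congr 1
      rw [lam]
      simp only [sub_zero, map_mul, Complex.conj_I, Complex.conj_ofReal]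
      push_cast
      field_simp
      ring
    simp only [fourier_coe_apply, G, phi, map_div₀, Complex.conj_ofReal, ← e, smul_eq_mul,
      Complex.real_smul]
    push_cast
    simp only [sub_zero]
    rw [← hsq]
    field_simp
  have h2 := h.mul_left g.L
  have e1 : (fun j => g.L * ‖fourierCoeffOn hL G j‖ ^ 2) = fun j => ‖g.coef u j‖ ^ 2 := by
    funext j
    rw [hc, norm_mul, mul_pow, norm_div, norm_one, Complex.norm_real, Real.norm_eq_abs,
      abs_of_pos g.sqrt_L_pos, div_pow, Real.sq_sqrt hL.le]
    field_simp
  rw [e1] at h2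
  have e2 : g.L * ((g.L - 0)⁻¹ • ∫ x in (0 : ℝ)..g.L, ‖G x‖ ^ 2)
      = ∫ x in (0 : ℝ)..g.L, ‖u x‖ ^ 2 := by
    simp only [hGn, sub_zero, smul_eq_mul]
    field_simp
  rwa [e2] at h2

theorem hasSum_coef_mul_conj {u w : ℝ → ℂ} (hu : Continuous u) (hw : Continuous w) :
    HasSum (fun j => g.coef u j * conj (g.coef w j))
      (∫ x in (0 : ℝ)..g.L, u x * conj (w x)) := by
  have key : ∀ c : ℂ, HasSum (fun j => ((‖g.coef u j + c * g.coef w j‖ ^ 2 : ℝ) : ℂ))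
      ((∫ x in (0 : ℝ)..g.L, ‖u x + c * w x‖ ^ 2 : ℝ) : ℂ) := by
    intro c
    have h := g.hasSum_norm_coef_sq (u := fun x => u x + c * w x) (by fun_prop)
    have e : ∀ j, g.coef (fun x => u x + c * w x) j = g.coef u j + c * g.coef w j := by
      intro j
      rw [g.coef_add hu (w := fun x => c * w x) (by fun_prop), coef_const_mul]
    simp only [e] at h
    exact Complex.hasSum_ofReal.2 h
  have h := (((((key 1).sub (key (-1))).add ((key Complex.I).mul_left Complex.I)).sub
    ((key (-Complex.I)).mul_left Complex.I))).div_const 4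
  have e1 : (fun j => g.coef u j * conj (g.coef w j)) = _ :=
    funext fun j => polarization (g.coef u j) (g.coef w j)
  have e2 : (fun x => u x * conj (w x)) = _ := funext fun x => polarization (u x) (w x)
  rw [e1, e2]
  have hi : ∀ c : ℂ, IntervalIntegrable (fun x => ((‖u x + c * w x‖ ^ 2 : ℝ) : ℂ)) volume
      0 g.L := fun c => Continuous.intervalIntegrable (by fun_prop) _ _
  simp only [← intervalIntegral.integral_ofReal] at h
  rw [← intervalIntegral.integral_sub (hi _) (hi _), ← intervalIntegral.integral_const_mul,
    ← intervalIntegral.integral_const_mul,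
    ← intervalIntegral.integral_add ((hi _).sub (hi _)) ((hi _).const_mul _),
    ← intervalIntegral.integral_sub (((hi _).sub (hi _)).add ((hi _).const_mul _))
      ((hi _).const_mul _), ← intervalIntegral.integral_div] at h
  simpa only [one_mul, neg_mul, sub_eq_add_neg, Pi.add_apply, Pi.neg_apply] using h

end Geo

theorem integral_swap {E : Type*} [NormedAddCommGroup E] [NormedSpace ℝ E]
    {F : ℝ × ℝ → E} (hF : Continuous F) (a b c d : ℝ) :
    ∫ x in a..b, ∫ y in c..d, F (x, y) = ∫ y in c..d, ∫ x in a..b, F (x, y) := by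
  refine intervalIntegral_intervalIntegral_swap (F := fun x y => F (x, y)) ?_
  exact (hF.continuousOn.integrableOn_compact (isCompact_uIcc.prod isCompact_uIcc)).mono_set
    (Set.prod_mono Set.uIoc_subset_uIcc Set.uIoc_subset_uIcc)

namespace Geo
variable (g : Geo)

/-- Lebesgue measure on `(0, L] × (0, H]`. -/
noncomputable def box : Measure (ℝ × ℝ) :=
  (volume.restrict (Set.Ioc 0 g.L)).prod (volume.restrict (Set.Ioc 0 g.H))

theorem box_eq : g.box = volume.restrict (Set.Ioc 0 g.L ×ˢ Set.Ioc 0 g.H) := by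
  rw [box, Measure.prod_restrict]; rfl

theorem integrable_box {E : Type*} [NormedAddCommGroup E] {F : ℝ × ℝ → E} (hF : Continuous F) :
    Integrable F g.box := by
  rw [box_eq]
  exact (hF.continuousOn.integrableOn_compact (isCompact_Icc.prod isCompact_Icc)).mono_set
    (Set.prod_mono Set.Ioc_subset_Icc_self Set.Ioc_subset_Icc_self)

variable {E : Type*} [NormedAddCommGroup E] [NormedSpace ℝ E]

theorem integral_box {F : ℝ × ℝ → E} (hF : Continuous F) :
    ∫ p, F p ∂g.box = ∫ y in (0 : ℝ)..g.H, ∫ x in (0 : ℝ)..g.L, F (x, y) := by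
  rw [intervalIntegral.integral_of_le g.H_pos.le]
  simp only [intervalIntegral.integral_of_le g.L_pos.le]
  exact integral_prod_symm _ (g.integrable_box hF)

theorem integral_box' {F : ℝ × ℝ → E} (hF : Continuous F) :
    ∫ p, F p ∂g.box = ∫ x in (0 : ℝ)..g.L, ∫ y in (0 : ℝ)..g.H, F (x, y) := by
  rw [integral_box g hF, integral_swap hF]

/-- A triple `(u, u_x, u_y)` of a continuously differentiable quasi-periodic function vanishing
near and below the profile. -/
structure IsTest (u : (ℝ × ℝ → ℂ) × (ℝ × ℝ → ℂ) × (ℝ × ℝ → ℂ)) : Prop where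
  cont : Continuous u.1
  contx : Continuous u.2.1
  conty : Continuous u.2.2
  derivx : ∀ x y, HasDerivAt (fun t => u.1 (t, y)) (u.2.1 (x, y)) x
  derivy : ∀ x y, HasDerivAt (fun t => u.1 (x, t)) (u.2.2 (x, y)) y
  qper : ∀ x y, u.1 (x + g.L, y) = g.nu * u.1 (x, y)
  zero : ∃ δ > 0, ∀ x y, y < g.f x + δ → u.1 (x, y) = 0

/-- The space of test functions. -/
def V : Submodule ℂ ((ℝ × ℝ → ℂ) × (ℝ × ℝ → ℂ) × (ℝ × ℝ → ℂ)) where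
  carrier := {u | g.IsTest u}
  zero_mem' :=
    { cont := continuous_const
      contx := continuous_const
      conty := continuous_const
      derivx := fun x y => hasDerivAt_const x 0
      derivy := fun x y => hasDerivAt_const y 0
      qper := fun x y => by simp
      zero := ⟨1, one_pos, fun x y _ => rfl⟩ }
  add_mem' := by
    rintro u w ⟨a1, a2, a3, a4, a5, a6, δ, hδ, a7⟩ ⟨b1, b2, b3, b4, b5, b6, δ', hδ', b7⟩
    refine ⟨a1.add b1, a2.add b2, a3.add b3, fun x y => (a4 x y).add (b4 x y),
      fun x y => (a5 x y).add (b5 x y), fun x y => ?_, min δ δ', lt_min hδ hδ', fun x y h => ?_⟩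
    · change u.1 (x + g.L, y) + w.1 (x + g.L, y) = g.nu * (u.1 (x, y) + w.1 (x, y))
      rw [a6, b6, mul_add]
    · change u.1 (x, y) + w.1 (x, y) = 0
      rw [a7 x y (h.trans_le (by gcongr; exact min_le_left _ _)),
        b7 x y (h.trans_le (by gcongr; exact min_le_right _ _)), add_zero]
  smul_mem' := by
    rintro c u ⟨a1, a2, a3, a4, a5, a6, δ, hδ, a7⟩
    refine ⟨a1.const_smul c, a2.const_smul c, a3.const_smul c, fun x y => (a4 x y).const_smul c,
      fun x y => (a5 x y).const_smul c, fun x y => ?_, δ, hδ, fun x y h => ?_⟩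
    · change c * u.1 (x + g.L, y) = g.nu * (c * u.1 (x, y))
      rw [a6]; ring
    · change c * u.1 (x, y) = 0
      rw [a7 x y h, mul_zero]

variable {g}

/-- The function underlying a test triple. -/
def fn (v : g.V) : ℝ × ℝ → ℂ := v.1.1
def dx (v : g.V) : ℝ × ℝ → ℂ := v.1.2.1
def dy (v : g.V) : ℝ × ℝ → ℂ := v.1.2.2

@[simp] theorem fn_add (v w : g.V) (p) : fn (v + w) p = fn v p + fn w p := rfl
@[simp] theorem dx_add (v w : g.V) (p) : dx (v + w) p = dx v p + dx w p := rfl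
@[simp] theorem dy_add (v w : g.V) (p) : dy (v + w) p = dy v p + dy w p := rfl
@[simp] theorem fn_sub (v w : g.V) (p) : fn (v - w) p = fn v p - fn w p := rfl
@[simp] theorem dx_sub (v w : g.V) (p) : dx (v - w) p = dx v p - dx w p := rfl
@[simp] theorem dy_sub (v w : g.V) (p) : dy (v - w) p = dy v p - dy w p := rfl
@[simp] theorem fn_smul (c : ℂ) (v : g.V) (p) : fn (c • v) p = c * fn v p := rfl
@[simp] theorem dx_smul (c : ℂ) (v : g.V) (p) : dx (c • v) p = c * dx v p := rfl
@[simp] theorem dy_smul (c : ℂ) (v : g.V) (p) : dy (c • v) p = c * dy v p := rfl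

@[fun_prop] theorem continuous_fn (v : g.V) : Continuous (fn v) := v.2.cont
@[fun_prop] theorem continuous_dx (v : g.V) : Continuous (dx v) := v.2.contx
@[fun_prop] theorem continuous_dy (v : g.V) : Continuous (dy v) := v.2.conty
theorem hasDerivAt_fn_x (v : g.V) (x y : ℝ) :
    HasDerivAt (fun t => fn v (t, y)) (dx v (x, y)) x := v.2.derivx x y
theorem hasDerivAt_fn_y (v : g.V) (x y : ℝ) :
    HasDerivAt (fun t => fn v (x, t)) (dy v (x, y)) y := v.2.derivy x y
theorem fn_add_L (v : g.V) (x y : ℝ) : fn v (x + g.L, y) = g.nu * fn v (x, y) := v.2.qper x y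

theorem exists_zero (v : g.V) : ∃ δ > 0, ∀ x y, y < g.f x + δ →
    fn v (x, y) = 0 ∧ dx v (x, y) = 0 ∧ dy v (x, y) = 0 := by
  obtain ⟨δ, hδ, h⟩ := v.2.zero
  refine ⟨δ, hδ, fun x y hy => ⟨h x y hy, ?_, ?_⟩⟩
  · refine (hasDerivAt_fn_x v x y).unique ((hasDerivAt_const x (0 : ℂ)).congr_of_eventuallyEq ?_)
    have : ∀ᶠ t in nhds x, y < g.f t + δ :=
      (g.lip.continuous.add continuous_const).continuousAt.eventually_const_lt hy
    filter_upwards [this] with t ht using h t y ht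
  · refine (hasDerivAt_fn_y v x y).unique ((hasDerivAt_const y (0 : ℂ)).congr_of_eventuallyEq ?_)
    filter_upwards [Iio_mem_nhds hy] with t ht using h x t ht

theorem zero_of_nonpos (v : g.V) (x : ℝ) {y : ℝ} (hy : y ≤ 0) :
    fn v (x, y) = 0 ∧ dx v (x, y) = 0 ∧ dy v (x, y) = 0 := by
  obtain ⟨δ, hδ, h⟩ := exists_zero v
  exact h x y (by linarith [g.nonneg x])

/-- The semi-inner product of the test space. -/
noncomputable def ip (v w : g.V) : ℂ :=
  ∫ p, (conj (fn v p) * fn w p + conj (dx v p) * dx w p + conj (dy v p) * dy w p) ∂g.box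

/-- The square of the energy norm. -/
noncomputable def nsq (v : g.V) : ℝ :=
  ∫ p, (‖fn v p‖ ^ 2 + ‖dx v p‖ ^ 2 + ‖dy v p‖ ^ 2) ∂g.box

theorem nsq_nonneg (v : g.V) : 0 ≤ nsq v := integral_nonneg fun p => by positivity

theorem ip_self (v : g.V) : ip v v = (nsq v : ℝ) := by
  rw [ip, nsq, ← integral_complex_ofReal]
  congr 1
  funext p
  simp only [← Complex.normSq_eq_conj_mul_self, Complex.normSq_eq_norm_sq]
  push_cast; ring

@[reducible] noncomputable def core : PreInnerProductSpace.Core ℂ g.V where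
  inner := ip
  conj_inner_symm := by
    intro v w
    rw [ip, ip, ← integral_conj]
    congr 1; funext p
    simp only [map_add, map_mul, Complex.conj_conj]
    ring
  re_inner_nonneg := by
    intro v
    rw [ip_self]; exact nsq_nonneg v
  add_left := by
    intro u v w
    rw [ip, ip, ip, ← integral_add]
    · congr 1; funext p
      simp only [fn_add, dx_add, dy_add, map_add]
      ring
    all_goals exact g.integrable_box (by fun_prop)
  smul_left := by
    intro v w c
    rw [ip, ip, ← integral_const_mul]
    congr 1; funext p
    simp only [fn_smul, dx_smul, dy_smul, map_mul]
    ring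

/-- The energy norm. -/
noncomputable def nrm (v : g.V) : ℝ := Real.sqrt (nsq v)

theorem nrm_nonneg (v : g.V) : 0 ≤ nrm v := Real.sqrt_nonneg _
theorem nrm_sq (v : g.V) : nrm v ^ 2 = nsq v := Real.sq_sqrt (nsq_nonneg v)

theorem nrm_eq (v : g.V) : nrm v = Real.sqrt ((core (g := g)).inner v v).re := by
  change _ = Real.sqrt (ip v v).re
  rw [ip_self]; rfl

/-- Fourier coefficients of the horizontal slices of `v`. -/
noncomputable def q (v : g.V) (j : ℤ) (y : ℝ) : ℂ := g.coef (fun x => fn v (x, y)) j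
/-- Fourier coefficients of the horizontal slices of `∂_y v`. -/
noncomputable def pd (v : g.V) (j : ℤ) (y : ℝ) : ℂ := g.coef (fun x => dy v (x, y)) j

theorem continuous_coef {F : ℝ × ℝ → ℂ} (hF : Continuous F) (j : ℤ) :
    Continuous fun y => g.coef (fun x => F (x, y)) j :=
  continuous_intervalIntegral_param (F := fun p => F p * conj (g.phi j p.1)) (by fun_prop) _ _

@[fun_prop] theorem continuous_q (v : g.V) (j : ℤ) : Continuous (q v j) :=
  continuous_coef (continuous_fn v) j
@[fun_prop] theorem continuous_pd (v : g.V) (j : ℤ) : Continuous (pd v j) :=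
  continuous_coef (continuous_dy v) j

theorem q_eq_integral (v : g.V) (j : ℤ) (y : ℝ) : q v j y = ∫ t in (0 : ℝ)..y, pd v j t := by
  have h1 : ∀ x, fn v (x, y) = ∫ t in (0 : ℝ)..y, dy v (x, t) := by
    intro x
    rw [intervalIntegral.integral_eq_sub_of_hasDerivAt (f := fun t => fn v (x, t))
      (fun t _ => hasDerivAt_fn_y v x t)
      (Continuous.intervalIntegrable (by fun_prop) _ _), (zero_of_nonpos v x le_rfl).1, sub_zero]
  unfold q pd coef
  rw [← integral_swap (F := fun p => dy v p * conj (g.phi j p.1)) (by fun_prop)]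
  refine intervalIntegral.integral_congr fun x _ => ?_
  simp only [h1 x]
  rw [← intervalIntegral.integral_mul_const]

theorem hasDerivAt_q (v : g.V) (j : ℤ) (y : ℝ) : HasDerivAt (q v j) (pd v j y) y := by
  have : q v j = fun y => ∫ t in (0 : ℝ)..y, pd v j t := funext (q_eq_integral v j)
  rw [this]
  exact intervalIntegral.integral_hasDerivAt_right
    ((continuous_pd v j).intervalIntegrable _ _)
    ((continuous_pd v j).stronglyMeasurableAtFilter _ _) (continuous_pd v j).continuousAt

/-- Fourier coefficients of the tangential derivative of a quasi-periodic function. -/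
theorem coef_deriv {u u' : ℝ → ℂ} (hu : ∀ x, HasDerivAt u (u' x) x) (hu' : Continuous u')
    (hL : u g.L = g.nu * u 0) (j : ℤ) :
    g.coef u' j = Complex.I * g.lam j * g.coef u j := by
  have hcu : Continuous u := continuous_iff_continuousAt.2 fun x => (hu x).continuousAt
  have hφ : ∀ x, HasDerivAt (fun x => conj (g.phi j x))
      (-(Complex.I * g.lam j) * conj (g.phi j x)) x := by
    intro x
    have := (g.hasDerivAt_phi j x).star
    refine this.congr_deriv ?_
    simp
  have h := intervalIntegral.integral_mul_deriv_eq_deriv_mul (a := 0) (b := g.L)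
    (u := fun x => conj (g.phi j x)) (v := u) (fun x _ => hφ x) (fun x _ => hu x)
    (Continuous.intervalIntegrable (by fun_prop) _ _)
    (Continuous.intervalIntegrable (by fun_prop) _ _)
  have hφL : g.phi j g.L = g.nu * g.phi j 0 := by
    have := g.phi_add_L j 0
    rwa [zero_add] at this
  have e : conj (g.phi j g.L) * u g.L = conj (g.phi j 0) * u 0 := by
    rw [hφL, hL, map_mul]
    linear_combination (conj (g.phi j 0) * u 0) * g.nu_mul_conj
  rw [e, sub_self, zero_sub] at h
  unfold coef
  rw [← intervalIntegral.integral_const_mul]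
  have h1 : ∫ x in (0 : ℝ)..g.L, u' x * conj (g.phi j x)
      = ∫ x in (0 : ℝ)..g.L, conj (g.phi j x) * u' x := by
    simp only [mul_comm]
  rw [h1, h, ← intervalIntegral.integral_neg]
  congr 1; funext x
  ring

theorem coef_dx (v : g.V) (j : ℤ) (y : ℝ) :
    g.coef (fun x => dx v (x, y)) j = Complex.I * g.lam j * q v j y := by
  refine coef_deriv (fun x => hasDerivAt_fn_x v x y) (by fun_prop) ?_ j
  have := fn_add_L v 0 y
  rwa [zero_add] at this

/-! ### Energy densities -/

noncomputable def Qd (v : g.V) (y : ℝ) : ℝ := ∫ x in (0 : ℝ)..g.L, ‖fn v (x, y)‖ ^ 2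
noncomputable def Xd (v : g.V) (y : ℝ) : ℝ := ∫ x in (0 : ℝ)..g.L, ‖dx v (x, y)‖ ^ 2
noncomputable def Pd (v : g.V) (y : ℝ) : ℝ := ∫ x in (0 : ℝ)..g.L, ‖dy v (x, y)‖ ^ 2

@[fun_prop] theorem continuous_Qd (v : g.V) : Continuous (Qd v) :=
  continuous_intervalIntegral_param (F := fun p => ‖fn v p‖ ^ 2) (by fun_prop) _ _
@[fun_prop] theorem continuous_Xd (v : g.V) : Continuous (Xd v) :=
  continuous_intervalIntegral_param (F := fun p => ‖dx v p‖ ^ 2) (by fun_prop) _ _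
@[fun_prop] theorem continuous_Pd (v : g.V) : Continuous (Pd v) :=
  continuous_intervalIntegral_param (F := fun p => ‖dy v p‖ ^ 2) (by fun_prop) _ _

theorem Qd_nonneg (v : g.V) (y : ℝ) : 0 ≤ Qd v y :=
  intervalIntegral.integral_nonneg g.L_pos.le fun _ _ => by positivity
theorem Xd_nonneg (v : g.V) (y : ℝ) : 0 ≤ Xd v y :=
  intervalIntegral.integral_nonneg g.L_pos.le fun _ _ => by positivity
theorem Pd_nonneg (v : g.V) (y : ℝ) : 0 ≤ Pd v y :=
  intervalIntegral.integral_nonneg g.L_pos.le fun _ _ => by positivity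

theorem dens_zero (v : g.V) {y : ℝ} (hy : y ≤ 0) : Qd v y = 0 ∧ Xd v y = 0 ∧ Pd v y = 0 := by
  simp [Qd, Xd, Pd, zero_of_nonpos v _ hy]

theorem hasSum_Qd (v : g.V) (y : ℝ) : HasSum (fun j => ‖q v j y‖ ^ 2) (Qd v y) :=
  g.hasSum_norm_coef_sq (by fun_prop)
theorem hasSum_Pd (v : g.V) (y : ℝ) : HasSum (fun j => ‖pd v j y‖ ^ 2) (Pd v y) :=
  g.hasSum_norm_coef_sq (by fun_prop)
theorem hasSum_Xd (v : g.V) (y : ℝ) :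
    HasSum (fun j => g.lam j ^ 2 * ‖q v j y‖ ^ 2) (Xd v y) := by
  have := g.hasSum_norm_coef_sq (u := fun x => dx v (x, y)) (by fun_prop)
  refine this.congr_fun fun j => ?_
  rw [coef_dx, norm_mul, norm_mul, mul_pow, mul_pow]
  simp

theorem integral_Qd (v : g.V) : ∫ y in (0 : ℝ)..g.H, Qd v y = ∫ p, ‖fn v p‖ ^ 2 ∂g.box :=
  (g.integral_box (F := fun p => ‖fn v p‖ ^ 2) (by fun_prop)).symm
theorem integral_Xd (v : g.V) : ∫ y in (0 : ℝ)..g.H, Xd v y = ∫ p, ‖dx v p‖ ^ 2 ∂g.box :=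
  (g.integral_box (F := fun p => ‖dx v p‖ ^ 2) (by fun_prop)).symm
theorem integral_Pd (v : g.V) : ∫ y in (0 : ℝ)..g.H, Pd v y = ∫ p, ‖dy v p‖ ^ 2 ∂g.box :=
  (g.integral_box (F := fun p => ‖dy v p‖ ^ 2) (by fun_prop)).symm

theorem nsq_eq (v : g.V) : nsq v = (∫ y in (0 : ℝ)..g.H, Qd v y) + (∫ y in (0 : ℝ)..g.H, Xd v y)
    + ∫ y in (0 : ℝ)..g.H, Pd v y := by
  rw [integral_Qd, integral_Xd, integral_Pd, nsq]
  have i1 := g.integrable_box (F := fun p => ‖fn v p‖ ^ 2) (by fun_prop)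
  have i2 := g.integrable_box (F := fun p => ‖dx v p‖ ^ 2) (by fun_prop)
  have i3 := g.integrable_box (F := fun p => ‖dy v p‖ ^ 2) (by fun_prop)
  rw [integral_add (f := fun p => ‖fn v p‖ ^ 2 + ‖dx v p‖ ^ 2) (i1.add i2) i3, integral_add i1 i2]

theorem int_nonneg {F : ℝ → ℝ} {a b : ℝ} (hab : a ≤ b) (h : ∀ y, 0 ≤ F y) :
    0 ≤ ∫ y in a..b, F y := intervalIntegral.integral_nonneg hab fun y _ => h y

theorem int_Qd_le (v : g.V) : ∫ y in (0 : ℝ)..g.H, Qd v y ≤ nsq v := by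
  have := int_nonneg g.H_pos.le (Xd_nonneg v); have := int_nonneg g.H_pos.le (Pd_nonneg v)
  rw [nsq_eq]; linarith
theorem int_Pd_le (v : g.V) : ∫ y in (0 : ℝ)..g.H, Pd v y ≤ nsq v := by
  have := int_nonneg g.H_pos.le (Xd_nonneg v); have := int_nonneg g.H_pos.le (Qd_nonneg v)
  rw [nsq_eq]; linarith

end Geo

theorem le_mul_of_forall_scaling {x c A B : ℝ} (hA : 0 ≤ A) (hB : 0 ≤ B) (hc : 0 ≤ c)
    (h : ∀ t : ℝ, 0 < t → x ≤ c * (t * A ^ 2 + t⁻¹ * B ^ 2) / 2) : x ≤ c * A * B := by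
  have key : ∀ δ : ℝ, 0 < δ → x ≤ c * A * B + c * (A + B) * δ / 2 := by
    intro δ hδ
    have h1 : 0 < A + δ := by linarith
    have h2 : 0 < B + δ := by linarith
    refine (h ((B + δ) / (A + δ)) (by positivity)).trans ?_
    have e1 : (B + δ) / (A + δ) * A ^ 2 ≤ (B + δ) * A := by
      rw [div_mul_eq_mul_div, div_le_iff₀ h1]
      nlinarith [mul_nonneg (mul_nonneg h2.le hA) hδ.le]
    have e2 : ((B + δ) / (A + δ))⁻¹ * B ^ 2 ≤ (A + δ) * B := by
      rw [inv_div, div_mul_eq_mul_div, div_le_iff₀ h2]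
      nlinarith [mul_nonneg (mul_nonneg h1.le hB) hδ.le]
    nlinarith [mul_le_mul_of_nonneg_left (add_le_add e1 e2) hc]
  have : Filter.Tendsto (fun δ : ℝ => c * A * B + c * (A + B) * δ / 2)
      (nhdsWithin 0 (Set.Ioi 0)) (nhds (c * A * B + c * (A + B) * 0 / 2)) :=
    (Continuous.tendsto (by fun_prop) 0).mono_left nhdsWithin_le_nhds
  have h3 := ge_of_tendsto this (Filter.eventually_of_mem self_mem_nhdsWithin
    (fun δ hδ => key δ hδ))
  simpa using h3

theorem mul_le_scaling {a b t : ℝ} (ht : 0 < t) : a * b ≤ (t * a ^ 2 + t⁻¹ * b ^ 2) / 2 := by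
  have : 0 ≤ t⁻¹ * (t * a - b) ^ 2 := by positivity
  have e : t⁻¹ * (t * a - b) ^ 2 = t * a ^ 2 + t⁻¹ * b ^ 2 - 2 * (a * b) := by
    field_simp; ring
  linarith

namespace Geo
variable {g : Geo}

/-! ### The sesquilinear form -/

noncomputable def eform (v z : g.V) : ℂ :=
  ∫ p, (dx v p * conj (dx z p) + dy v p * conj (dy z p) - g.k ^ 2 * (fn v p * conj (fn z p))) ∂g.box

noncomputable def bform (v z : g.V) : ℂ := ∑' j, g.m j * (q v j g.H * conj (q z j g.H))

noncomputable def aform (v z : g.V) : ℂ := eform v z + bform v z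

noncomputable def esq (v : g.V) : ℝ :=
  (∫ y in (0 : ℝ)..g.H, Xd v y) + (∫ y in (0 : ℝ)..g.H, Pd v y)
    - g.k ^ 2 * ∫ y in (0 : ℝ)..g.H, Qd v y

theorem eform_self (v : g.V) : eform v v = (esq v : ℝ) := by
  have i1 := g.integrable_box (F := fun p => ‖fn v p‖ ^ 2) (by fun_prop)
  have i2 := g.integrable_box (F := fun p => ‖dx v p‖ ^ 2) (by fun_prop)
  have i3 := g.integrable_box (F := fun p => ‖dy v p‖ ^ 2) (by fun_prop)
  have : esq v = ∫ p, (‖dx v p‖ ^ 2 + ‖dy v p‖ ^ 2 - g.k ^ 2 * ‖fn v p‖ ^ 2) ∂g.box := by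
    rw [integral_sub (f := fun p => ‖dx v p‖ ^ 2 + ‖dy v p‖ ^ 2) (i2.add i3) (i1.const_mul _),
      integral_add i2 i3, integral_const_mul, esq, integral_Qd, integral_Xd, integral_Pd]
  rw [this, eform, ← integral_complex_ofReal]
  congr 1
  funext p
  simp only [Complex.mul_conj, Complex.normSq_eq_norm_sq]
  push_cast; ring

theorem q_add (v w : g.V) (j : ℤ) (y : ℝ) : q (v + w) j y = q v j y + q w j y :=
  g.coef_add (u := fun x => fn v (x, y)) (w := fun x => fn w (x, y)) (by fun_prop) (by fun_prop) j
theorem q_smul (c : ℂ) (v : g.V) (j : ℤ) (y : ℝ) : q (c • v) j y = c * q v j y :=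
  g.coef_const_mul c _ j
theorem pd_add (v w : g.V) (j : ℤ) (y : ℝ) : pd (v + w) j y = pd v j y + pd w j y :=
  g.coef_add (u := fun x => dy v (x, y)) (w := fun x => dy w (x, y)) (by fun_prop) (by fun_prop) j
theorem eform_add_left (v w z : g.V) : eform (v + w) z = eform v z + eform w z := by
  rw [eform, eform, eform, ← integral_add]
  · congr 1; funext p
    simp only [fn_add, dx_add, dy_add]; ring
  all_goals exact g.integrable_box (by fun_prop)

theorem eform_smul_left (c : ℂ) (v z : g.V) : eform (c • v) z = c * eform v z := by
  rw [eform, eform, ← integral_const_mul]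
  congr 1; funext p
  simp only [fn_smul, dx_smul, dy_smul]; ring

theorem eform_conj (v z : g.V) : conj (eform v z) = eform z v := by
  rw [eform, eform, ← integral_conj]
  congr 1; funext p
  simp only [map_add, map_sub, map_mul, Complex.conj_conj, map_pow, Complex.conj_ofReal]; ring

theorem eform_add_right (v w z : g.V) : eform v (w + z) = eform v w + eform v z := by
  rw [← eform_conj, eform_add_left, map_add, eform_conj, eform_conj]

theorem eform_smul_right (c : ℂ) (v z : g.V) : eform v (c • z) = conj c * eform v z := by
  rw [← eform_conj, eform_smul_left, map_mul, eform_conj]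

theorem q_zero_le (v : g.V) (j : ℤ) {y : ℝ} (hy : y ≤ 0) : q v j y = 0 := by
  simp [q, coef, zero_of_nonpos v _ hy]

theorem sq_trace_le (v : g.V) (j : ℤ) {t : ℝ} (ht : 0 ≤ t) :
    t * ‖q v j g.H‖ ^ 2 ≤ ∫ y in (0 : ℝ)..g.H, (t ^ 2 * ‖q v j y‖ ^ 2 + ‖pd v j y‖ ^ 2) := by
  have h := intervalIntegral.integral_eq_sub_of_hasDerivAt (a := 0) (b := g.H)
    (f := fun y => ‖q v j y‖ ^ 2) (fun y _ => (hasDerivAt_q v j y).norm_sq)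
    (Continuous.intervalIntegrable (by fun_prop) _ _)
  rw [q_zero_le v j le_rfl] at h
  simp only [norm_zero, ne_eq, OfNat.ofNat_ne_zero, not_false_eq_true, zero_pow, sub_zero] at h
  rw [← h, ← intervalIntegral.integral_const_mul]
  refine intervalIntegral.integral_mono_on g.H_pos.le
    (Continuous.intervalIntegrable (by fun_prop) _ _)
    (Continuous.intervalIntegrable (by fun_prop) _ _) fun y _ => ?_
  have h1 : inner ℝ (q v j y) (pd v j y) ≤ ‖q v j y‖ * ‖pd v j y‖ := real_inner_le_norm _ _
  have h2 := mul_le_mul_of_nonneg_left h1 ht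
  nlinarith [sq_nonneg (t * ‖q v j y‖ - ‖pd v j y‖)]

theorem norm_q_sq_le_Qd (v : g.V) (j : ℤ) (y : ℝ) : ‖q v j y‖ ^ 2 ≤ Qd v y :=
  le_hasSum (hasSum_Qd v y) j fun _ _ => by positivity
theorem norm_pd_sq_le_Pd (v : g.V) (j : ℤ) (y : ℝ) : ‖pd v j y‖ ^ 2 ≤ Pd v y :=
  le_hasSum (hasSum_Pd v y) j fun _ _ => by positivity

theorem norm_trace_le (v : g.V) (j : ℤ) : ‖q v j g.H‖ ≤ nrm v := by
  refine Real.le_sqrt_of_sq_le ?_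
  have h := sq_trace_le v j zero_le_one
  rw [one_mul] at h
  refine h.trans ?_
  have : ∫ y in (0 : ℝ)..g.H, (1 ^ 2 * ‖q v j y‖ ^ 2 + ‖pd v j y‖ ^ 2)
      ≤ ∫ y in (0 : ℝ)..g.H, (Qd v y + Pd v y) := by
    refine intervalIntegral.integral_mono_on g.H_pos.le
      (Continuous.intervalIntegrable (by fun_prop) _ _)
      (Continuous.intervalIntegrable (by fun_prop) _ _) fun y _ => ?_
    linarith [norm_q_sq_le_Qd v j y, norm_pd_sq_le_Pd v j y]
  rw [intervalIntegral.integral_add ((continuous_Qd v).intervalIntegrable _ _)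
    ((continuous_Pd v).intervalIntegrable _ _)] at this
  rw [nsq_eq]
  linarith [int_nonneg g.H_pos.le (Xd_nonneg v)]

theorem sum_modes_le (v : g.V) (F : Finset ℤ) (y : ℝ) :
    ∑ j ∈ F, (‖g.m j‖ ^ 2 * ‖q v j y‖ ^ 2 + ‖pd v j y‖ ^ 2)
      ≤ Xd v y + g.k ^ 2 * Qd v y + Pd v y := by
  have h := ((hasSum_Xd v y).add ((hasSum_Qd v y).mul_left (g.k ^ 2))).add (hasSum_Pd v y)
  refine le_trans (Finset.sum_le_sum fun j _ => ?_) (sum_le_hasSum F (fun j _ => by positivity) h)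
  nlinarith [g.norm_m_sq_le j, sq_nonneg ‖q v j y‖]

theorem int_modes_le (v : g.V) :
    ∫ y in (0 : ℝ)..g.H, (Xd v y + g.k ^ 2 * Qd v y + Pd v y) ≤ (1 + g.k ^ 2) * nsq v := by
  have hX : IntervalIntegrable (Xd v) volume 0 g.H := (continuous_Xd v).intervalIntegrable _ _
  have hQ : IntervalIntegrable (Qd v) volume 0 g.H := (continuous_Qd v).intervalIntegrable _ _
  have hP : IntervalIntegrable (Pd v) volume 0 g.H := (continuous_Pd v).intervalIntegrable _ _
  rw [intervalIntegral.integral_add (f := fun y => Xd v y + g.k ^ 2 * Qd v y)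
    (hX.add (hQ.const_mul _)) hP, intervalIntegral.integral_add hX (hQ.const_mul _),
    intervalIntegral.integral_const_mul]
  have h1 := int_nonneg g.H_pos.le (Xd_nonneg v)
  have h2 := int_nonneg g.H_pos.le (Pd_nonneg v)
  have h3 := int_nonneg g.H_pos.le (Qd_nonneg v)
  have h4 := int_Qd_le v
  have h5 := nsq_eq v
  nlinarith [sq_nonneg g.k]

theorem sum_trace_le (v : g.V) (F : Finset ℤ) :
    ∑ j ∈ F, ‖g.m j‖ * ‖q v j g.H‖ ^ 2 ≤ (1 + g.k ^ 2) * nsq v := by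
  calc _ ≤ ∑ j ∈ F, ∫ y in (0 : ℝ)..g.H, (‖g.m j‖ ^ 2 * ‖q v j y‖ ^ 2 + ‖pd v j y‖ ^ 2) :=
        Finset.sum_le_sum fun j _ => sq_trace_le v j (norm_nonneg _)
    _ = ∫ y in (0 : ℝ)..g.H, ∑ j ∈ F, (‖g.m j‖ ^ 2 * ‖q v j y‖ ^ 2 + ‖pd v j y‖ ^ 2) := by
        rw [intervalIntegral.integral_finsetSum]
        exact fun j _ => Continuous.intervalIntegrable (by fun_prop) _ _
    _ ≤ ∫ y in (0 : ℝ)..g.H, (Xd v y + g.k ^ 2 * Qd v y + Pd v y) := by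
        refine intervalIntegral.integral_mono_on g.H_pos.le
          (Continuous.intervalIntegrable (by fun_prop) _ _)
          (Continuous.intervalIntegrable (by fun_prop) _ _) fun y _ => sum_modes_le v F y
    _ ≤ _ := int_modes_le v

theorem summable_trace (v : g.V) : Summable fun j => ‖g.m j‖ * ‖q v j g.H‖ ^ 2 :=
  summable_of_sum_le (fun _ => by positivity) (sum_trace_le v)

theorem tsum_trace_le (v : g.V) : ∑' j, ‖g.m j‖ * ‖q v j g.H‖ ^ 2 ≤ (1 + g.k ^ 2) * nsq v :=
  (summable_trace v).tsum_le_of_sum_le (sum_trace_le v)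

theorem norm_bterm_le (v z : g.V) (j : ℤ) {t : ℝ} (ht : 0 < t) :
    ‖g.m j * (q v j g.H * conj (q z j g.H))‖
      ≤ (t * (‖g.m j‖ * ‖q v j g.H‖ ^ 2) + t⁻¹ * (‖g.m j‖ * ‖q z j g.H‖ ^ 2)) / 2 := by
  rw [norm_mul, norm_mul, Complex.norm_conj]
  have := mul_le_mul_of_nonneg_left
    (mul_le_scaling (a := ‖q v j g.H‖) (b := ‖q z j g.H‖) ht) (norm_nonneg (g.m j))
  linarith

theorem summable_bform (v z : g.V) :
    Summable fun j => g.m j * (q v j g.H * conj (q z j g.H)) := by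
  refine Summable.of_norm_bounded ((((summable_trace v).mul_left 1).add
    ((summable_trace z).mul_left 1⁻¹)).div_const 2) fun j => ?_
  exact norm_bterm_le v z j one_pos

theorem bform_add_left (v w z : g.V) : bform (v + w) z = bform v z + bform w z := by
  rw [bform, bform, bform, ← (summable_bform v z).tsum_add (summable_bform w z)]
  congr 1; funext j
  rw [q_add]; ring

theorem bform_add_right (v w z : g.V) : bform v (w + z) = bform v w + bform v z := by
  rw [bform, bform, bform, ← (summable_bform v w).tsum_add (summable_bform v z)]
  congr 1; funext j
  rw [q_add, map_add]; ring

theorem bform_smul_left (c : ℂ) (v z : g.V) : bform (c • v) z = c * bform v z := by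
  rw [bform, bform, ← tsum_mul_left]
  congr 1; funext j
  rw [q_smul]; ring

theorem bform_smul_right (c : ℂ) (v z : g.V) : bform v (c • z) = conj c * bform v z := by
  rw [bform, bform, ← tsum_mul_left]
  congr 1; funext j
  rw [q_smul, map_mul]; ring

theorem norm_bform_le (v z : g.V) {t : ℝ} (ht : 0 < t) :
    ‖bform v z‖ ≤ (1 + g.k ^ 2) * (t * nrm v ^ 2 + t⁻¹ * nrm z ^ 2) / 2 := by
  have hs := (((summable_trace v).mul_left t).add ((summable_trace z).mul_left t⁻¹)).div_const 2
  have h1 : ‖bform v z‖ ≤ ∑' j, (t * (‖g.m j‖ * ‖q v j g.H‖ ^ 2)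
      + t⁻¹ * (‖g.m j‖ * ‖q z j g.H‖ ^ 2)) / 2 :=
    tsum_of_norm_bounded hs.hasSum fun j => norm_bterm_le v z j ht
  rw [tsum_div_const, ((summable_trace v).mul_left t).tsum_add ((summable_trace z).mul_left t⁻¹),
    tsum_mul_left, tsum_mul_left] at h1
  rw [nrm_sq, nrm_sq]
  have h2 := mul_le_mul_of_nonneg_left (tsum_trace_le v) ht.le
  have h3 := mul_le_mul_of_nonneg_left (tsum_trace_le z) (inv_pos.2 ht).le
  linarith

theorem norm_eform_le (v z : g.V) {t : ℝ} (ht : 0 < t) :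
    ‖eform v z‖ ≤ (1 + g.k ^ 2) * (t * nrm v ^ 2 + t⁻¹ * nrm z ^ 2) / 2 := by
  have h1 : ‖eform v z‖ ≤ ∫ p, (1 + g.k ^ 2) / 2 * (t * (‖fn v p‖ ^ 2 + ‖dx v p‖ ^ 2 + ‖dy v p‖ ^ 2)
      + t⁻¹ * (‖fn z p‖ ^ 2 + ‖dx z p‖ ^ 2 + ‖dy z p‖ ^ 2)) ∂g.box := by
    refine norm_integral_le_of_norm_le (g.integrable_box (by fun_prop))
      (Filter.Eventually.of_forall fun p => ?_)
    have e0 : ‖dx v p * conj (dx z p) + dy v p * conj (dy z p)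
        - g.k ^ 2 * (fn v p * conj (fn z p))‖
        ≤ ‖dx v p‖ * ‖dx z p‖ + ‖dy v p‖ * ‖dy z p‖ + g.k ^ 2 * (‖fn v p‖ * ‖fn z p‖) := by
      refine (norm_sub_le _ _).trans (add_le_add ((norm_add_le _ _).trans (add_le_add ?_ ?_)) ?_)
      all_goals simp
    have e1 := mul_le_scaling (a := ‖fn v p‖) (b := ‖fn z p‖) ht
    have e2 := mul_le_scaling (a := ‖dx v p‖) (b := ‖dx z p‖) ht
    have e3 := mul_le_scaling (a := ‖dy v p‖) (b := ‖dy z p‖) ht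
    have hk := sq_nonneg g.k
    have p1 : 0 ≤ (t * ‖fn v p‖ ^ 2 + t⁻¹ * ‖fn z p‖ ^ 2) / 2 := by positivity
    have p2 : 0 ≤ (t * ‖dx v p‖ ^ 2 + t⁻¹ * ‖dx z p‖ ^ 2) / 2 := by positivity
    have p3 : 0 ≤ (t * ‖dy v p‖ ^ 2 + t⁻¹ * ‖dy z p‖ ^ 2) / 2 := by positivity
    have e4 := mul_le_mul_of_nonneg_left e1 hk
    have p4 := mul_nonneg hk p2
    have p5 := mul_nonneg hk p3
    linarith
  have i1 := g.integrable_box (F := fun p => (‖fn v p‖ ^ 2 + ‖dx v p‖ ^ 2 + ‖dy v p‖ ^ 2))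
    (by fun_prop)
  have i2 := g.integrable_box (F := fun p => (‖fn z p‖ ^ 2 + ‖dx z p‖ ^ 2 + ‖dy z p‖ ^ 2))
    (by fun_prop)
  rw [integral_const_mul, integral_add (i1.const_mul _) (i2.const_mul _), integral_const_mul,
    integral_const_mul] at h1
  rw [nrm_sq, nrm_sq]
  refine h1.trans_eq ?_
  rw [nsq, nsq]; ring

theorem norm_eform_le' (v z : g.V) : ‖eform v z‖ ≤ (1 + g.k ^ 2) * nrm v * nrm z :=
  le_mul_of_forall_scaling (nrm_nonneg v) (nrm_nonneg z) (by positivity)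
    fun _ ht => norm_eform_le v z ht

theorem norm_bform_le' (v z : g.V) : ‖bform v z‖ ≤ (1 + g.k ^ 2) * nrm v * nrm z :=
  le_mul_of_forall_scaling (nrm_nonneg v) (nrm_nonneg z) (by positivity)
    fun _ ht => norm_bform_le v z ht

theorem norm_aform_le (v z : g.V) : ‖aform v z‖ ≤ 2 * (1 + g.k ^ 2) * nrm v * nrm z :=
  (norm_add_le _ _).trans (by linarith [norm_eform_le' v z, norm_bform_le' v z])

theorem aform_add_left (v w z : g.V) : aform (v + w) z = aform v z + aform w z := by
  simp only [aform, eform_add_left, bform_add_left]; ring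
theorem aform_add_right (v w z : g.V) : aform v (w + z) = aform v w + aform v z := by
  simp only [aform, eform_add_right, bform_add_right]; ring
theorem aform_smul_left (c : ℂ) (v z : g.V) : aform (c • v) z = c * aform v z := by
  simp only [aform, eform_smul_left, bform_smul_left]; ring
theorem aform_smul_right (c : ℂ) (v z : g.V) : aform v (c • z) = conj c * aform v z := by
  simp only [aform, eform_smul_right, bform_smul_right]; ring

theorem aform_eq_eform_left (v : g.V) {d : g.V} (hd : ∀ j, q d j g.H = 0) :
    aform v d = eform v d := by
  simp [aform, bform, hd]
theorem aform_eq_eform_right (v : g.V) {d : g.V} (hd : ∀ j, q d j g.H = 0) :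
    aform d v = eform d v := by
  simp [aform, bform, hd]

/-- Expansion of the energy of a perturbation. -/
theorem esq_add (v d : g.V) : esq (v + d) = esq v + esq d + 2 * (eform v d).re := by
  have h : eform (v + d) (v + d) = eform v v + eform d d + (eform v d + eform d v) := by
    rw [eform_add_left, eform_add_right, eform_add_right]; ring
  rw [← eform_conj v d, Complex.add_conj, eform_self, eform_self, eform_self] at h
  exact_mod_cast h

theorem esq_le_aform (v : g.V) : esq v ≤ ‖aform v v‖ := by
  have h1 : 0 ≤ (bform v v).re := by
    rw [bform, Complex.re_tsum (summable_bform v v)]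
    refine tsum_nonneg fun j => ?_
    rw [Complex.mul_conj, Complex.re_mul_ofReal]
    exact mul_nonneg (g.m_re_nonneg j) (Complex.normSq_nonneg _)
  have h2 : (aform v v).re = esq v + (bform v v).re := by
    rw [aform, eform_self]; simp
  linarith [Complex.re_le_norm (aform v v)]

theorem im_trace_le_aform (v : g.V) (j : ℤ) : -(g.m j).im * ‖q v j g.H‖ ^ 2 ≤ ‖aform v v‖ := by
  have h2 : -(aform v v).im = ∑' j, -(g.m j).im * ‖q v j g.H‖ ^ 2 := by
    rw [aform, eform_self, bform, Complex.add_im, Complex.im_tsum (summable_bform v v)]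
    simp only [Complex.ofReal_im, zero_add]
    rw [← tsum_neg]
    congr 1; funext j
    rw [Complex.mul_conj, Complex.im_mul_ofReal, Complex.normSq_eq_norm_sq]; ring
  have hs : Summable fun j => -(g.m j).im * ‖q v j g.H‖ ^ 2 := by
    refine Summable.of_norm_bounded (summable_trace v) fun j => ?_
    rw [norm_mul, norm_neg, norm_pow, norm_norm]
    gcongr
    exact Complex.abs_im_le_norm _
  have h3 := hs.le_tsum j fun i _ => mul_nonneg (by linarith [g.m_im_nonpos i]) (by positivity)
  rw [← h2] at h3
  have := Complex.abs_im_le_norm (aform v v)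
  rw [abs_le] at this
  linarith

/-! ### Shifts and the Poincaré inequality -/

theorem shift_le (v : g.V) {s : ℝ → ℝ} (hs : Continuous s) {w : ℝ} (hw : 0 ≤ w)
    (h0 : ∀ y ∈ Set.Icc 0 g.H, 0 ≤ s y ∧ s y ≤ w) :
    ∫ p, ‖fn v (p.1, p.2 - s p.2) - fn v p‖ ^ 2 ∂g.box ≤ w ^ 2 * ∫ y in (0 : ℝ)..g.H, Pd v y := by
  have hH := g.H_pos.le
  have hL := g.L_pos.le
  -- pointwise bound
  have h1 : ∀ x, ∀ y ∈ Set.Icc 0 g.H, ‖fn v (x, y - s y) - fn v (x, y)‖ ^ 2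
      ≤ w * ∫ r in (0 : ℝ)..w, ‖dy v (x, y - r)‖ ^ 2 := by
    intro x y hy
    obtain ⟨hs0, hs1⟩ := h0 y hy
    have e1 : fn v (x, y) - fn v (x, y - s y) = ∫ t in (y - s y)..y, dy v (x, t) :=
      (intervalIntegral.integral_eq_sub_of_hasDerivAt (f := fun t => fn v (x, t))
        (fun t _ => hasDerivAt_fn_y v x t) (Continuous.intervalIntegrable (by fun_prop) _ _)).symm
    have e2 : ∫ t in (y - s y)..y, dy v (x, t) = ∫ r in (0 : ℝ)..(s y), dy v (x, y - r) := by
      rw [intervalIntegral.integral_comp_sub_left (fun t => dy v (x, t)), sub_zero]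
    rw [norm_sub_rev, e1, e2]
    refine (sq_norm_intervalIntegral_le hs0 (Continuous.continuousOn (by fun_prop))).trans ?_
    rw [sub_zero]
    have e3 : ∫ r in (0 : ℝ)..(s y), ‖dy v (x, y - r)‖ ^ 2
        ≤ ∫ r in (0 : ℝ)..w, ‖dy v (x, y - r)‖ ^ 2 :=
      intervalIntegral.integral_mono_interval le_rfl hs0 hs1
        (Filter.Eventually.of_forall fun _ => by positivity)
        (Continuous.intervalIntegrable (by fun_prop) _ _)
    exact mul_le_mul hs1 e3 (int_nonneg hs0 fun _ => by positivity) hw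
  have h2 : ∀ y ∈ Set.Icc 0 g.H, ∫ x in (0 : ℝ)..g.L, ‖fn v (x, y - s y) - fn v (x, y)‖ ^ 2
      ≤ w * ∫ r in (0 : ℝ)..w, Pd v (y - r) := by
    intro y hy
    have hc : Continuous fun p : ℝ × ℝ => ‖dy v (p.1, y - p.2)‖ ^ 2 := by fun_prop
    unfold Pd
    rw [← integral_swap (F := fun p : ℝ × ℝ => ‖dy v (p.1, y - p.2)‖ ^ 2) hc,
      ← intervalIntegral.integral_const_mul]
    refine intervalIntegral.integral_mono_on hL (Continuous.intervalIntegrable (by fun_prop) _ _)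
      (Continuous.intervalIntegrable ?_ _ _) fun x _ => h1 x y hy
    exact continuous_const.mul (continuous_intervalIntegral_param
      (F := fun p : ℝ × ℝ => ‖dy v (p.2, y - p.1)‖ ^ 2) (by fun_prop) _ _)
  have h3 : ∀ r ∈ Set.Icc 0 w, ∫ y in (0 : ℝ)..g.H, Pd v (y - r) ≤ ∫ y in (0 : ℝ)..g.H, Pd v y := by
    intro r hr
    rw [intervalIntegral.integral_comp_sub_right (Pd v)]
    have hi : ∀ a b, IntervalIntegrable (Pd v) volume a b := fun a b =>
      (continuous_Pd v).intervalIntegrable _ _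
    have e0 : ∫ y in (0 - r)..0, Pd v y = 0 := by
      rw [intervalIntegral.integral_congr (g := fun _ => (0 : ℝ)), intervalIntegral.integral_zero]
      intro y hy
      rw [Set.uIcc_of_le (by linarith [hr.1])] at hy
      exact (dens_zero v hy.2).2.2
    have e1 : ∫ y in (g.H - r)..g.H, Pd v y ≥ 0 := int_nonneg (by linarith [hr.1]) (Pd_nonneg v)
    have e2 := intervalIntegral.integral_add_adjacent_intervals (hi (0 - r) (g.H - r))
      (hi (g.H - r) g.H)
    have e3 := intervalIntegral.integral_add_adjacent_intervals (hi (0 - r) 0) (hi 0 g.H)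
    linarith
  have hcP : Continuous fun p : ℝ × ℝ => Pd v (p.2 - p.1) := by fun_prop
  have hcP2 : Continuous fun p : ℝ × ℝ => Pd v (p.1 - p.2) := by fun_prop
  rw [g.integral_box (F := fun p => ‖fn v (p.1, p.2 - s p.2) - fn v p‖ ^ 2) (by fun_prop)]
  calc ∫ y in (0 : ℝ)..g.H, ∫ x in (0 : ℝ)..g.L, ‖fn v (x, y - s y) - fn v (x, y)‖ ^ 2
      ≤ ∫ y in (0 : ℝ)..g.H, w * ∫ r in (0 : ℝ)..w, Pd v (y - r) := by
        refine intervalIntegral.integral_mono_on hH (Continuous.intervalIntegrable ?_ _ _)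
          (Continuous.intervalIntegrable ?_ _ _) h2
        · exact continuous_intervalIntegral_param
            (F := fun p : ℝ × ℝ => ‖fn v (p.1, p.2 - s p.2) - fn v p‖ ^ 2) (by fun_prop) _ _
        · exact continuous_const.mul (continuous_intervalIntegral_param hcP _ _)
    _ = w * ∫ r in (0 : ℝ)..w, ∫ y in (0 : ℝ)..g.H, Pd v (y - r) := by
        rw [intervalIntegral.integral_const_mul, integral_swap hcP2]
    _ ≤ w * ∫ r in (0 : ℝ)..w, ∫ y in (0 : ℝ)..g.H, Pd v y := by
        refine mul_le_mul_of_nonneg_left ?_ hw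
        refine intervalIntegral.integral_mono_on hw (Continuous.intervalIntegrable ?_ _ _)
          (Continuous.intervalIntegrable (by fun_prop) _ _) h3
        exact continuous_intervalIntegral_param hcP2 _ _
    _ = _ := by rw [intervalIntegral.integral_const]; simp; ring

theorem poincare (v : g.V) :
    ∫ y in (0 : ℝ)..g.H, Qd v y ≤ g.H ^ 2 * ∫ y in (0 : ℝ)..g.H, Pd v y := by
  have h := shift_le v (s := fun _ => g.H) continuous_const g.H_pos.le
    (fun y _ => ⟨g.H_pos.le, le_rfl⟩)
  refine le_trans (le_of_eq ?_) h
  rw [integral_Qd, box_eq]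
  refine setIntegral_congr_fun (measurableSet_Ioc.prod measurableSet_Ioc) ?_
  rintro ⟨x, y⟩ ⟨_, hy⟩
  simp [(zero_of_nonpos v x (sub_nonpos.2 hy.2)).1]

/-! ### The vertical stretch -/

variable (g)

noncomputable def cc : ℝ := (1 + g.H) / (g.H - g.b) ^ 2
noncomputable def al (y : ℝ) : ℝ := 1 + y - g.cc * (max (y - g.b) 0) ^ 2
/-- The weight of the top strip. -/
noncomputable def chi (y : ℝ) : ℝ := 2 * g.cc * max (y - g.b) 0

theorem cc_pos : 0 < g.cc := by
  have := g.b_lt_H; have := g.H_pos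
  unfold cc
  have : 0 < g.H - g.b := by linarith
  positivity

@[fun_prop] theorem continuous_al : Continuous g.al := by unfold al; fun_prop
@[fun_prop] theorem continuous_chi : Continuous g.chi := by unfold chi; fun_prop

theorem chi_nonneg (y : ℝ) : 0 ≤ g.chi y :=
  mul_nonneg (by linarith [g.cc_pos]) (le_max_right _ _)

theorem chi_zero {y : ℝ} (hy : y ≤ g.b) : g.chi y = 0 := by
  rw [chi, max_eq_right (by linarith), mul_zero]

theorem chi_le {y : ℝ} (hy : y ≤ g.H) : g.chi y ≤ 2 * g.cc * g.H := by
  refine mul_le_mul_of_nonneg_left ?_ (by linarith [g.cc_pos])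
  exact max_le (by linarith [g.b_pos]) g.H_pos.le

theorem abs_chi_sub_le (y z : ℝ) : |g.chi y - g.chi z| ≤ 2 * g.cc * |y - z| := by
  have h : |max (y - g.b) 0 - max (z - g.b) 0| ≤ |(y - g.b) - (z - g.b)| :=
    abs_max_sub_max_le_abs _ _ _
  have e : (y - g.b) - (z - g.b) = y - z := by ring
  rw [e] at h
  rw [chi, chi, ← mul_sub, abs_mul, abs_of_pos (by linarith [g.cc_pos])]
  exact mul_le_mul_of_nonneg_left h (by linarith [g.cc_pos])

theorem hasDerivAt_al (y : ℝ) : HasDerivAt g.al (1 - g.chi y) y := by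
  have h := (hasDerivAt_max_sq (y - g.b)).comp_sub_const y g.b
  refine (((hasDerivAt_id y).const_add 1).sub (h.const_mul g.cc)).congr_deriv ?_
  rw [chi]; ring

theorem al_of_le {y : ℝ} (hy : y ≤ g.b) : g.al y = 1 + y := by
  rw [al, max_eq_right (by linarith)]; ring

theorem al_H : g.al g.H = 0 := by
  have := g.b_lt_H
  have h : 0 < g.H - g.b := by linarith
  rw [al, max_eq_left h.le, cc]
  field_simp; ring

theorem al_nonneg {y : ℝ} (h0 : 0 ≤ y) (hy : y ≤ g.H) : 0 ≤ g.al y := by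
  rcases le_total y g.b with h | h
  · rw [al_of_le g h]; linarith
  · have hb := g.b_lt_H
    have h1 : 0 < g.H - g.b := by linarith
    have h2 : 0 ≤ y - g.b := by linarith
    have h3 := g.b_pos
    have h4 := g.H_pos
    rw [al, max_eq_left h2, cc, div_mul_eq_mul_div, sub_nonneg, div_le_iff₀ (by positivity)]
    have e1 : (1 + g.H) * (y - g.b) ≤ (1 + y) * (g.H - g.b) := by nlinarith
    have e2 : (y - g.b) ≤ g.H - g.b := by linarith
    calc (1 + g.H) * (y - g.b) ^ 2 = ((1 + g.H) * (y - g.b)) * (y - g.b) := by ring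
      _ ≤ ((1 + y) * (g.H - g.b)) * (g.H - g.b) := mul_le_mul e1 e2 h2 (by positivity)
      _ = _ := by ring

theorem al_le {y : ℝ} (hy : y ≤ g.H) : g.al y ≤ 1 + g.H := by
  have : 0 ≤ g.cc * (max (y - g.b) 0) ^ 2 := mul_nonneg g.cc_pos.le (sq_nonneg _)
  rw [al]; linarith

noncomputable def psi (h y : ℝ) : ℝ := y - h * g.al y

@[fun_prop] theorem continuous_psi (h : ℝ) : Continuous (g.psi h) := by unfold psi; fun_prop

theorem hasDerivAt_psi (h y : ℝ) : HasDerivAt (g.psi h) (1 - h * (1 - g.chi y)) y :=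
  (hasDerivAt_id y).sub ((g.hasDerivAt_al y).const_mul h)

theorem psi_H (h : ℝ) : g.psi h g.H = g.H := by rw [psi, al_H]; ring

theorem psi_neg {h y : ℝ} (h0 : 0 < h) (h1 : h ≤ 1) (hy : y < 0) : g.psi h y < 0 := by
  rw [psi, al_of_le g (hy.le.trans g.b_pos.le)]
  nlinarith

theorem psi_le {h y : ℝ} (h0 : 0 < h) (h1 : h ≤ 1) (hy : y ≤ g.H) : g.psi h y ≤ max y 0 := by
  rcases lt_or_ge y 0 with hy0 | hy0
  · exact (g.psi_neg h0 h1 hy0).le.trans (le_max_right _ _)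
  · have := mul_nonneg h0.le (g.al_nonneg hy0 hy)
    rw [psi]
    exact le_trans (by linarith) (le_max_left _ _)

variable {g}

/-- The stretched function `v(x, ψ(y))`. -/
noncomputable def stretch (v : g.V) (h : ℝ) (h0 : 0 < h) (h1 : h ≤ 1) : g.V :=
  ⟨(fun p => fn v (p.1, g.psi h p.2), fun p => dx v (p.1, g.psi h p.2),
    fun p => ((1 - h * (1 - g.chi p.2) : ℝ) : ℂ) * dy v (p.1, g.psi h p.2)),
  { cont := by fun_prop
    contx := by fun_prop
    conty := by fun_prop
    derivx := fun x y => hasDerivAt_fn_x v x (g.psi h y)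
    derivy := fun x y => by
      have := (hasDerivAt_fn_y v x (g.psi h y)).scomp y (g.hasDerivAt_psi h y)
      exact this.congr_deriv (Complex.real_smul)
    qper := fun x y => fn_add_L v x (g.psi h y)
    zero := by
      obtain ⟨δ, hδ, hz⟩ := exists_zero v
      refine ⟨min δ (g.H - g.M), lt_min hδ (by linarith [g.M_lt_b, g.b_lt_H]), fun x y hy => ?_⟩
      refine (hz x _ ?_).1
      have h2 := min_le_left δ (g.H - g.M)
      have h3 := min_le_right δ (g.H - g.M)
      have h4 := g.psi_le h0 h1 (y := y) (by linarith [g.le_M x])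
      refine h4.trans_lt (max_lt ?_ ?_) <;> linarith [g.nonneg x] }⟩

theorem integral_psi {G : ℝ → ℝ} (hG : Continuous G) (h0 : ∀ y ≤ 0, G y = 0) {h : ℝ} (hh : 0 ≤ h) :
    ∫ y in (0 : ℝ)..g.H, G (g.psi h y) * (1 - h * (1 - g.chi y)) = ∫ y in (0 : ℝ)..g.H, G y := by
  have := intervalIntegral.integral_comp_mul_deriv (a := 0) (b := g.H) (f := g.psi h)
    (g := G) (fun y _ => g.hasDerivAt_psi h y) (Continuous.continuousOn (by fun_prop)) hG
  simp only [Function.comp_def] at this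
  rw [this, psi_H]
  have e0 : g.psi h 0 = -h := by rw [psi, al_of_le g g.b_pos.le]; ring
  rw [e0, ← intervalIntegral.integral_add_adjacent_intervals
    (hG.intervalIntegrable (-h) 0) (hG.intervalIntegrable 0 g.H)]
  rw [intervalIntegral.integral_congr (g := fun _ => (0 : ℝ)) (a := -h) (b := 0),
    intervalIntegral.integral_zero, zero_add]
  intro y hy
  rw [Set.uIcc_of_le (by linarith)] at hy
  exact h0 y hy.2

noncomputable def rho (v : g.V) (y : ℝ) : ℝ := Xd v y - g.k ^ 2 * Qd v y - Pd v y

@[fun_prop] theorem continuous_rho (v : g.V) : Continuous (rho v) := by unfold rho; fun_prop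

theorem abs_rho_le (v : g.V) (y : ℝ) : |rho v y| ≤ Xd v y + g.k ^ 2 * Qd v y + Pd v y := by
  have h1 := Xd_nonneg v y; have h2 := Pd_nonneg v y
  have h3 := mul_nonneg (sq_nonneg g.k) (Qd_nonneg v y)
  rw [rho, abs_le]; constructor <;> linarith

theorem stretch_algebra {h a a2 X P Q A A' c : ℝ} (h0 : 0 < h) (hX : 0 ≤ X) (hP : 0 ≤ P)
    (hQ : 0 ≤ Q)
    (hc : 0 < c) (hA : 0 < A) (hA' : 0 < A') (ha : |1 - a| ≤ A') (ha2 : |1 - a2| ≤ A')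
    (hpsi' : |1 - h * (1 - a)| ≤ 2) (hlip : |a - a2| ≤ 2 * c * (h * A)) :
    |X + (1 - h * (1 - a)) ^ 2 * P - Q - (X + P - Q) * (1 - h * (1 - a))
      - h * ((1 - a2) * (X - Q - P) * (1 - h * (1 - a)))|
      ≤ (2 * c * A * 2 + A' ^ 2) * h ^ 2 * (X + Q + P) := by
  have e : X + (1 - h * (1 - a)) ^ 2 * P - Q - (X + P - Q) * (1 - h * (1 - a))
      - h * ((1 - a2) * (X - Q - P) * (1 - h * (1 - a)))
      = (-h * (a - a2) + h ^ 2 * ((1 - a) * (1 - a2))) * (X - Q)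
        + (h * (1 - h * (1 - a)) * (a - a2)) * P := by ring
  rw [e]
  have b1 : |-h * (a - a2) + h ^ 2 * ((1 - a) * (1 - a2))| ≤ (2 * c * A * 2 + A' ^ 2) * h ^ 2 := by
    refine (abs_add_le _ _).trans ?_
    rw [abs_mul, abs_mul, abs_mul, abs_neg, abs_of_pos h0, abs_of_nonneg (sq_nonneg h)]
    have c1 := mul_le_mul_of_nonneg_left hlip h0.le
    have c2 : |1 - a| * |1 - a2| ≤ A' * A' := mul_le_mul ha ha2 (abs_nonneg _) hA'.le
    have c3 := mul_le_mul_of_nonneg_left c2 (sq_nonneg h)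
    have : 0 ≤ c * A * h ^ 2 := by positivity
    linarith
  have b2 : |h * (1 - h * (1 - a)) * (a - a2)| ≤ (2 * c * A * 2 + A' ^ 2) * h ^ 2 := by
    rw [abs_mul, abs_mul, abs_of_pos h0]
    have c1 : |1 - h * (1 - a)| * |a - a2| ≤ 2 * (2 * c * (h * A)) :=
      mul_le_mul hpsi' hlip (abs_nonneg _) zero_le_two
    have c2 := mul_le_mul_of_nonneg_left c1 h0.le
    have : 0 ≤ A' ^ 2 * h ^ 2 := by positivity
    linarith
  have b3 : |X - Q| ≤ X + Q := by rw [abs_le]; constructor <;> linarith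
  refine (abs_add_le _ _).trans ?_
  rw [abs_mul, abs_mul _ P, abs_of_nonneg hP]
  have d1 := mul_le_mul b1 b3 (abs_nonneg _) (by positivity)
  have d2 := mul_le_mul_of_nonneg_right b2 hP
  linarith

theorem stretch_props (g : Geo) : ∃ C h0 : ℝ, 0 < C ∧ 0 < h0 ∧ ∀ (v : g.V) (h : ℝ), 0 < h → h < h0 →
    ∃ d : g.V, (∀ j, q d j g.H = 0) ∧ (∀ x y, y ≤ g.f x + h → fn (v + d) (x, y) = 0) ∧
      ∫ y in (0 : ℝ)..g.H, Qd d y ≤ C * h ^ 2 * nsq v ∧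
      |esq (v + d) - esq v - h * ∫ y in (0 : ℝ)..g.H, (1 - g.chi y) * rho v y|
        ≤ C * h ^ 2 * nsq v := by
  have hH := g.H_pos
  have hcc := g.cc_pos
  set A : ℝ := 1 + g.H with hA
  set A' : ℝ := 1 + 2 * g.cc * g.H with hA'
  have hA0 : 0 < A := by positivity
  have hA'0 : 0 < A' := by positivity
  set C1 : ℝ := 2 * g.cc * A * 2 + A' ^ 2 with hC1
  have hC10 : 0 < C1 := by positivity
  refine ⟨A ^ 2 + C1 * (2 * (1 + g.k ^ 2)), min (min 1 (g.b - g.M)) (1 / (2 * A')), by positivity,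
    lt_min (lt_min one_pos (by linarith [g.M_lt_b])) (by positivity), fun v h h0 hh => ?_⟩
  have hh1 : h < 1 := hh.trans_le ((min_le_left _ _).trans (min_le_left _ _))
  have hh2 : h < g.b - g.M := hh.trans_le ((min_le_left _ _).trans (min_le_right _ _))
  have hh3 : h * A' < 1 / 2 := by
    have := hh.trans_le (min_le_right _ _)
    rw [lt_div_iff₀ (by positivity)] at this
    linarith
  have hnv := nsq_nonneg v
  set w := stretch v h h0 hh1.le with hw
  have hfw : ∀ x y, fn w (x, y) = fn v (x, g.psi h y) := fun x y => rfl
  refine ⟨w - v, fun j => ?_, fun x y hy => ?_, ?_, ?_⟩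
  · simp [q, coef, hfw, psi_H]
  · rw [add_sub_cancel, hfw]
    obtain ⟨δ, hδ, hz⟩ := exists_zero v
    refine (hz x _ ?_).1
    rcases lt_or_ge y 0 with hy0 | hy0
    · linarith [g.psi_neg h0 hh1.le hy0, g.nonneg x]
    · rw [psi, al_of_le g (by linarith [g.le_M x])]
      nlinarith
  · have h1 := shift_le v (s := fun y => h * g.al y) (by fun_prop) (w := h * A) (by positivity)
      (fun y hy => ⟨mul_nonneg h0.le (g.al_nonneg hy.1 hy.2),
        mul_le_mul_of_nonneg_left (g.al_le hy.2) h0.le⟩)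
    have h2 := int_Pd_le v
    rw [integral_Qd]
    calc _ ≤ (h * A) ^ 2 * ∫ y in (0 : ℝ)..g.H, Pd v y := h1
      _ ≤ (h * A) ^ 2 * nsq v := by gcongr
      _ = A ^ 2 * h ^ 2 * nsq v := by ring
      _ ≤ _ := by gcongr; linarith [show 0 ≤ C1 * (2 * (1 + g.k ^ 2)) by positivity]
  · rw [add_sub_cancel]
    have eX : ∀ y, Xd w y = Xd v (g.psi h y) := fun y => rfl
    have eQ : ∀ y, Qd w y = Qd v (g.psi h y) := fun y => rfl
    have eP : ∀ y, Pd w y = (1 - h * (1 - g.chi y)) ^ 2 * Pd v (g.psi h y) := by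
      intro y
      unfold Pd
      rw [← intervalIntegral.integral_const_mul]
      congr 1; funext x
      change ‖((1 - h * (1 - g.chi y) : ℝ) : ℂ) * dy v (x, g.psi h y)‖ ^ 2 = _
      rw [norm_mul, mul_pow, Complex.norm_real, Real.norm_eq_abs, sq_abs]
    have i1 : ∫ y in (0 : ℝ)..g.H, (Xd v y + Pd v y - g.k ^ 2 * Qd v y) = esq v := by
      rw [intervalIntegral.integral_sub, intervalIntegral.integral_add,
        intervalIntegral.integral_const_mul, esq]
      all_goals exact Continuous.intervalIntegrable (by fun_prop) _ _
    have i2 : ∫ y in (0 : ℝ)..g.H, (Xd w y + Pd w y - g.k ^ 2 * Qd w y) = esq w := by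
      rw [intervalIntegral.integral_sub, intervalIntegral.integral_add,
        intervalIntegral.integral_const_mul, esq]
      all_goals exact Continuous.intervalIntegrable (by fun_prop) _ _
    have j1 := integral_psi (g := g) (G := fun y => Xd v y + Pd v y - g.k ^ 2 * Qd v y)
      (by fun_prop) (fun y hy => by simp [dens_zero v hy]) h0.le
    have j2 := integral_psi (g := g) (G := fun y => (1 - g.chi y) * rho v y)
      (by fun_prop) (fun y hy => by simp [rho, dens_zero v hy]) h0.le
    have j3 := integral_psi (g := g) (G := fun y => Xd v y + g.k ^ 2 * Qd v y + Pd v y)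
      (by fun_prop) (fun y hy => by simp [dens_zero v hy]) h0.le
    rw [← i2, ← i1, ← j1, ← j2, ← intervalIntegral.integral_const_mul,
      ← intervalIntegral.integral_sub, ← intervalIntegral.integral_sub]
    rotate_left
    all_goals try exact Continuous.intervalIntegrable (by fun_prop) _ _
    have hE : ∫ y in (0 : ℝ)..g.H, (Xd v (g.psi h y) + g.k ^ 2 * Qd v (g.psi h y)
        + Pd v (g.psi h y)) ≤ 2 * ((1 + g.k ^ 2) * nsq v) := by
      refine le_trans ?_ (mul_le_mul_of_nonneg_left (int_modes_le v) zero_le_two)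
      rw [← j3, ← intervalIntegral.integral_const_mul]
      refine intervalIntegral.integral_mono_on hH.le
        (Continuous.intervalIntegrable (by fun_prop) _ _)
        (Continuous.intervalIntegrable (by fun_prop) _ _) fun y hy => ?_
      have h1 := Xd_nonneg v (g.psi h y); have h2 := Pd_nonneg v (g.psi h y)
      have h3 := mul_nonneg (sq_nonneg g.k) (Qd_nonneg v (g.psi h y))
      have h4 := mul_nonneg h0.le (g.chi_nonneg y)
      have h5 : h ≤ 1 / 2 := by nlinarith [show 0 ≤ 2 * g.cc * g.H by positivity]
      nlinarith
    have hpt : ∀ y ∈ Set.Icc 0 g.H, |Xd w y + Pd w y - g.k ^ 2 * Qd w y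
        - (Xd v (g.psi h y) + Pd v (g.psi h y) - g.k ^ 2 * Qd v (g.psi h y))
          * (1 - h * (1 - g.chi y))
        - h * ((1 - g.chi (g.psi h y)) * rho v (g.psi h y) * (1 - h * (1 - g.chi y)))|
        ≤ C1 * h ^ 2 * (Xd v (g.psi h y) + g.k ^ 2 * Qd v (g.psi h y) + Pd v (g.psi h y)) := by
      intro y hy
      have hX := Xd_nonneg v (g.psi h y)
      have hP := Pd_nonneg v (g.psi h y)
      have hQ := mul_nonneg (sq_nonneg g.k) (Qd_nonneg v (g.psi h y))
      have hlip : |g.chi y - g.chi (g.psi h y)| ≤ 2 * g.cc * (h * A) := by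
        refine (g.abs_chi_sub_le _ _).trans ?_
        refine mul_le_mul_of_nonneg_left ?_ (by positivity)
        rw [psi, sub_sub_cancel, abs_of_nonneg (mul_nonneg h0.le (g.al_nonneg hy.1 hy.2))]
        exact mul_le_mul_of_nonneg_left (g.al_le hy.2) h0.le
      have hpsiH : g.psi h y ≤ g.H := by
        have := mul_nonneg h0.le (g.al_nonneg hy.1 hy.2)
        rw [psi]; linarith [hy.2]
      have ha : |1 - g.chi y| ≤ A' := by
        rw [abs_le]; constructor <;> linarith [g.chi_nonneg y, g.chi_le hy.2]
      have ha2 : |1 - g.chi (g.psi h y)| ≤ A' := by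
        rw [abs_le]; constructor <;> linarith [g.chi_nonneg (g.psi h y), g.chi_le hpsiH]
      have hpsi' : |1 - h * (1 - g.chi y)| ≤ 2 := by
        have : |h * (1 - g.chi y)| ≤ 1 / 2 := by
          rw [abs_mul, abs_of_pos h0]
          exact (mul_le_mul_of_nonneg_left ha h0.le).trans hh3.le
        rw [abs_le] at this ⊢
        constructor <;> linarith
      rw [eX, eQ, eP, rho]
      exact stretch_algebra h0 hX hP hQ hcc hA0 hA'0 ha ha2 hpsi' hlip
    refine (intervalIntegral.abs_integral_le_integral_abs hH.le).trans ?_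
    refine (intervalIntegral.integral_mono_on hH.le
      (Continuous.intervalIntegrable (by fun_prop) _ _)
      (Continuous.intervalIntegrable (by fun_prop) _ _) hpt).trans ?_
    rw [intervalIntegral.integral_const_mul]
    calc _ ≤ C1 * h ^ 2 * (2 * ((1 + g.k ^ 2) * nsq v)) := by gcongr
      _ = (C1 * (2 * (1 + g.k ^ 2))) * h ^ 2 * nsq v := by ring
      _ ≤ _ := by gcongr; linarith [sq_nonneg A]

end Geo

/-- The solution of `ψ' + a ψ = w` vanishing at `b`. -/
noncomputable def duhamel (a : ℂ) (b : ℝ) (w : ℝ → ℂ) (y : ℝ) : ℂ :=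
  Complex.exp (-a * y) * ∫ t in b..y, Complex.exp (a * t) * w t

theorem hasDerivAt_duhamel (a : ℂ) (b : ℝ) {w : ℝ → ℂ} (hw : Continuous w) (y : ℝ) :
    HasDerivAt (duhamel a b w) (w y - a * duhamel a b w y) y := by
  have hc : Continuous fun t : ℝ => Complex.exp (a * t) * w t := by fun_prop
  have h1 : HasDerivAt (fun y => ∫ t in b..y, Complex.exp (a * t) * w t)
      (Complex.exp (a * y) * w y) y :=
    intervalIntegral.integral_hasDerivAt_right (hc.intervalIntegrable _ _)
      (hc.stronglyMeasurableAtFilter _ _) hc.continuousAt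
  have h2 : HasDerivAt (fun y : ℝ => Complex.exp (-a * y)) (Complex.exp (-a * y) * (-a)) y := by
    have h3 : HasDerivAt (fun y : ℝ => (-a : ℂ) * (y : ℂ)) (-a) y := by
      simpa using (hasDerivAt_id y).ofReal_comp.const_mul (-a)
    exact h3.cexp
  refine (h2.mul h1).congr_deriv ?_
  have e : Complex.exp (-a * y) * Complex.exp (a * y) = 1 := by
    rw [← Complex.exp_add]; simp
  rw [duhamel]
  linear_combination w y * e

theorem continuous_duhamel (a : ℂ) (b : ℝ) {w : ℝ → ℂ} (hw : Continuous w) :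
    Continuous (duhamel a b w) :=
  continuous_iff_continuousAt.2 fun y => (hasDerivAt_duhamel a b hw y).continuousAt

theorem duhamel_zero (a : ℂ) {b : ℝ} {w : ℝ → ℂ} (hw : ∀ y ≤ b, w y = 0) {y : ℝ} (hy : y ≤ b) :
    duhamel a b w y = 0 := by
  rw [duhamel, intervalIntegral.integral_congr (g := fun _ => (0 : ℂ)),
    intervalIntegral.integral_zero, mul_zero]
  intro t ht
  rw [Set.uIcc_of_ge hy] at ht
  simp [hw t ht.2]

theorem sq_norm_duhamel_le {a : ℂ} (ha : 0 ≤ a.re) {b H y : ℝ} (hb : 0 ≤ b) (hby : b ≤ y)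
    (hyH : y ≤ H) {w : ℝ → ℂ} (hw : Continuous w) :
    ‖duhamel a b w y‖ ^ 2 ≤ H * ∫ t in (0 : ℝ)..H, ‖w t‖ ^ 2 := by
  have e : duhamel a b w y = ∫ t in b..y, Complex.exp (a * (t - y)) * w t := by
    rw [duhamel, ← intervalIntegral.integral_const_mul]
    congr 1; funext t
    rw [← mul_assoc, ← Complex.exp_add]
    congr 2; ring
  have hi : ∀ u v : ℝ, IntervalIntegrable (fun t => ‖w t‖ ^ 2) volume u v := fun u v =>
    Continuous.intervalIntegrable (by fun_prop) _ _
  rw [e]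
  refine (sq_norm_intervalIntegral_le hby (Continuous.continuousOn (by fun_prop))).trans ?_
  have h1 : ∫ t in b..y, ‖Complex.exp (a * (t - y)) * w t‖ ^ 2 ≤ ∫ t in b..y, ‖w t‖ ^ 2 := by
    refine intervalIntegral.integral_mono_on hby (Continuous.intervalIntegrable (by fun_prop) _ _)
      (hi _ _) fun t ht => ?_
    have : ‖Complex.exp (a * (t - y))‖ ≤ 1 := by
      rw [Complex.norm_exp, Real.exp_le_one_iff]
      rw [← Complex.ofReal_sub, Complex.re_mul_ofReal]
      exact mul_nonpos_of_nonneg_of_nonpos ha (by linarith [ht.2])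
    rw [norm_mul, mul_pow]
    exact mul_le_of_le_one_left (sq_nonneg _) (pow_le_one₀ (norm_nonneg _) this)
  have h2 : ∫ t in b..y, ‖w t‖ ^ 2 ≤ ∫ t in (0 : ℝ)..H, ‖w t‖ ^ 2 :=
    intervalIntegral.integral_mono_interval hb hby hyH
      (Filter.Eventually.of_forall fun t => sq_nonneg _) (hi _ _)
  exact mul_le_mul (by linarith) (h1.trans h2)
    (intervalIntegral.integral_nonneg hby fun _ _ => by positivity) (by linarith)

/-- Energy estimate for `ψ' + a ψ = w` with `a` real or imaginary. -/
theorem duhamel_energy {a : ℂ} (ha : 0 ≤ a.re) {b H k l : ℝ} (hb : 0 ≤ b) (hbH : b ≤ H)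
    (hl : a ^ 2 = ((l ^ 2 - k ^ 2 : ℝ) : ℂ)) {w : ℝ → ℂ} (hw : Continuous w)
    (hw0 : ∀ y ≤ b, w y = 0) :
    ∫ y in (0 : ℝ)..H, ((1 + l ^ 2) * ‖duhamel a b w y‖ ^ 2 + ‖w y - a * duhamel a b w y‖ ^ 2)
      ≤ ((1 + 3 * k ^ 2) * H ^ 2 + 2) * ∫ y in (0 : ℝ)..H, ‖w y‖ ^ 2 := by
  have hH : 0 ≤ H := hb.trans hbH
  set ψ := duhamel a b w with hψ
  have hc : Continuous ψ := continuous_duhamel a b hw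
  set G := ∫ y in (0 : ℝ)..H, ‖w y‖ ^ 2 with hG
  have hG0 : 0 ≤ G := intervalIntegral.integral_nonneg hH fun _ _ => by positivity
  have hpt : ∀ y ∈ Set.Icc 0 H, ‖ψ y‖ ^ 2 ≤ H * G := by
    intro y hy
    rcases le_total y b with h | h
    · rw [hψ, duhamel_zero a hw0 h]; simp; positivity
    · exact sq_norm_duhamel_le ha hb h hy.2 hw
  have hI : ∫ y in (0 : ℝ)..H, ‖ψ y‖ ^ 2 ≤ H ^ 2 * G := by
    calc _ ≤ ∫ y in (0 : ℝ)..H, H * G := intervalIntegral.integral_mono_on hH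
          (Continuous.intervalIntegrable (by fun_prop) _ _) (by simp) hpt
      _ = _ := by simp; ring
  have i1 : IntervalIntegrable (fun y => ‖ψ y‖ ^ 2) volume 0 H :=
    Continuous.intervalIntegrable (by fun_prop) _ _
  have i2 : IntervalIntegrable (fun y => ‖w y - a * ψ y‖ ^ 2) volume 0 H :=
    Continuous.intervalIntegrable (by fun_prop) _ _
  have i3 : IntervalIntegrable (fun y => ‖w y‖ ^ 2) volume 0 H :=
    Continuous.intervalIntegrable (by fun_prop) _ _
  have hre : a.re ^ 2 - a.im ^ 2 = l ^ 2 - k ^ 2 := by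
    have := congrArg Complex.re hl
    rw [Complex.ofReal_re] at this
    rw [← this, sq a, Complex.mul_re]; ring
  have him : a.re * a.im = 0 := by
    have := congrArg Complex.im hl
    rw [Complex.ofReal_im, sq a, Complex.mul_im] at this
    linarith
  have hn : ‖a‖ ^ 2 = a.re ^ 2 + a.im ^ 2 := by
    rw [← Complex.normSq_eq_norm_sq, Complex.normSq_apply]; ring
  rw [intervalIntegral.integral_add (i1.const_mul _) i2, intervalIntegral.integral_const_mul]
  rcases mul_eq_zero.1 him with h0 | h0
  · have hal : ‖a‖ ^ 2 ≤ k ^ 2 := by rw [hn]; nlinarith [sq_nonneg l]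
    have hlk : l ^ 2 ≤ k ^ 2 := by nlinarith [sq_nonneg a.im]
    have h2 : ∫ y in (0 : ℝ)..H, ‖w y - a * ψ y‖ ^ 2
        ≤ ∫ y in (0 : ℝ)..H, (2 * ‖w y‖ ^ 2 + 2 * k ^ 2 * ‖ψ y‖ ^ 2) := by
      refine intervalIntegral.integral_mono_on hH i2 ((i3.const_mul _).add (i1.const_mul _))
        fun y _ => (norm_sub_sq_le _ _).trans ?_
      rw [norm_mul, mul_pow, mul_assoc]
      gcongr
    rw [intervalIntegral.integral_add (i3.const_mul _) (i1.const_mul _),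
      intervalIntegral.integral_const_mul, intervalIntegral.integral_const_mul, ← hG] at h2
    have h3 : (1 + l ^ 2) * ∫ y in (0 : ℝ)..H, ‖ψ y‖ ^ 2 ≤ (1 + k ^ 2) * (H ^ 2 * G) := by
      gcongr
      exact intervalIntegral.integral_nonneg hH fun _ _ => by positivity
    have h4 := mul_le_mul_of_nonneg_left hI (show 0 ≤ 2 * k ^ 2 by positivity)
    linarith
  · have hl2 : l ^ 2 = k ^ 2 + a.re ^ 2 := by rw [h0] at hre; linarith
    have hder : ∀ y, HasDerivAt (fun y => a.re * ‖ψ y‖ ^ 2)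
        (‖w y‖ ^ 2 - a.re ^ 2 * ‖ψ y‖ ^ 2 - ‖w y - a * ψ y‖ ^ 2) y := by
      intro y
      refine ((hasDerivAt_duhamel a b hw y).norm_sq.const_mul a.re).congr_deriv ?_
      rw [← hψ]
      have e1 := norm_add_sq_complex (w y - a * ψ y) (a * ψ y)
      rw [sub_add_cancel, norm_mul, mul_pow, hn, h0] at e1
      rw [e1, Complex.inner]
      have ea : a = (a.re : ℂ) := Complex.ext (by simp) (by simp [h0])
      generalize w y - a * ψ y = z
      rw [ea]
      simp
      ring
    have h1 := intervalIntegral.integral_eq_sub_of_hasDerivAt (a := 0) (b := H)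
      (fun y _ => hder y) (Continuous.intervalIntegrable (by fun_prop) _ _)
    rw [intervalIntegral.integral_sub (i3.sub (i1.const_mul _)) i2,
      intervalIntegral.integral_sub i3 (i1.const_mul _), intervalIntegral.integral_const_mul] at h1
    have h2 : ψ 0 = 0 := duhamel_zero a hw0 hb
    rw [h2, norm_zero] at h1
    have h3 : 0 ≤ a.re * ‖ψ H‖ ^ 2 := by positivity
    have h4 := mul_le_mul_of_nonneg_left hI (show 0 ≤ 1 + k ^ 2 by positivity)
    have h5 : 0 ≤ k ^ 2 * (H ^ 2 * G) := by positivity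
    rw [hl2]
    linarith

namespace Geo
variable {g : Geo}

theorem coef_phi (i j : ℤ) : g.coef (g.phi j) i = if i = j then 1 else 0 := by
  split_ifs with h
  · subst h
    have : ∀ x, g.phi i x * conj (g.phi i x) = ((1 / g.L : ℝ) : ℂ) := by
      intro x
      rw [Complex.mul_conj, Complex.normSq_eq_norm_sq, norm_phi, div_pow, Real.sq_sqrt g.L_pos.le,
        one_pow]
    rw [coef, intervalIntegral.integral_congr (fun x _ => this x), intervalIntegral.integral_const]
    simp [g.L_pos.ne']
  · have h1 := coef_deriv (g := g) (u := g.phi j) (u' := fun x => Complex.I * g.lam j * g.phi j x)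
      (fun x => g.hasDerivAt_phi j x) (by fun_prop) (by simpa using g.phi_add_L j 0) i
    rw [coef_const_mul] at h1
    have h2 : (g.lam j : ℂ) - g.lam i ≠ 0 := by
      rw [← Complex.ofReal_sub, Complex.ofReal_ne_zero]
      have hL := g.L_pos.ne'
      have : g.lam j - g.lam i = 2 * Real.pi * ((j - i : ℤ) : ℝ) / g.L := by
        unfold lam; push_cast; ring
      rw [this]
      have : ((j - i : ℤ) : ℝ) ≠ 0 := by
        rw [Int.cast_ne_zero, sub_ne_zero]; exact fun e => h e.symm
      have := Real.pi_ne_zero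
      positivity
    have h3 : ((g.lam j : ℂ) - g.lam i) * g.coef (g.phi j) i = 0 := by
      have : Complex.I * (((g.lam j : ℂ) - g.lam i) * g.coef (g.phi j) i) = 0 := by
        linear_combination h1
      exact (mul_eq_zero.1 this).resolve_left Complex.I_ne_zero
    exact (mul_eq_zero.1 h3).resolve_left h2

/-- The single-mode test function `ψ(y) φ_j(x)`. -/
noncomputable def modeTest (j : ℤ) {ψ ψ' : ℝ → ℂ} (hψ : ∀ y, HasDerivAt ψ (ψ' y) y)
    (hψ' : Continuous ψ') (h0 : ∀ y ≤ g.b, ψ y = 0) : g.V :=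
  ⟨(fun p => ψ p.2 * g.phi j p.1, fun p => Complex.I * g.lam j * (ψ p.2 * g.phi j p.1),
    fun p => ψ' p.2 * g.phi j p.1),
    have hc : Continuous ψ := continuous_iff_continuousAt.2 fun y => (hψ y).continuousAt
    { cont := by fun_prop
      contx := by fun_prop
      conty := by fun_prop
      derivx := fun x y => by
        refine ((g.hasDerivAt_phi j x).const_mul (ψ y)).congr_deriv ?_
        simp only; ring
      derivy := fun x y => (hψ y).mul_const (g.phi j x)
      qper := fun x y => by simp only [phi_add_L]; ring
      zero := ⟨g.b - g.M, sub_pos.2 g.M_lt_b, fun x y hy => by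
        simp only
        rw [h0 y (by linarith [g.le_M x]), zero_mul]⟩ }⟩

section modeTest
variable (j : ℤ) {ψ ψ' : ℝ → ℂ} (hψ : ∀ y, HasDerivAt ψ (ψ' y) y)
    (hψ' : Continuous ψ') (h0 : ∀ y ≤ g.b, ψ y = 0)

theorem q_modeTest (i : ℤ) (y : ℝ) :
    q (modeTest j hψ hψ' h0) i y = if i = j then ψ y else 0 := by
  change g.coef (fun x => ψ y * g.phi j x) i = _
  rw [coef_const_mul, coef_phi]; split_ifs <;> simp

theorem pd_modeTest (i : ℤ) (y : ℝ) :
    pd (modeTest j hψ hψ' h0) i y = if i = j then ψ' y else 0 := by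
  change g.coef (fun x => ψ' y * g.phi j x) i = _
  rw [coef_const_mul, coef_phi]; split_ifs <;> simp

theorem bform_modeTest (v : g.V) : bform v (modeTest j hψ hψ' h0)
    = g.m j * (q v j g.H * conj (ψ g.H)) := by
  rw [bform, tsum_eq_single j]
  · rw [q_modeTest, if_pos rfl]
  · intro i hi
    rw [q_modeTest, if_neg hi]; simp

theorem eform_modeTest (v : g.V) : eform v (modeTest j hψ hψ' h0)
    = ∫ y in (0 : ℝ)..g.H, ((g.lam j ^ 2 - g.k ^ 2 : ℝ) * (q v j y * conj (ψ y))
        + pd v j y * conj (ψ' y)) := by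
  rw [eform, g.integral_box (by fun_prop)]
  congr 1; funext y
  have e : ∀ x, dx v (x, y) * conj (dx (modeTest j hψ hψ' h0) (x, y))
      + dy v (x, y) * conj (dy (modeTest j hψ hψ' h0) (x, y))
      - g.k ^ 2 * (fn v (x, y) * conj (fn (modeTest j hψ hψ' h0) (x, y)))
      = (-(Complex.I * g.lam j) * conj (ψ y)) * (dx v (x, y) * conj (g.phi j x))
        + conj (ψ' y) * (dy v (x, y) * conj (g.phi j x))
        - (g.k ^ 2 * conj (ψ y)) * (fn v (x, y) * conj (g.phi j x)) := by
    intro x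
    change dx v (x, y) * conj (Complex.I * g.lam j * (ψ y * g.phi j x))
      + dy v (x, y) * conj (ψ' y * g.phi j x)
      - g.k ^ 2 * (fn v (x, y) * conj (ψ y * g.phi j x)) = _
    simp only [map_mul, Complex.conj_I, Complex.conj_ofReal]
    ring
  simp only [e]
  rw [intervalIntegral.integral_sub, intervalIntegral.integral_add,
    intervalIntegral.integral_const_mul, intervalIntegral.integral_const_mul,
    intervalIntegral.integral_const_mul]
  · have h1 := coef_dx v j y
    have h2 : pd v j y = ∫ x in (0 : ℝ)..g.L, dy v (x, y) * conj (g.phi j x) := rfl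
    have h3 : q v j y = ∫ x in (0 : ℝ)..g.L, fn v (x, y) * conj (g.phi j x) := rfl
    rw [coef] at h1
    rw [h1, ← h2, ← h3]
    push_cast
    linear_combination (-(g.lam j : ℂ) ^ 2 * conj (ψ y) * q v j y) * Complex.I_sq
  all_goals exact Continuous.intervalIntegrable (by fun_prop) _ _

/-- The form tested against a single mode, factorised by a characteristic root. -/
theorem aform_modeTest (v : g.V) {a : ℂ} (ha : a ^ 2 = ((g.lam j ^ 2 - g.k ^ 2 : ℝ) : ℂ)) :
    aform v (modeTest j hψ hψ' h0)
      = (∫ y in (0 : ℝ)..g.H, (pd v j y + a * q v j y) * (conj (ψ' y) + a * conj (ψ y)))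
        + (g.m j - a) * (q v j g.H * conj (ψ g.H)) := by
  have hc : Continuous ψ := continuous_iff_continuousAt.2 fun y => (hψ y).continuousAt
  have h1 := intervalIntegral.integral_eq_sub_of_hasDerivAt (a := 0) (b := g.H)
    (fun y _ => (hasDerivAt_q v j y).mul (hψ y).star)
    (Continuous.intervalIntegrable (by fun_prop) _ _)
  simp only [Pi.mul_apply, q_zero_le v j le_rfl, zero_mul, sub_zero] at h1
  change _ = q v j g.H * conj (ψ g.H) at h1
  rw [aform, bform_modeTest, eform_modeTest, ← ha]
  have e : ∀ y, (pd v j y + a * q v j y) * (conj (ψ' y) + a * conj (ψ y))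
      = (a ^ 2 * (q v j y * conj (ψ y)) + pd v j y * conj (ψ' y))
        + a * (pd v j y * conj (ψ y) + q v j y * conj (ψ' y)) := fun y => by ring
  simp only [e]
  rw [intervalIntegral.integral_add (f := fun y => a ^ 2 * (q v j y * conj (ψ y))
    + pd v j y * conj (ψ' y)), intervalIntegral.integral_const_mul a]
  · change _ = _ + a * (∫ y in (0 : ℝ)..g.H, (pd v j y * star (ψ y) + q v j y * star (ψ' y))) + _
    rw [h1]; ring
  all_goals exact Continuous.intervalIntegrable (by fun_prop) _ _

end modeTest

theorem aform_sum_right {ι : Type*} (v : g.V) (F : Finset ι) (z : ι → g.V) :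
    aform v (∑ j ∈ F, z j) = ∑ j ∈ F, aform v (z j) :=
  map_sum (AddMonoidHom.mk' (aform v) (aform_add_right v)) z F

theorem q_sum {ι : Type*} (F : Finset ι) (z : ι → g.V) (i : ℤ) (y : ℝ) :
    q (∑ j ∈ F, z j) i y = ∑ j ∈ F, q (z j) i y :=
  map_sum (AddMonoidHom.mk' (fun w : g.V => q w i y) (fun u w => q_add u w i y)) z F

theorem pd_sum {ι : Type*} (F : Finset ι) (z : ι → g.V) (i : ℤ) (y : ℝ) :
    pd (∑ j ∈ F, z j) i y = ∑ j ∈ F, pd (z j) i y :=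
  map_sum (AddMonoidHom.mk' (fun w : g.V => pd w i y) (fun u w => pd_add u w i y)) z F

theorem nsq_eq_of_finite {z : g.V} {F : Finset ℤ} (hq : ∀ j ∉ F, ∀ y, q z j y = 0)
    (hp : ∀ j ∉ F, ∀ y, pd z j y = 0) :
    nsq z = ∑ j ∈ F, ∫ y in (0 : ℝ)..g.H,
      ((1 + g.lam j ^ 2) * ‖q z j y‖ ^ 2 + ‖pd z j y‖ ^ 2) := by
  rw [← intervalIntegral.integral_finsetSum fun j _ =>
    Continuous.intervalIntegrable (by fun_prop) _ _]
  rw [nsq_eq, ← intervalIntegral.integral_add, ← intervalIntegral.integral_add]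
  rotate_left
  all_goals try exact Continuous.intervalIntegrable (by fun_prop) _ _
  congr 1; funext y
  have h1 := (hasSum_Qd z y).unique
    (hasSum_sum_of_ne_finset_zero (s := F) fun j hj => by simp [hq j hj])
  have h2 := (hasSum_Xd z y).unique
    (hasSum_sum_of_ne_finset_zero (s := F) fun j hj => by simp [hq j hj])
  have h3 := (hasSum_Pd z y).unique
    (hasSum_sum_of_ne_finset_zero (s := F) fun j hj => by simp [hp j hj])
  rw [h1, h2, h3, ← Finset.sum_add_distrib, ← Finset.sum_add_distrib]
  exact Finset.sum_congr rfl fun j _ => by ring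

end Geo

theorem le_of_self_bounding {Z s Y C : ℝ} (hC : 0 < C) (hZ : 0 ≤ Z)
    (h1 : Z ≤ s * Y) (h2 : Y ^ 2 ≤ C * Z) : Z ≤ C * s ^ 2 := by
  rcases hZ.eq_or_lt with h0 | h0
  · rw [← h0]; positivity
  · have h3 : Z ^ 2 ≤ s ^ 2 * Y ^ 2 := by
      rw [← mul_pow]; exact pow_le_pow_left₀ hZ h1 2
    have h4 : Z * Z ≤ (C * s ^ 2) * Z := by nlinarith [mul_le_mul_of_nonneg_left h2 (sq_nonneg s)]
    exact le_of_mul_le_mul_right h4 h0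

namespace Geo
variable {g : Geo}

/-- The factor `q' + a q` of a mode. -/
noncomputable def zeta (v : g.V) (a : ℂ) (j : ℤ) (y : ℝ) : ℂ := pd v j y + a * q v j y

@[fun_prop] theorem continuous_zeta (v : g.V) (a : ℂ) (j : ℤ) : Continuous (zeta v a j) := by
  unfold zeta; fun_prop

theorem int_chi_zeta_nonneg (v : g.V) (a : ℂ) (j : ℤ) :
    0 ≤ ∫ y in (0 : ℝ)..g.H, g.chi y * ‖zeta v a j y‖ ^ 2 :=
  int_nonneg g.H_pos.le fun y => mul_nonneg (g.chi_nonneg y) (sq_nonneg _)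

theorem strip_test (g : Geo) : ∃ C : ℝ, 0 < C ∧ ∀ (v : g.V) (F : Finset ℤ) (a : ℤ → ℂ),
    (∀ j, 0 ≤ (a j).re) → (∀ j, a j ^ 2 = ((g.lam j ^ 2 - g.k ^ 2 : ℝ) : ℂ)) →
    ∃ (z : g.V) (t : ℤ → ℂ),
      aform v z = ∑ j ∈ F, (((∫ y in (0 : ℝ)..g.H, g.chi y * ‖zeta v (a j) j y‖ ^ 2 : ℝ) : ℂ)
        + (g.m j - a j) * (q v j g.H * conj (t j))) ∧
      nrm z ^ 2 ≤ C * ∑ j ∈ F, ∫ y in (0 : ℝ)..g.H, g.chi y * ‖zeta v (a j) j y‖ ^ 2 ∧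
      ∀ j ∈ F, ‖t j‖ ≤ nrm z := by
  classical
  have hH := g.H_pos
  have hcc := g.cc_pos
  refine ⟨((1 + 3 * g.k ^ 2) * g.H ^ 2 + 2) * (2 * g.cc * g.H), by positivity,
    fun v F a hre hsq => ?_⟩
  let w : ℤ → ℝ → ℂ := fun j y => g.chi y * zeta v (a j) j y
  have hw : ∀ j, Continuous (w j) := fun j => by fun_prop
  have hw0 : ∀ j, ∀ y ≤ g.b, w j y = 0 := fun j y hy => by simp [w, g.chi_zero hy]
  let ψ : ℤ → ℝ → ℂ := fun j => duhamel (conj (a j)) g.b (w j)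
  let ψ' : ℤ → ℝ → ℂ := fun j y => w j y - conj (a j) * ψ j y
  have hψc : ∀ j, Continuous (ψ j) := fun j => continuous_duhamel _ _ (hw j)
  have hψ : ∀ j y, HasDerivAt (ψ j) (ψ' j y) y := fun j y => hasDerivAt_duhamel _ _ (hw j) y
  have hψ' : ∀ j, Continuous (ψ' j) := fun j =>
    (hw j).sub (continuous_const.mul (hψc j))
  have hψ0 : ∀ j, ∀ y ≤ g.b, ψ j y = 0 := fun j y hy => duhamel_zero _ (hw0 j) hy
  let z : ℤ → g.V := fun j => modeTest j (hψ j) (hψ' j) (hψ0 j)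
  have hqz : ∀ i y, q (∑ j ∈ F, z j) i y = if i ∈ F then ψ i y else 0 := by
    intro i y
    simp only [q_sum, z, q_modeTest, Finset.sum_ite_eq]
  have hpz : ∀ i y, pd (∑ j ∈ F, z j) i y = if i ∈ F then ψ' i y else 0 := by
    intro i y
    simp only [pd_sum, z, pd_modeTest, Finset.sum_ite_eq]
  refine ⟨∑ j ∈ F, z j, fun j => ψ j g.H, ?_, ?_, fun j hj => ?_⟩
  · rw [aform_sum_right]
    refine Finset.sum_congr rfl fun j _ => ?_
    rw [aform_modeTest _ _ _ _ _ (hsq j)]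
    congr 1
    rw [← intervalIntegral.integral_ofReal]
    congr 1; funext y
    have : conj (ψ' j y) + a j * conj (ψ j y) = g.chi y * conj (zeta v (a j) j y) := by
      simp only [ψ', w, map_sub, map_mul, Complex.conj_conj, Complex.conj_ofReal]; ring
    rw [this, mul_left_comm]
    push_cast
    rw [← Complex.mul_conj']
    rfl
  · rw [nrm_sq, nsq_eq_of_finite (F := F) (fun j hj y => by rw [hqz, if_neg hj])
      (fun j hj y => by rw [hpz, if_neg hj]), Finset.mul_sum]
    refine Finset.sum_le_sum fun j hj => ?_
    have h1 := duhamel_energy (a := conj (a j)) (b := g.b) (H := g.H) (k := g.k) (l := g.lam j)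
      (by simpa using hre j) g.b_pos.le g.b_lt_H.le
      (by rw [← map_pow, hsq, Complex.conj_ofReal]) (hw j) (hw0 j)
    have e : ∀ y, (1 + g.lam j ^ 2) * ‖q (∑ j ∈ F, z j) j y‖ ^ 2 + ‖pd (∑ j ∈ F, z j) j y‖ ^ 2
        = (1 + g.lam j ^ 2) * ‖ψ j y‖ ^ 2 + ‖ψ' j y‖ ^ 2 := fun y => by
      rw [hqz, hpz, if_pos hj, if_pos hj]
    simp only [e]
    refine h1.trans ?_
    rw [mul_assoc, ← intervalIntegral.integral_const_mul (2 * g.cc * g.H)]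
    refine mul_le_mul_of_nonneg_left ?_ (by positivity)
    refine intervalIntegral.integral_mono_on hH.le
      (Continuous.intervalIntegrable (by fun_prop) _ _)
      (Continuous.intervalIntegrable (by fun_prop) _ _) fun y hy => ?_
    simp only [w]
    rw [norm_mul, mul_pow, Complex.norm_real, Real.norm_eq_abs, sq_abs, ← mul_assoc]
    refine mul_le_mul_of_nonneg_right ?_ (sq_nonneg _)
    rw [sq]
    exact mul_le_mul_of_nonneg_right (g.chi_le hy.2) (g.chi_nonneg y)
  · have := norm_trace_le (∑ j ∈ F, z j) j
    rwa [hqz, if_pos hj] at this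

/-- The hypothesis of the inf-sup estimate. -/
def Small (v : g.V) (ε : ℝ) : Prop := ∀ z, ‖aform v z‖ ≤ ε * nrm z

theorem strip_incoming (g : Geo) : ∃ C : ℝ, 0 < C ∧ ∀ (v : g.V) (ε : ℝ), 0 ≤ ε → Small v ε →
    ∀ F : Finset ℤ, ∑ j ∈ F, ∫ y in (0 : ℝ)..g.H, g.chi y * ‖zeta v (g.m j) j y‖ ^ 2
      ≤ C * ε ^ 2 := by
  obtain ⟨C, hC, h⟩ := strip_test g
  refine ⟨C, hC, fun v ε hε hv F => ?_⟩
  obtain ⟨z, t, h1, h2, -⟩ := h v F g.m g.m_re_nonneg g.m_sq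
  have hZ : 0 ≤ ∑ j ∈ F, ∫ y in (0 : ℝ)..g.H, g.chi y * ‖zeta v (g.m j) j y‖ ^ 2 :=
    Finset.sum_nonneg fun j _ => int_chi_zeta_nonneg v _ j
  refine le_of_self_bounding hC hZ ?_ h2
  have h3 := hv z
  simp only [sub_self, zero_mul, add_zero] at h1
  rw [h1, ← Complex.ofReal_sum, Complex.norm_real, Real.norm_of_nonneg hZ] at h3
  exact h3

theorem norm_m_prop {j : ℤ} (hj : ¬ g.k ^ 2 < g.lam j ^ 2) :
    ‖g.m j‖ = -(g.m j).im ∧ ‖g.m j‖ ≤ g.k := by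
  obtain ⟨h1, h2⟩ := g.m_prop hj
  constructor
  · have : g.m j = ((g.m j).im : ℂ) * Complex.I := Complex.ext (by simp [h1]) (by simp)
    rw [this, norm_mul, Complex.norm_I, mul_one, Complex.norm_real, Real.norm_of_nonpos h2.le]
    simp
  · refine le_of_sq_le_sq ?_ g.k_pos.le
    rw [norm_m_sq, abs_of_nonpos (by linarith)]
    nlinarith [sq_nonneg (g.lam j)]

theorem strip_outgoing (g : Geo) : ∃ C : ℝ, 0 < C ∧ ∀ (v : g.V) (ε : ℝ), 0 ≤ ε → Small v ε →
    ∀ j, ¬ g.k ^ 2 < g.lam j ^ 2 →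
      ∫ y in (0 : ℝ)..g.H, g.chi y * ‖zeta v (-g.m j) j y‖ ^ 2 ≤ C * (ε ^ 2 + ε * nrm v) := by
  obtain ⟨C, hC, h⟩ := strip_test g
  have hk := g.k_pos
  refine ⟨C * (2 + 8 * g.k), by positivity, fun v ε hε hv j hj => ?_⟩
  have hre : ∀ i, 0 ≤ ((if i = j then -g.m i else g.m i).re) := by
    intro i
    split_ifs with hi
    · subst hi; simp [(g.m_prop hj).1]
    · exact g.m_re_nonneg i
  obtain ⟨z, t, h1, h2, h3⟩ := h v {j} (fun i => if i = j then -g.m i else g.m i) hre (fun i => by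
    split_ifs
    · rw [neg_sq, m_sq]
    · rw [m_sq])
  simp only [Finset.sum_singleton, if_true] at h1 h2
  have h3 := h3 j (Finset.mem_singleton_self j)
  have hZ := int_chi_zeta_nonneg v (-g.m j) j
  generalize ∫ y in (0 : ℝ)..g.H, g.chi y * ‖zeta v (-g.m j) j y‖ ^ 2 = Z at *
  have h4 : Z ≤ (ε + 2 * (‖g.m j‖ * ‖q v j g.H‖)) * nrm z := by
    have e : (Z : ℂ) = aform v z - 2 * g.m j * (q v j g.H * conj (t j)) := by
      rw [h1]; ring
    have h5 : Z = ‖(Z : ℂ)‖ := by rw [Complex.norm_real, Real.norm_of_nonneg hZ]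
    rw [h5, e]
    refine (norm_sub_le _ _).trans ?_
    rw [norm_mul, norm_mul, norm_mul, RCLike.norm_conj, Complex.norm_ofNat]
    have := hv z
    have := mul_le_mul_of_nonneg_left h3 (show 0 ≤ 2 * (‖g.m j‖ * ‖q v j g.H‖) by positivity)
    linarith
  have h5 := le_of_self_bounding hC hZ h4 h2
  have h6 : ‖g.m j‖ * ‖q v j g.H‖ ^ 2 ≤ ε * nrm v := by
    rw [(norm_m_prop hj).1]
    exact (im_trace_le_aform v j).trans (hv v)
  have h7 : (‖g.m j‖ * ‖q v j g.H‖) ^ 2 ≤ g.k * (ε * nrm v) := by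
    calc _ = ‖g.m j‖ * (‖g.m j‖ * ‖q v j g.H‖ ^ 2) := by ring
      _ ≤ _ := mul_le_mul (norm_m_prop hj).2 h6 (by positivity) hk.le
  refine h5.trans ?_
  rw [mul_assoc]
  refine mul_le_mul_of_nonneg_left ?_ hC.le
  have hN := mul_nonneg hε (nrm_nonneg v)
  have := mul_nonneg hk.le (sq_nonneg ε)
  nlinarith [sq_nonneg (ε - 2 * (‖g.m j‖ * ‖q v j g.H‖))]

theorem finite_propagating (g : Geo) : {j : ℤ | ¬ g.k ^ 2 < g.lam j ^ 2}.Finite := by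
  have hL := g.L_pos
  set B := (g.k + |g.β|) * g.L with hB
  refine (Set.finite_Icc (-⌈B⌉) ⌈B⌉).subset fun j hj => ?_
  have h1 : |g.lam j| ≤ g.k := abs_le_of_sq_le_sq (not_lt.1 hj) g.k_pos.le
  have h2 : |2 * Real.pi * j / g.L| ≤ g.k + |g.β| := by
    have e : 2 * Real.pi * j / g.L = g.lam j - g.β := by rw [lam]; ring
    rw [e]
    exact (abs_sub _ _).trans (by linarith)
  rw [abs_div, abs_of_pos hL, div_le_iff₀ hL, ← hB, abs_mul, abs_of_pos Real.two_pi_pos] at h2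
  have h3 : |(j : ℝ)| ≤ B := by
    have := Real.pi_gt_three
    nlinarith [abs_nonneg (j : ℝ)]
  rw [abs_le] at h3
  have h4 := Int.le_ceil B
  constructor
  · exact_mod_cast (by push_cast; linarith : ((-⌈B⌉ : ℤ) : ℝ) ≤ j)
  · exact_mod_cast h3.2.trans h4

/-- The modal energy difference. -/
noncomputable def rhoMode (v : g.V) (j : ℤ) (y : ℝ) : ℝ :=
  (g.lam j ^ 2 - g.k ^ 2) * ‖q v j y‖ ^ 2 - ‖pd v j y‖ ^ 2

@[fun_prop] theorem continuous_rhoMode (v : g.V) (j : ℤ) : Continuous (rhoMode v j) := by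
  unfold rhoMode; fun_prop

theorem hasSum_rhoMode (v : g.V) (y : ℝ) : HasSum (fun j => rhoMode v j y) (rho v y) := by
  have := ((hasSum_Xd v y).sub ((hasSum_Qd v y).mul_left (g.k ^ 2))).sub (hasSum_Pd v y)
  refine this.congr_fun fun j => ?_
  rw [rhoMode]; ring

theorem abs_rhoMode_le (v : g.V) (j : ℤ) (y : ℝ) :
    |rhoMode v j y| ≤ ‖g.m j‖ ^ 2 * ‖q v j y‖ ^ 2 + ‖pd v j y‖ ^ 2 := by
  rw [norm_m_sq, rhoMode]
  refine (abs_sub _ _).trans ?_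
  rw [abs_mul, abs_of_nonneg (sq_nonneg ‖q v j y‖), abs_of_nonneg (sq_nonneg ‖pd v j y‖)]

theorem tendsto_chi_rho (v : g.V) : Filter.Tendsto
    (fun F : Finset ℤ => ∑ j ∈ F, ∫ y in (0 : ℝ)..g.H, g.chi y * rhoMode v j y) Filter.atTop
    (nhds (∫ y in (0 : ℝ)..g.H, g.chi y * rho v y)) := by
  have e : ∀ F : Finset ℤ, ∑ j ∈ F, ∫ y in (0 : ℝ)..g.H, g.chi y * rhoMode v j y
      = ∫ y in (0 : ℝ)..g.H, ∑ j ∈ F, g.chi y * rhoMode v j y := fun F =>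
    (intervalIntegral.integral_finsetSum fun j _ =>
      Continuous.intervalIntegrable (by fun_prop) _ _).symm
  simp only [e]
  refine intervalIntegral.tendsto_integral_filter_of_dominated_convergence
    (fun y => g.chi y * (Xd v y + g.k ^ 2 * Qd v y + Pd v y)) ?_ ?_ ?_ ?_
  · exact Filter.Eventually.of_forall fun F => Continuous.aestronglyMeasurable (by fun_prop)
  · refine Filter.Eventually.of_forall fun F => Filter.Eventually.of_forall fun y _ => ?_
    rw [← Finset.mul_sum, norm_mul, Real.norm_of_nonneg (g.chi_nonneg y)]
    refine mul_le_mul_of_nonneg_left ?_ (g.chi_nonneg y)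
    refine (norm_sum_le _ _).trans ((Finset.sum_le_sum fun j _ => ?_).trans (sum_modes_le v F y))
    exact abs_rhoMode_le v j y
  · exact Continuous.intervalIntegrable (by fun_prop) _ _
  · exact Filter.Eventually.of_forall fun y _ => (hasSum_rhoMode v y).mul_left (g.chi y)

theorem neg_rhoMode_evan_le (v : g.V) {j : ℤ} (hj : g.k ^ 2 < g.lam j ^ 2) (y : ℝ) {t : ℝ}
    (ht : 0 < t) : -rhoMode v j y ≤ (t * ‖zeta v (g.m j) j y‖ ^ 2
      + t⁻¹ * (2 * (‖g.m j‖ ^ 2 * ‖q v j y‖ ^ 2 + ‖pd v j y‖ ^ 2))) / 2 := by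
  obtain ⟨h1, h2⟩ := g.m_evan hj
  have em : g.m j = ((g.m j).re : ℂ) := Complex.ext (by simp) (by simp [h2])
  have hm := g.norm_m_sq j
  rw [abs_of_pos (by linarith)] at hm
  have e : -rhoMode v j y
      = (zeta v (g.m j) j y * conj (pd v j y - g.m j * q v j y)).re := by
    rw [rhoMode, ← hm, zeta, em]
    simp only [← Complex.normSq_eq_norm_sq, Complex.normSq_apply]
    simp
    ring
  have h3 : ‖pd v j y - g.m j * q v j y‖ ^ 2
      ≤ 2 * (‖g.m j‖ ^ 2 * ‖q v j y‖ ^ 2 + ‖pd v j y‖ ^ 2) := by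
    refine (norm_sub_sq_le _ _).trans ?_
    rw [norm_mul, mul_pow]; linarith
  rw [e]
  refine (Complex.re_le_norm _).trans ?_
  rw [norm_mul, RCLike.norm_conj]
  refine (mul_le_scaling ht).trans ?_
  gcongr

theorem neg_rhoMode_prop (v : g.V) {j : ℤ} (hj : ¬ g.k ^ 2 < g.lam j ^ 2) (y : ℝ) :
    -rhoMode v j y = (‖zeta v (g.m j) j y‖ ^ 2 + ‖zeta v (-g.m j) j y‖ ^ 2) / 2 := by
  have hm := g.norm_m_sq j
  rw [abs_of_nonpos (by linarith)] at hm
  have e1 := norm_add_sq_complex (pd v j y) (g.m j * q v j y)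
  have e2 := norm_add_sq_complex (pd v j y) (-g.m j * q v j y)
  rw [zeta, zeta, e1, e2, norm_mul, norm_mul, norm_neg, mul_pow, hm, rhoMode]
  simp
  ring

theorem neg_int_chi_rho_le (g : Geo) : ∃ C : ℝ, 0 < C ∧ ∀ (v : g.V) (ε : ℝ), 0 ≤ ε → Small v ε →
    -∫ y in (0 : ℝ)..g.H, g.chi y * rho v y ≤ C * (ε * nrm v + ε ^ 2) := by
  classical
  obtain ⟨C1, hC1, hin⟩ := strip_incoming g
  obtain ⟨C2, hC2, hout⟩ := strip_outgoing g
  have hH := g.H_pos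
  have hcc := g.cc_pos
  set J := (finite_propagating g).toFinset with hJ
  set A := 2 * ((2 * g.cc * g.H) * (1 + g.k ^ 2)) with hA
  refine ⟨(C1 + A) + J.card * (C1 + C2), by positivity, fun v ε hε hv => ?_⟩
  have hN := nrm_nonneg v
  set T := (J.card : ℝ) * ((C1 * ε ^ 2 + C2 * (ε ^ 2 + ε * nrm v)) / 2) with hT
  have hI : ∀ {F : ℝ → ℝ}, Continuous F → IntervalIntegrable F volume 0 g.H :=
    fun hF => hF.intervalIntegrable _ _
  have key : ∀ t : ℝ, 0 < t → -(∫ y in (0 : ℝ)..g.H, g.chi y * rho v y) - T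
      ≤ (C1 + A) * (t * ε ^ 2 + t⁻¹ * nrm v ^ 2) / 2 := by
    intro t ht
    have ht' := inv_pos.2 ht
    have hF : ∀ F : Finset ℤ, -∑ j ∈ F, ∫ y in (0 : ℝ)..g.H, g.chi y * rhoMode v j y
        ≤ (C1 + A) * (t * ε ^ 2 + t⁻¹ * nrm v ^ 2) / 2 + T := by
      intro F
      set a : ℤ → ℝ := fun j => ∫ y in (0 : ℝ)..g.H, g.chi y * ‖zeta v (g.m j) j y‖ ^ 2
      set c : ℤ → ℝ := fun j => ∫ y in (0 : ℝ)..g.H,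
        g.chi y * (‖g.m j‖ ^ 2 * ‖q v j y‖ ^ 2 + ‖pd v j y‖ ^ 2) with hc
      have ha : ∀ j, 0 ≤ a j := fun j => int_chi_zeta_nonneg v _ j
      have hc0 : ∀ j, 0 ≤ c j := fun j =>
        int_nonneg hH.le fun y => mul_nonneg (g.chi_nonneg y) (by positivity)
      have hj : ∀ j, -(∫ y in (0 : ℝ)..g.H, g.chi y * rhoMode v j y)
          ≤ (t * a j + t⁻¹ * (2 * c j)) / 2
            + if j ∈ J then (C1 * ε ^ 2 + C2 * (ε ^ 2 + ε * nrm v)) / 2 else 0 := by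
        intro j
        rw [← intervalIntegral.integral_neg]
        by_cases hjp : g.k ^ 2 < g.lam j ^ 2
        · rw [if_neg (by simp [hJ, hjp]), add_zero]
          have e : (t * a j + t⁻¹ * (2 * c j)) / 2 = ∫ y in (0 : ℝ)..g.H,
              ((t / 2) * (g.chi y * ‖zeta v (g.m j) j y‖ ^ 2)
                + t⁻¹ * (g.chi y * (‖g.m j‖ ^ 2 * ‖q v j y‖ ^ 2 + ‖pd v j y‖ ^ 2))) := by
            rw [intervalIntegral.integral_add (hI (by fun_prop)) (hI (by fun_prop)),
              intervalIntegral.integral_const_mul, intervalIntegral.integral_const_mul]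
            ring
          rw [e]
          refine intervalIntegral.integral_mono_on hH.le (hI (by fun_prop)) (hI (by fun_prop))
            fun y _ => ?_
          have := mul_le_mul_of_nonneg_left (neg_rhoMode_evan_le v hjp y ht) (g.chi_nonneg y)
          linarith
        · rw [if_pos (by simp [hJ] at hjp ⊢; exact hjp)]
          have e : ∫ y in (0 : ℝ)..g.H, -(g.chi y * rhoMode v j y)
              = (a j + ∫ y in (0 : ℝ)..g.H, g.chi y * ‖zeta v (-g.m j) j y‖ ^ 2) / 2 := by
            rw [← intervalIntegral.integral_add (hI (by fun_prop)) (hI (by fun_prop)),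
              ← intervalIntegral.integral_div]
            congr 1; funext y
            linear_combination g.chi y * neg_rhoMode_prop v hjp y
          have h1 := hin v ε hε hv {j}
          rw [Finset.sum_singleton] at h1
          have h2 := hout v ε hε hv j hjp
          have h3 := mul_nonneg ht.le (ha j)
          have h4 := mul_nonneg ht'.le (hc0 j)
          rw [e]
          change a j ≤ _ at h1
          linarith
      have hsa : ∑ j ∈ F, a j ≤ C1 * ε ^ 2 := hin v ε hε hv F
      have hsc : 2 * ∑ j ∈ F, c j ≤ A * nrm v ^ 2 := by
        have h1 : ∑ j ∈ F, c j ≤ ∫ y in (0 : ℝ)..g.H,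
            (2 * g.cc * g.H) * (Xd v y + g.k ^ 2 * Qd v y + Pd v y) := by
          rw [hc, ← intervalIntegral.integral_finsetSum fun j _ => hI (by fun_prop)]
          refine intervalIntegral.integral_mono_on hH.le (hI (by fun_prop)) (hI (by fun_prop))
            fun y hy => ?_
          rw [← Finset.mul_sum]
          exact mul_le_mul (g.chi_le hy.2) (sum_modes_le v F y)
            (Finset.sum_nonneg fun j _ => by positivity) (by positivity)
        rw [intervalIntegral.integral_const_mul] at h1
        have h2 := mul_le_mul_of_nonneg_left (int_modes_le v)
          (show 0 ≤ 2 * g.cc * g.H by positivity)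
        rw [nrm_sq, hA]
        linarith
      have hsJ : ∑ j ∈ F, (if j ∈ J then (C1 * ε ^ 2 + C2 * (ε ^ 2 + ε * nrm v)) / 2 else 0)
          ≤ T := by
        rw [← Finset.sum_filter, Finset.sum_const, nsmul_eq_mul]
        refine mul_le_mul_of_nonneg_right ?_ (by positivity)
        exact_mod_cast Finset.card_le_card fun j hj => (Finset.mem_filter.1 hj).2
      rw [← Finset.sum_neg_distrib]
      refine (Finset.sum_le_sum fun j _ => hj j).trans ?_
      rw [Finset.sum_add_distrib, ← Finset.sum_div, Finset.sum_add_distrib, ← Finset.mul_sum,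
        ← Finset.mul_sum, ← Finset.mul_sum]
      have h1 := mul_le_mul_of_nonneg_left hsa ht.le
      have h2 := mul_le_mul_of_nonneg_left hsc ht'.le
      have h3 : 0 ≤ A * (t * ε ^ 2) := by positivity
      have h4 : 0 ≤ C1 * (t⁻¹ * nrm v ^ 2) := by positivity
      linarith
    have := le_of_tendsto (tendsto_chi_rho v).neg (Filter.Eventually.of_forall hF)
    linarith
  have h1 := le_mul_of_forall_scaling hε hN (by positivity) key
  have h2 := mul_nonneg hε hN
  have h3 : T ≤ J.card * (C1 + C2) * (ε * nrm v + ε ^ 2) := by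
    rw [hT, mul_assoc]
    refine mul_le_mul_of_nonneg_left ?_ (by positivity)
    nlinarith [mul_nonneg hC1.le h2, mul_nonneg hC2.le h2, mul_nonneg hC1.le (sq_nonneg ε),
      mul_nonneg hC2.le (sq_nonneg ε)]
  have h4 : 0 ≤ (C1 + A) * ε ^ 2 := by positivity
  linarith

theorem stretch_energy (g : Geo) : ∃ C h0 : ℝ, 0 < C ∧ 0 < h0 ∧ ∀ (v : g.V) (h : ℝ), 0 < h →
    h < h0 → ∃ d : g.V, (∀ j, q d j g.H = 0) ∧
      (∀ x y, y ≤ g.f x + h → fn (v + d) (x, y) = 0) ∧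
      ∀ ε : ℝ, ‖eform v d‖ ≤ ε * nrm d → nrm d ^ 2 ≤ C * h ^ 2 * nrm v ^ 2
        + h * (∫ y in (0 : ℝ)..g.H, (1 - g.chi y) * rho v y) + 2 * ε * nrm d := by
  obtain ⟨C, h0, hC, hh0, H⟩ := stretch_props g
  refine ⟨C + (1 + g.k ^ 2) * C, h0, by positivity, hh0, fun v h hp hh => ?_⟩
  obtain ⟨d, h1, h2, h3, h4⟩ := H v h hp hh
  refine ⟨d, h1, h2, fun ε hε => ?_⟩
  rw [esq_add, ← nrm_sq] at h4
  rw [← nrm_sq] at h3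
  have h5 := (abs_le.1 h4).2
  have h6 := (abs_le.1 (Complex.abs_re_le_norm (eform v d))).1
  have h7 : nrm d ^ 2 = esq d + (1 + g.k ^ 2) * ∫ y in (0 : ℝ)..g.H, Qd d y := by
    rw [nrm_sq, nsq_eq, esq]; ring
  have h8 := mul_le_mul_of_nonneg_left h3 (show 0 ≤ 1 + g.k ^ 2 by positivity)
  linarith

theorem inf_sup_pos (g : Geo) : ∃ C : ℝ, 0 < C ∧ ∀ (v : g.V) (ε : ℝ), 0 < ε → Small v ε →
    nrm v ≤ C * ε := by
  obtain ⟨C1, hC1, H1⟩ := neg_int_chi_rho_le g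
  obtain ⟨C2, h0, hC2, hh0, H2⟩ := stretch_energy g
  have hH := g.H_pos
  have hk := g.k_pos
  set B := 1 + C1 + C2 + 1 with hB
  set D := B * (1 + (1 + g.k ^ 2) * g.H ^ 2) + 1 with hD
  refine ⟨1 / h0 + 2 * D + 1, by positivity, fun v ε hε hv => ?_⟩
  have hN := nrm_nonneg v
  by_cases hs : nrm v * h0 ≤ ε
  · have : nrm v ≤ 1 / h0 * ε := by
      rw [one_div, ← div_eq_inv_mul, le_div_iff₀ hh0]; exact hs
    have : 0 ≤ (2 * D + 1) * ε := by positivity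
    linarith
  push Not at hs
  have hN' : 0 < nrm v := by
    by_contra hc
    have : nrm v = 0 := le_antisymm (not_lt.1 hc) hN
    rw [this, zero_mul] at hs; linarith
  have hA : -∫ y in (0 : ℝ)..g.H, (1 - g.chi y) * rho v y ≤ (C2 + 1) * (ε * nrm v) := by
    obtain ⟨d, d1, -, d3⟩ := H2 v (ε / nrm v) (by positivity) (by
      rw [div_lt_iff₀ hN']; linarith)
    have h1 := d3 ε (by rw [← aform_eq_eform_left v d1]; exact hv d)
    have h2 : 0 ≤ (nrm d - ε) ^ 2 := sq_nonneg _
    have h3 : ε / nrm v * (-∫ y in (0 : ℝ)..g.H, (1 - g.chi y) * rho v y)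
        ≤ C2 * (ε / nrm v) ^ 2 * nrm v ^ 2 + ε ^ 2 := by linarith
    have h4 : C2 * (ε / nrm v) ^ 2 * nrm v ^ 2 + ε ^ 2
        = ε / nrm v * ((C2 + 1) * (ε * nrm v)) := by
      field_simp
    rw [h4] at h3
    exact le_of_mul_le_mul_left h3 (by positivity)
  have hB' := H1 v ε hε.le hv
  have hI : ∀ {F : ℝ → ℝ}, Continuous F → IntervalIntegrable F volume 0 g.H :=
    fun hF => hF.intervalIntegrable _ _
  have e1 : ∫ y in (0 : ℝ)..g.H, rho v y = (∫ y in (0 : ℝ)..g.H, (1 - g.chi y) * rho v y)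
      + ∫ y in (0 : ℝ)..g.H, g.chi y * rho v y := by
    rw [← intervalIntegral.integral_add (hI (by fun_prop)) (hI (by fun_prop))]
    congr 1; funext y; ring
  have e2 : ∫ y in (0 : ℝ)..g.H, rho v y = (∫ y in (0 : ℝ)..g.H, Xd v y)
      - g.k ^ 2 * (∫ y in (0 : ℝ)..g.H, Qd v y) - ∫ y in (0 : ℝ)..g.H, Pd v y := by
    unfold rho
    rw [intervalIntegral.integral_sub (hI (by fun_prop)) (hI (by fun_prop)),
      intervalIntegral.integral_sub (hI (by fun_prop)) (hI (by fun_prop)),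
      intervalIntegral.integral_const_mul]
  have e3 := (esq_le_aform v).trans (hv v)
  rw [esq] at e3
  have e4 := poincare v
  have e5 : nrm v ^ 2 = _ := (nrm_sq v).trans (nsq_eq v)
  have p1 := int_nonneg hH.le (Pd_nonneg v)
  generalize ∫ y in (0 : ℝ)..g.H, Xd v y = X at *
  generalize ∫ y in (0 : ℝ)..g.H, Pd v y = P at *
  generalize ∫ y in (0 : ℝ)..g.H, Qd v y = Q at *
  set S := ε * nrm v + ε ^ 2 with hS
  have hεN := mul_pos hε hN'
  have hP : P ≤ B * S := by
    have s1 : 0 ≤ ε ^ 2 := sq_nonneg ε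
    have : 2 * P ≤ B * S := by
      rw [hB, hS]
      nlinarith [mul_nonneg hC2.le s1]
    linarith
  have hX : X ≤ ε * nrm v + g.k ^ 2 * Q := by linarith
  have hQ : (1 + g.k ^ 2) * Q ≤ (1 + g.k ^ 2) * (g.H ^ 2 * P) :=
    mul_le_mul_of_nonneg_left e4 (by positivity)
  have hfin : nrm v ^ 2 ≤ D * S := by
    have hS0 : 0 ≤ ε ^ 2 := sq_nonneg ε
    have h1 := mul_le_mul_of_nonneg_left hP (show 0 ≤ 1 + (1 + g.k ^ 2) * g.H ^ 2 by positivity)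
    rw [hD]
    linarith
  by_cases hc : nrm v ≤ ε
  · have : 0 ≤ (1 / h0 + 2 * D) * ε := by positivity
    linarith
  · push Not at hc
    have hD0 : 0 < D := by positivity
    have h1 : nrm v * nrm v ≤ (2 * D * ε) * nrm v := by
      have : D * ε ^ 2 ≤ D * (ε * nrm v) := by
        rw [sq]; gcongr
      rw [hS] at hfin
      linarith
    have h2 := le_of_mul_le_mul_right h1 hN'
    have : 0 ≤ (1 / h0 + 1) * ε := by positivity
    linarith

theorem inf_sup (g : Geo) : ∃ C : ℝ, 0 < C ∧ ∀ (v : g.V) (ε : ℝ), 0 ≤ ε → Small v ε →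
    nrm v ≤ C * ε := by
  obtain ⟨C, hC, H⟩ := inf_sup_pos g
  refine ⟨C, hC, fun v ε hε hv => ?_⟩
  rcases hε.eq_or_lt with h | h
  · subst h
    rw [mul_zero]
    refine le_of_forall_pos_le_add fun δ hδ => ?_
    have := H v (δ / C) (by positivity) fun z => (hv z).trans (by
      rw [zero_mul]; exact mul_nonneg (by positivity) (nrm_nonneg z))
    rw [mul_div_cancel₀ _ hC.ne'] at this
    linarith
  · exact H v ε h hv

theorem abs_int_rho_le (v : g.V) : |∫ y in (0 : ℝ)..g.H, (1 - g.chi y) * rho v y|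
    ≤ (1 + 2 * g.cc * g.H) * ((1 + g.k ^ 2) * nsq v) := by
  have hcc := g.cc_pos
  have hH := g.H_pos
  have h0 : 0 ≤ 1 + 2 * g.cc * g.H := by positivity
  refine le_trans ?_ (mul_le_mul_of_nonneg_left (int_modes_le v) h0)
  rw [← intervalIntegral.integral_const_mul]
  refine (intervalIntegral.abs_integral_le_integral_abs hH.le).trans ?_
  refine intervalIntegral.integral_mono_on hH.le
    (Continuous.intervalIntegrable (by fun_prop) _ _)
    (Continuous.intervalIntegrable (by fun_prop) _ _) fun y hy => ?_
  rw [abs_mul]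
  refine mul_le_mul ?_ (abs_rho_le v y) (abs_nonneg _) h0
  have h1 : g.chi y ≤ 2 * g.cc * g.H := by
    unfold chi
    refine mul_le_mul_of_nonneg_left (max_le ?_ hH.le) (by positivity)
    linarith [hy.2, g.b_pos]
  have h2 := g.chi_nonneg y
  rw [abs_le]; constructor <;> linarith

/-- Approximate solutions of the dual problem for the top Fourier coefficients, which split near
the profile into a function vanishing there and a small remainder. -/
theorem exists_dual (g : Geo) : ∃ C h0 : ℝ, 0 < C ∧ 0 < h0 ∧ ∀ (j : ℤ) (h ε : ℝ), 0 < h → h < h0 →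
    0 < ε → ∃ u d : g.V, (∀ z, ‖aform z u - q z j g.H‖ ≤ ε * nrm z) ∧
      (∀ x y, y ≤ g.f x + h → fn (u + d) (x, y) = 0) ∧ nsq d ≤ C * (h + ε ^ 2) := by
  obtain ⟨C1, hC1, H1⟩ := inf_sup g
  obtain ⟨C2, h0, hC2, hh0, H2⟩ := stretch_energy g
  have hcc := g.cc_pos
  have hH := g.H_pos
  set A := (1 + 2 * g.cc * g.H) * (1 + g.k ^ 2) with hA
  have hA0 : 0 ≤ A := by positivity
  refine ⟨2 * (C2 * (C1 + 1) ^ 2 + A * (C1 + 1) ^ 2 + 2), min h0 1, by positivity, by positivity,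
    fun j h ε hh hh' hε => ?_⟩
  let G : g.V →ₗ[ℂ] ℂ :=
    { toFun := fun z => q z j g.H
      map_add' := fun v w => q_add v w j g.H
      map_smul' := fun c v => q_smul c v j g.H }
  obtain ⟨u, hu1, hu2⟩ := exists_approx_dual (core (g := g)) nrm nrm_eq aform aform_add_left
    aform_smul_left aform_add_right aform_smul_right (2 * (1 + g.k ^ 2)) (by positivity)
    norm_aform_le C1 hC1.le H1 G 1 zero_le_one
    (fun z => by rw [one_mul]; exact norm_trace_le z j) ε hε
  rw [one_mul] at hu1
  obtain ⟨d, hd1, hd2, hd3⟩ := H2 u h hh (hh'.trans_le (min_le_left _ _))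
  refine ⟨u, d, hu2, hd2, ?_⟩
  have he : ‖eform u d‖ ≤ ε * nrm d := by
    have := hu2 d
    rw [aform_eq_eform_right u hd1] at this
    change ‖eform d u - q d j g.H‖ ≤ _ at this
    rw [hd1, sub_zero, ← eform_conj, RCLike.norm_conj] at this
    exact this
  have h3 := hd3 ε he
  have h4 := (le_abs_self _).trans (abs_int_rho_le u)
  have h5 : nrm u ^ 2 ≤ (C1 + 1) ^ 2 := pow_le_pow_left₀ (nrm_nonneg u) hu1 2
  have h6 : nsq u ≤ (C1 + 1) ^ 2 := by rw [← nrm_sq]; exact h5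
  have hh1 : h < 1 := hh'.trans_le (min_le_right _ _)
  have h7 : (∫ y in (0 : ℝ)..g.H, (1 - g.chi y) * rho u y) ≤ A * (C1 + 1) ^ 2 := by
    refine h4.trans ?_
    rw [← mul_assoc]
    exact mul_le_mul_of_nonneg_left h6 hA0
  have h8 : C2 * h ^ 2 * nrm u ^ 2 ≤ C2 * h * (C1 + 1) ^ 2 := by
    refine mul_le_mul (mul_le_mul_of_nonneg_left (by nlinarith) hC2.le) h5 (by positivity)
      (by positivity)
  have h9 := mul_le_mul_of_nonneg_left h7 hh.le
  have h10 : 2 * ε * nrm d ≤ nrm d ^ 2 / 2 + 2 * ε ^ 2 := by nlinarith [sq_nonneg (nrm d - 2 * ε)]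
  rw [← nrm_sq]
  have h11 : 0 ≤ (C2 * (C1 + 1) ^ 2 + A * (C1 + 1) ^ 2) * ε ^ 2 := by positivity
  nlinarith

theorem continuous_mul_of_zero {A c : ℝ × ℝ → ℂ}
    (hA : ContinuousOn A {p : ℝ × ℝ | g.f p.1 < p.2}) (hc : Continuous c)
    (h0 : ∃ δ > 0, ∀ x y, y < g.f x + δ → c (x, y) = 0) : Continuous fun p => A p * c p := by
  obtain ⟨δ, hδ, h0⟩ := h0
  have hf := g.lip.continuous
  rw [continuous_iff_continuousAt]
  intro p
  by_cases hp : g.f p.1 < p.2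
  · have ho : IsOpen {p : ℝ × ℝ | g.f p.1 < p.2} :=
      isOpen_lt (hf.comp continuous_fst) continuous_snd
    exact (hA.continuousAt (ho.mem_nhds hp)).mul hc.continuousAt
  · have ho : IsOpen {p : ℝ × ℝ | p.2 < g.f p.1 + δ} :=
      isOpen_lt continuous_snd ((hf.comp continuous_fst).add continuous_const)
    refine (continuousAt_const (y := (0 : ℂ))).congr ?_
    filter_upwards [ho.mem_nhds (show p.2 < g.f p.1 + δ by linarith [not_lt.1 hp])] with z hz
    rw [h0 z.1 z.2 hz, mul_zero]

/-- An outgoing quasi-periodic solution of the Helmholtz equation, continuously differentiable up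
to the profile, together with its derivatives. -/
structure Field (g : Geo) where
  w : ℝ × ℝ → ℂ
  wx : ℝ × ℝ → ℂ
  wy : ℝ × ℝ → ℂ
  wxx : ℝ × ℝ → ℂ
  wyy : ℝ × ℝ → ℂ
  cont : ContinuousOn w {p : ℝ × ℝ | g.f p.1 ≤ p.2}
  contx : ContinuousOn wx {p : ℝ × ℝ | g.f p.1 ≤ p.2}
  conty : ContinuousOn wy {p : ℝ × ℝ | g.f p.1 ≤ p.2}
  contxx : ContinuousOn wxx {p : ℝ × ℝ | g.f p.1 < p.2}
  contyy : ContinuousOn wyy {p : ℝ × ℝ | g.f p.1 < p.2}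
  derivx : ∀ x y, g.f x < y → HasDerivAt (fun t => w (t, y)) (wx (x, y)) x
  derivy : ∀ x y, g.f x < y → HasDerivAt (fun t => w (x, t)) (wy (x, y)) y
  derivxx : ∀ x y, g.f x < y → HasDerivAt (fun t => wx (t, y)) (wxx (x, y)) x
  derivyy : ∀ x y, g.f x < y → HasDerivAt (fun t => wy (x, t)) (wyy (x, y)) y
  helm : ∀ x y, g.f x < y → wxx (x, y) + wyy (x, y) + (g.k : ℂ) ^ 2 * w (x, y) = 0
  qper : ∀ x y, g.f x < y → w (x + g.L, y) = g.nu * w (x, y)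
  qperx : ∀ x y, g.f x < y → wx (x + g.L, y) = g.nu * wx (x, y)
  top : ∀ j, g.coef (fun x => wy (x, g.H)) j = -g.m j * g.coef (fun x => w (x, g.H)) j

namespace Field

variable (W : Field g)

theorem open_subset : {p : ℝ × ℝ | g.f p.1 < p.2} ⊆ {p : ℝ × ℝ | g.f p.1 ≤ p.2} :=
  fun p (h : g.f p.1 < p.2) => h.le

theorem f_lt_H (x : ℝ) : g.f x < g.H := by linarith [g.le_M x, g.M_lt_b, g.b_lt_H]

theorem continuous_top {A : ℝ × ℝ → ℂ} (hA : ContinuousOn A {p : ℝ × ℝ | g.f p.1 ≤ p.2}) :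
    Continuous fun x => A (x, g.H) := by
  rw [← continuousOn_univ]
  exact hA.comp (by fun_prop : Continuous fun x : ℝ => (x, g.H)).continuousOn
    fun x _ => (f_lt_H x).le

theorem zero_fn (u : g.V) : ∃ δ > 0, ∀ x y, y < g.f x + δ → conj (fn u (x, y)) = 0 := by
  obtain ⟨δ, hδ, h⟩ := exists_zero u
  exact ⟨δ, hδ, fun x y hy => by rw [(h x y hy).1, map_zero]⟩
theorem zero_dx (u : g.V) : ∃ δ > 0, ∀ x y, y < g.f x + δ → conj (dx u (x, y)) = 0 := by
  obtain ⟨δ, hδ, h⟩ := exists_zero u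
  exact ⟨δ, hδ, fun x y hy => by rw [(h x y hy).2.1, map_zero]⟩
theorem zero_dy (u : g.V) : ∃ δ > 0, ∀ x y, y < g.f x + δ → conj (dy u (x, y)) = 0 := by
  obtain ⟨δ, hδ, h⟩ := exists_zero u
  exact ⟨δ, hδ, fun x y hy => by rw [(h x y hy).2.2, map_zero]⟩

theorem hasDerivAt_conj {a : ℝ → ℂ} {a' : ℂ} {x : ℝ} (h : HasDerivAt a a' x) :
    HasDerivAt (fun t => conj (a t)) (conj a') x :=
  Complex.conjCLE.toContinuousLinearMap.hasFDerivAt.comp_hasDerivAt x h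

theorem hasDerivAt_mul_x {A : ℝ × ℝ → ℂ} {A' : ℂ} {x y : ℝ} (u : g.V)
    (hA : g.f x < y → HasDerivAt (fun t => A (t, y)) A' x) :
    HasDerivAt (fun t => A (t, y) * conj (fn u (t, y)))
      (A' * conj (fn u (x, y)) + A (x, y) * conj (dx u (x, y))) x := by
  by_cases h : g.f x < y
  · exact (hA h).mul (hasDerivAt_conj (hasDerivAt_fn_x u x y))
  · obtain ⟨δ, hδ, h0⟩ := exists_zero u
    have hy : y < g.f x + δ := by linarith [not_lt.1 h]
    rw [(h0 x y hy).1, (h0 x y hy).2.1, map_zero, mul_zero, mul_zero, add_zero]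
    refine (hasDerivAt_const x (0 : ℂ)).congr_of_eventuallyEq ?_
    have ho : IsOpen {t : ℝ | y < g.f t + δ} :=
      isOpen_lt continuous_const (g.lip.continuous.add continuous_const)
    filter_upwards [ho.mem_nhds hy] with t ht
    rw [(h0 t y ht).1, map_zero, mul_zero]

theorem hasDerivAt_mul_y {A : ℝ × ℝ → ℂ} {A' : ℂ} {x y : ℝ} (u : g.V)
    (hA : g.f x < y → HasDerivAt (fun t => A (x, t)) A' y) :
    HasDerivAt (fun t => A (x, t) * conj (fn u (x, t)))
      (A' * conj (fn u (x, y)) + A (x, y) * conj (dy u (x, y))) y := by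
  by_cases h : g.f x < y
  · exact (hA h).mul (hasDerivAt_conj (hasDerivAt_fn_y u x y))
  · obtain ⟨δ, hδ, h0⟩ := exists_zero u
    have hy : y < g.f x + δ := by linarith [not_lt.1 h]
    rw [(h0 x y hy).1, (h0 x y hy).2.2, map_zero, mul_zero, mul_zero, add_zero]
    refine (hasDerivAt_const y (0 : ℂ)).congr_of_eventuallyEq ?_
    filter_upwards [Iio_mem_nhds hy] with t ht
    rw [(h0 x t ht).1, map_zero, mul_zero]

/-- The integrand of the Dirichlet form of `W` and `u`. -/
noncomputable def dens (u : g.V) (p : ℝ × ℝ) : ℂ :=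
  W.wx p * conj (dx u p) + W.wy p * conj (dy u p) - g.k ^ 2 * (W.w p * conj (fn u p))

theorem continuous_dens (u : g.V) : Continuous (W.dens u) := by
  have h1 := continuous_mul_of_zero (W.contx.mono open_subset) (c := fun p => conj (dx u p))
    (by fun_prop) (zero_dx u)
  have h2 := continuous_mul_of_zero (W.conty.mono open_subset) (c := fun p => conj (dy u p))
    (by fun_prop) (zero_dy u)
  have h3 := continuous_mul_of_zero (W.cont.mono open_subset) (c := fun p => conj (fn u p))
    (by fun_prop) (zero_fn u)
  exact (h1.add h2).sub (continuous_const.mul h3)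

/-- Green's identity. -/
theorem integral_dens (u : g.V) : ∫ p, W.dens u p ∂g.box
    = ∫ x in (0 : ℝ)..g.L, W.wy (x, g.H) * conj (fn u (x, g.H)) := by
  have cx := continuous_mul_of_zero (W.contx.mono open_subset) (c := fun p => conj (dx u p))
    (by fun_prop) (zero_dx u)
  have cy := continuous_mul_of_zero (W.conty.mono open_subset) (c := fun p => conj (dy u p))
    (by fun_prop) (zero_dy u)
  have cxx := continuous_mul_of_zero W.contxx (c := fun p => conj (fn u p)) (by fun_prop)
    (zero_fn u)
  have cyy := continuous_mul_of_zero W.contyy (c := fun p => conj (fn u p)) (by fun_prop)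
    (zero_fn u)
  have c1 : Continuous fun p => W.wxx p * conj (fn u p) + W.wx p * conj (dx u p) := cxx.add cx
  have c2 : Continuous fun p => W.wyy p * conj (fn u p) + W.wy p * conj (dy u p) := cyy.add cy
  have e : W.dens u = fun p => (W.wxx p * conj (fn u p) + W.wx p * conj (dx u p))
      + (W.wyy p * conj (fn u p) + W.wy p * conj (dy u p)) := by
    funext ⟨x, y⟩
    by_cases h : g.f x < y
    · have := W.helm x y h
      rw [dens]
      linear_combination (-conj (fn u (x, y))) * this
    · obtain ⟨δ, hδ, h0⟩ := exists_zero u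
      have hy : y < g.f x + δ := by linarith [not_lt.1 h]
      simp [dens, h0 x y hy]
  have i1 : ∫ p, (W.wxx p * conj (fn u p) + W.wx p * conj (dx u p)) ∂g.box = 0 := by
    rw [g.integral_box c1, intervalIntegral.integral_congr (g := fun _ => (0 : ℂ)),
      intervalIntegral.integral_zero]
    intro y _
    simp only
    rw [intervalIntegral.integral_eq_sub_of_hasDerivAt
      (f := fun t => W.wx (t, y) * conj (fn u (t, y)))
      (fun t _ => hasDerivAt_mul_x u fun h => W.derivxx t y h)
      ((c1.comp (by fun_prop : Continuous fun x : ℝ => (x, y))).intervalIntegrable _ _)]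
    have hq := fn_add_L u 0 y
    rw [zero_add] at hq
    by_cases h : g.f 0 < y
    · have hx := W.qperx 0 y h
      rw [zero_add] at hx
      rw [hq, hx, map_mul]
      linear_combination (W.wx (0, y) * conj (fn u (0, y))) * g.nu_mul_conj
    · obtain ⟨δ, hδ, h0⟩ := exists_zero u
      have hy : y < g.f 0 + δ := by linarith [not_lt.1 h]
      rw [hq, (h0 0 y hy).1]; simp
  have i2 : ∫ p, (W.wyy p * conj (fn u p) + W.wy p * conj (dy u p)) ∂g.box
      = ∫ x in (0 : ℝ)..g.L, W.wy (x, g.H) * conj (fn u (x, g.H)) := by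
    rw [g.integral_box' c2]
    refine intervalIntegral.integral_congr fun x _ => ?_
    rw [intervalIntegral.integral_eq_sub_of_hasDerivAt
      (f := fun t => W.wy (x, t) * conj (fn u (x, t)))
      (fun t _ => hasDerivAt_mul_y u fun h => W.derivyy x t h)
      ((c2.comp (by fun_prop : Continuous fun y : ℝ => (x, y))).intervalIntegrable _ _)]
    rw [(zero_of_nonpos u x le_rfl).1, map_zero, mul_zero, sub_zero]
  rw [e, integral_add (g.integrable_box c1) (g.integrable_box c2), i1, i2, zero_add]

theorem bform_eq (u z : g.V) (hz : ∀ x, fn z (x, g.H) = W.w (x, g.H)) :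
    bform z u = -∫ x in (0 : ℝ)..g.L, W.wy (x, g.H) * conj (fn u (x, g.H)) := by
  have h := g.hasSum_coef_mul_conj (continuous_top W.conty)
    (w := fun x => fn u (x, g.H)) (by fun_prop)
  rw [← h.neg.tsum_eq, bform]
  congr 1
  funext j
  have : q z j g.H = g.coef (fun x => W.w (x, g.H)) j := by
    rw [q]; congr 1; funext x; exact hz x
  rw [W.top j, this, q]; ring

theorem aform_eq (u z : g.V) (hz : ∀ x, fn z (x, g.H) = W.w (x, g.H)) :
    aform z u = ∫ p, ((dx z p * conj (dx u p) + dy z p * conj (dy u p)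
      - g.k ^ 2 * (fn z p * conj (fn u p))) - W.dens u p) ∂g.box := by
  rw [integral_sub (g.integrable_box (by fun_prop)) (g.integrable_box (W.continuous_dens u)),
    W.integral_dens, aform, W.bform_eq u z hz, eform, sub_eq_add_neg]

end Field
end Geo

/-- A continuously differentiable step from `0` to `1`. -/
noncomputable def step (r : ℝ) : ℝ :=
  2 * (max r 0) ^ 2 - 4 * (max (r - 1 / 2) 0) ^ 2 + 2 * (max (r - 1) 0) ^ 2
/-- The derivative of `step`. -/
noncomputable def step' (r : ℝ) : ℝ :=
  4 * max r 0 - 8 * max (r - 1 / 2) 0 + 4 * max (r - 1) 0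

@[fun_prop] theorem continuous_step : Continuous step := by unfold step; fun_prop
@[fun_prop] theorem continuous_step' : Continuous step' := by unfold step'; fun_prop

theorem hasDerivAt_step (r : ℝ) : HasDerivAt step (step' r) r := by
  have h1 := (hasDerivAt_max_sq (r - 1 / 2)).comp_sub_const r (1 / 2)
  have h2 := (hasDerivAt_max_sq (r - 1)).comp_sub_const r 1
  refine ((((hasDerivAt_max_sq r).const_mul 2).sub (h1.const_mul 4)).add
    (h2.const_mul 2)).congr_deriv ?_
  rw [step']; ring

theorem step_of_nonpos {r : ℝ} (hr : r ≤ 0) : step r = 0 ∧ step' r = 0 := by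
  rw [step, step', max_eq_right hr, max_eq_right (by linarith), max_eq_right (by linarith)]
  norm_num

theorem step_of_one_le {r : ℝ} (hr : 1 ≤ r) : step r = 1 ∧ step' r = 0 := by
  rw [step, step', max_eq_left (by linarith), max_eq_left (by linarith),
    max_eq_left (by linarith)]
  constructor <;> ring

theorem step_bounds (r : ℝ) : 0 ≤ step r ∧ step r ≤ 1 ∧ |step' r| ≤ 2 := by
  rcases le_total r 0 with h | h
  · rw [(step_of_nonpos h).1, (step_of_nonpos h).2]; norm_num
  rcases le_total 1 r with h1 | h1
  · rw [(step_of_one_le h1).1, (step_of_one_le h1).2]; norm_num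
  rw [step, step', max_eq_left h, max_eq_right (show r - 1 ≤ 0 by linarith), abs_le]
  rcases le_total r (1 / 2) with h2 | h2
  · rw [max_eq_right (show r - 1 / 2 ≤ 0 by linarith)]
    refine ⟨?_, ?_, ?_, ?_⟩ <;> nlinarith
  · rw [max_eq_left (show 0 ≤ r - 1 / 2 by linarith)]
    refine ⟨?_, ?_, ?_, ?_⟩ <;> nlinarith

namespace Geo
variable {g : Geo}

/-- A continuously differentiable periodic profile slightly above `f`. -/
theorem exists_smooth_profile (g : Geo) {h : ℝ} (hh : 0 < h) : ∃ F F' : ℝ → ℝ, Continuous F' ∧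
    (∀ x, HasDerivAt F (F' x) x) ∧ (∀ x, |F' x| ≤ g.K) ∧
    (∀ x, g.f x + h / 4 ≤ F x ∧ F x ≤ g.f x + h / 2) ∧ ∀ x, F (x + g.L) = F x := by
  have hf := g.lip.continuous
  have hK : (0 : ℝ) ≤ g.K := g.K.2
  have hlip : ∀ x y, |g.f x - g.f y| ≤ g.K * |x - y| := fun x y => by
    simpa [Real.dist_eq] using g.lip.dist_le_mul x y
  set s := h / (8 * (g.K + 1)) with hs
  have hs0 : 0 < s := by positivity
  have hKs : g.K * s ≤ h / 8 := by
    rw [hs, mul_div_assoc', div_le_div_iff₀ (by positivity) (by norm_num)]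
    nlinarith
  refine ⟨fun x => (1 / s) * (∫ t in x..x + s, g.f t) + 3 * h / 8,
    fun x => (1 / s) * (g.f (x + s) - g.f x), by fun_prop, fun x => ?_, fun x => ?_,
    fun x => ?_, fun x => ?_⟩
  · have h1 : ∀ a x, HasDerivAt (fun x => ∫ t in a..x, g.f t) (g.f x) x := fun a x =>
      intervalIntegral.integral_hasDerivAt_right (hf.intervalIntegrable _ _)
        (hf.stronglyMeasurableAtFilter _ _) hf.continuousAt
    have h2 := ((h1 0 (x + s)).comp_add_const x s).sub (h1 0 x)
    refine (((h2.congr_of_eventuallyEq (Filter.Eventually.of_forall fun y => ?_)).const_mul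
      (1 / s)).add_const (3 * h / 8))
    simp only [Pi.sub_apply]
    rw [intervalIntegral.integral_interval_sub_left (hf.intervalIntegrable _ _)
      (hf.intervalIntegrable _ _)]
  · rw [abs_mul, abs_of_pos (by positivity), one_div, inv_mul_le_iff₀ hs0]
    have := hlip (x + s) x
    rw [add_sub_cancel_left, abs_of_pos hs0] at this
    linarith
  · have h1 : ∀ t ∈ Set.Icc x (x + s), g.f x - h / 8 ≤ g.f t ∧ g.f t ≤ g.f x + h / 8 := by
      intro t ht
      have h2 := hlip t x
      rw [abs_of_nonneg (by linarith [ht.1] : 0 ≤ t - x)] at h2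
      have h3 : g.K * (t - x) ≤ g.K * s := mul_le_mul_of_nonneg_left (by linarith [ht.2]) hK
      rw [abs_le] at h2
      constructor <;> linarith [h2.1, h2.2]
    have l := intervalIntegral.integral_mono_on (μ := volume) (by linarith : x ≤ x + s)
      (continuous_const.intervalIntegrable _ _) (hf.intervalIntegrable _ _) fun t ht => (h1 t ht).1
    have u := intervalIntegral.integral_mono_on (μ := volume) (by linarith : x ≤ x + s)
      (hf.intervalIntegrable _ _) (continuous_const.intervalIntegrable _ _) fun t ht => (h1 t ht).2
    rw [intervalIntegral.integral_const, add_sub_cancel_left, smul_eq_mul] at l u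
    have l' : g.f x - h / 8 ≤ (1 / s) * ∫ t in x..x + s, g.f t := by
      rw [one_div, le_inv_mul_iff₀ hs0]; exact l
    have u' : (1 / s) * (∫ t in x..x + s, g.f t) ≤ g.f x + h / 8 := by
      rw [one_div, inv_mul_le_iff₀ hs0]; exact u
    constructor <;> linarith
  · simp only
    congr 2
    rw [show x + g.L + s = (x + s) + g.L by ring,
      ← intervalIntegral.integral_comp_add_right (fun t => g.f t) g.L]
    simp only [g.per]

/-- A cutoff which vanishes near the profile and is one at distance `h` from it. -/
structure Cutoff (g : Geo) (C h : ℝ) where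
  η : ℝ × ℝ → ℝ
  ηx : ℝ × ℝ → ℝ
  ηy : ℝ × ℝ → ℝ
  cont : Continuous η
  contx : Continuous ηx
  conty : Continuous ηy
  derivx : ∀ x y, HasDerivAt (fun t => η (t, y)) (ηx (x, y)) x
  derivy : ∀ x y, HasDerivAt (fun t => η (x, t)) (ηy (x, y)) y
  zero : ∀ x y, y ≤ g.f x + h / 4 → η (x, y) = 0 ∧ ηx (x, y) = 0 ∧ ηy (x, y) = 0
  one : ∀ x y, g.f x + h ≤ y → η (x, y) = 1 ∧ ηx (x, y) = 0 ∧ ηy (x, y) = 0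
  nonneg : ∀ p, 0 ≤ η p
  le_one : ∀ p, η p ≤ 1
  boundx : ∀ p, |ηx p| ≤ C / h
  boundy : ∀ p, |ηy p| ≤ C / h
  per : ∀ x y, η (x + g.L, y) = η (x, y)

theorem exists_cutoff (g : Geo) : ∃ C : ℝ, 0 < C ∧ ∀ h : ℝ, 0 < h → Nonempty (g.Cutoff C h) := by
  refine ⟨4 * (g.K + 1), by have := g.K.2; positivity, fun h hh => ?_⟩
  have hK : (0 : ℝ) ≤ g.K := g.K.2
  obtain ⟨F, F', cF', dF, bF, hF, pF⟩ := exists_smooth_profile g hh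
  have cF : Continuous F := continuous_iff_continuousAt.2 fun x => (dF x).continuousAt
  have hr0 : ∀ x y, y ≤ g.f x + h / 4 → 2 / h * (y - F x) ≤ 0 := fun x y hy =>
    mul_nonpos_of_nonneg_of_nonpos (by positivity) (by linarith [(hF x).1])
  have hr1 : ∀ x y, g.f x + h ≤ y → 1 ≤ 2 / h * (y - F x) := fun x y hy => by
    rw [div_mul_eq_mul_div, le_div_iff₀ hh]; linarith [(hF x).2]
  refine ⟨{
    η := fun p => step (2 / h * (p.2 - F p.1))
    ηx := fun p => step' (2 / h * (p.2 - F p.1)) * (2 / h * (-F' p.1))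
    ηy := fun p => step' (2 / h * (p.2 - F p.1)) * (2 / h)
    cont := by fun_prop
    contx := by fun_prop
    conty := by fun_prop
    derivx := fun x y => ?_
    derivy := fun x y => ?_
    zero := fun x y hy => by simp [step_of_nonpos (hr0 x y hy)]
    one := fun x y hy => by simp [step_of_one_le (hr1 x y hy)]
    nonneg := fun p => (step_bounds _).1
    le_one := fun p => (step_bounds _).2.1
    boundx := fun p => ?_
    boundy := fun p => ?_
    per := fun x y => by simp only [pF] }⟩
  · exact (hasDerivAt_step _).comp x (((dF x).const_sub y).const_mul (2 / h))
  · have := (hasDerivAt_step (2 / h * (y - F x))).comp y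
      (((hasDerivAt_id y).sub_const (F x)).const_mul (2 / h))
    simpa [Function.comp_def] using this
  · rw [abs_mul, abs_mul, abs_neg, abs_of_pos (by positivity : 0 < 2 / h)]
    calc |step' (2 / h * (p.2 - F p.1))| * (2 / h * |F' p.1|) ≤ 2 * (2 / h * g.K) :=
          mul_le_mul (step_bounds _).2.2 (mul_le_mul_of_nonneg_left (bF _) (by positivity))
            (by positivity) (by norm_num)
      _ = 4 * g.K / h := by ring
      _ ≤ _ := by gcongr; linarith
  · rw [abs_mul, abs_of_pos (by positivity : 0 < 2 / h)]
    calc |step' (2 / h * (p.2 - F p.1))| * (2 / h) ≤ 2 * (2 / h) :=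
          mul_le_mul_of_nonneg_right (step_bounds _).2.2 (by positivity)
      _ = 4 / h := by ring
      _ ≤ _ := by gcongr; linarith

/-- The product of a cutoff and a field. -/
noncomputable def Field.cut (W : Field g) {C h : ℝ} (hh : 0 < h) (χ : g.Cutoff C h) : g.V :=
  ⟨(fun p => W.w p * χ.η p, fun p => W.wx p * χ.η p + W.w p * χ.ηx p,
    fun p => W.wy p * χ.η p + W.w p * χ.ηy p), by
    have c0 := χ.cont
    have c1 := χ.contx
    have c2 := χ.conty
    have z0 : ∃ δ > 0, ∀ x y, y < g.f x + δ → (χ.η (x, y) : ℂ) = 0 :=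
      ⟨h / 4, by positivity, fun x y hy => by rw [(χ.zero x y hy.le).1, Complex.ofReal_zero]⟩
    have z1 : ∃ δ > 0, ∀ x y, y < g.f x + δ → (χ.ηx (x, y) : ℂ) = 0 :=
      ⟨h / 4, by positivity, fun x y hy => by rw [(χ.zero x y hy.le).2.1, Complex.ofReal_zero]⟩
    have z2 : ∃ δ > 0, ∀ x y, y < g.f x + δ → (χ.ηy (x, y) : ℂ) = 0 :=
      ⟨h / 4, by positivity, fun x y hy => by rw [(χ.zero x y hy.le).2.2, Complex.ofReal_zero]⟩
    have w0 := W.cont.mono Field.open_subset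
    have w1 := W.contx.mono Field.open_subset
    have w2 := W.conty.mono Field.open_subset
    have hf := g.lip.continuous
    refine ⟨continuous_mul_of_zero w0 (by fun_prop) z0,
      (continuous_mul_of_zero w1 (by fun_prop) z0).add
        (continuous_mul_of_zero w0 (by fun_prop) z1),
      (continuous_mul_of_zero w2 (by fun_prop) z0).add
        (continuous_mul_of_zero w0 (by fun_prop) z2), fun x y => ?_, fun x y => ?_,
      fun x y => ?_, h / 4, by positivity, fun x y hy => ?_⟩
    · by_cases hy : g.f x < y
      · exact (W.derivx x y hy).mul (χ.derivx x y).ofReal_comp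
      · have hy' : y < g.f x + h / 4 := by linarith [not_lt.1 hy]
        simp only [χ.zero x y hy'.le, Complex.ofReal_zero, mul_zero, add_zero]
        refine (hasDerivAt_const x (0 : ℂ)).congr_of_eventuallyEq ?_
        have ho : IsOpen {t : ℝ | y < g.f t + h / 4} :=
          isOpen_lt continuous_const (by fun_prop)
        filter_upwards [ho.mem_nhds hy'] with t ht
        rw [(χ.zero t y (le_of_lt ht)).1, Complex.ofReal_zero, mul_zero]
    · by_cases hy : g.f x < y
      · exact (W.derivy x y hy).mul (χ.derivy x y).ofReal_comp
      · have hy' : y < g.f x + h / 4 := by linarith [not_lt.1 hy]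
        simp only [χ.zero x y hy'.le, Complex.ofReal_zero, mul_zero, add_zero]
        refine (hasDerivAt_const y (0 : ℂ)).congr_of_eventuallyEq ?_
        filter_upwards [Iio_mem_nhds hy'] with t ht
        rw [(χ.zero x t (le_of_lt ht)).1, Complex.ofReal_zero, mul_zero]
    · simp only [χ.per]
      by_cases hy : g.f x < y
      · rw [W.qper x y hy, mul_assoc]
      · rw [(χ.zero x y (by linarith [not_lt.1 hy])).1]; simp
    · simp only [(χ.zero x y hy.le).1, Complex.ofReal_zero, mul_zero]⟩

namespace Field
variable (W : Field g)

/-- `W` and its gradient are bounded on compact pieces of the domain. -/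
theorem exists_bound : ∃ B : ℝ, 0 < B ∧ ∀ x y, x ∈ Set.Icc 0 g.L → g.f x ≤ y → y ≤ g.H →
    ‖W.wx (x, y)‖ ≤ B ∧ ‖W.wy (x, y)‖ ≤ B := by
  have hf := g.lip.continuous
  have hK : IsCompact ((Set.Icc 0 g.L ×ˢ Set.Icc 0 g.H) ∩ {p : ℝ × ℝ | g.f p.1 ≤ p.2}) :=
    (isCompact_Icc.prod isCompact_Icc).inter_right (isClosed_le (by fun_prop) (by fun_prop))
  obtain ⟨B1, h1⟩ := hK.exists_bound_of_continuousOn (W.contx.mono Set.inter_subset_right)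
  obtain ⟨B2, h2⟩ := hK.exists_bound_of_continuousOn (W.conty.mono Set.inter_subset_right)
  refine ⟨|B1| + |B2| + 1, by positivity, fun x y hx hy hH => ?_⟩
  have hm : (x, y) ∈ (Set.Icc 0 g.L ×ˢ Set.Icc 0 g.H) ∩ {p : ℝ × ℝ | g.f p.1 ≤ p.2} :=
    ⟨⟨hx, (g.nonneg x).trans hy, hH⟩, hy⟩
  constructor
  · linarith [h1 _ hm, le_abs_self B1, abs_nonneg B2]
  · linarith [h2 _ hm, le_abs_self B2, abs_nonneg B1]

theorem norm_le_boundary {B : ℝ} (x : ℝ) (hB : ∀ y, g.f x ≤ y → y ≤ g.H → ‖W.wy (x, y)‖ ≤ B)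
    {y : ℝ} (hy : g.f x ≤ y) (hH : y ≤ g.H) :
    ‖W.w (x, y)‖ ≤ ‖W.w (x, g.f x)‖ + B * (y - g.f x) := by
  have hc : ContinuousOn (fun t => W.w (x, t)) (Set.Icc (g.f x) y) :=
    W.cont.comp (by fun_prop : Continuous fun t : ℝ => (x, t)).continuousOn fun t ht => ht.1
  have key : ∀ a, g.f x < a → a ≤ y → ‖W.w (x, y) - W.w (x, a)‖ ≤ B * (y - a) := by
    intro a ha hay
    exact norm_image_sub_le_of_norm_deriv_le_segment' (f' := fun t => W.wy (x, t)) (C := B)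
      (f := fun t => W.w (x, t)) (a := a) (b := y)
      (fun t ht => (W.derivy x t (ha.trans_le ht.1)).hasDerivWithinAt)
      (fun t ht => hB t (ha.le.trans ht.1) (ht.2.le.trans hH)) y ⟨hay, le_rfl⟩
  rcases hy.eq_or_lt with h0 | h0
  · rw [← h0]; simp
  · have hl : Filter.Tendsto (fun a => ‖W.w (x, y) - W.w (x, a)‖)
        (nhdsWithin (g.f x) (Set.Ioo (g.f x) y)) (nhds ‖W.w (x, y) - W.w (x, g.f x)‖) := by
      have := (hc (g.f x) ⟨le_rfl, hy⟩).mono Set.Ioo_subset_Icc_self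
      exact (tendsto_const_nhds.sub this.tendsto).norm
    have hr : Filter.Tendsto (fun a => B * (y - a))
        (nhdsWithin (g.f x) (Set.Ioo (g.f x) y)) (nhds (B * (y - g.f x))) :=
      ((by fun_prop : Continuous fun a => B * (y - a)).tendsto _).mono_left nhdsWithin_le_nhds
    have : (nhdsWithin (g.f x) (Set.Ioo (g.f x) y)).NeBot := left_nhdsWithin_Ioo_neBot h0
    have h3 := le_of_tendsto_of_tendsto hl hr (by
      filter_upwards [self_mem_nhdsWithin] with a ha using key a ha.1 ha.2.le)
    have h4 : W.w (x, y) = W.w (x, g.f x) + (W.w (x, y) - W.w (x, g.f x)) := by ring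
    rw [h4]
    exact (norm_add_le _ _).trans (by linarith)

/-- The integrand measuring the failure of the cut field to solve the equation. -/
noncomputable def defect (u z : g.V) (p : ℝ × ℝ) : ℂ :=
  (dx z p * conj (dx u p) + dy z p * conj (dy u p) - g.k ^ 2 * (fn z p * conj (fn u p)))
    - W.dens u p

theorem eq_neg_of_zero {u d : g.V} {h : ℝ}
    (hud : ∀ x y, y ≤ g.f x + h → fn (u + d) (x, y) = 0) {x y : ℝ} (hy : y < g.f x + h) :
    fn u (x, y) = -fn d (x, y) ∧ dx u (x, y) = -dx d (x, y) ∧ dy u (x, y) = -dy d (x, y) := by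
  have hf := g.lip.continuous
  simp only [← add_eq_zero_iff_eq_neg]
  refine ⟨hud x y hy.le, ?_, ?_⟩
  · refine (hasDerivAt_fn_x (u + d) x y).unique
      ((hasDerivAt_const x (0 : ℂ)).congr_of_eventuallyEq ?_)
    have ho : IsOpen {t : ℝ | y < g.f t + h} := isOpen_lt continuous_const (by fun_prop)
    filter_upwards [ho.mem_nhds hy] with t ht using hud t y (le_of_lt ht)
  · refine (hasDerivAt_fn_y (u + d) x y).unique
      ((hasDerivAt_const y (0 : ℂ)).congr_of_eventuallyEq ?_)
    filter_upwards [Iio_mem_nhds hy] with t ht using hud x t (le_of_lt ht)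

theorem norm_defect_le {C h B : ℝ} (hC : 0 < C) (hh : 0 < h) (h1 : h ≤ 1) (hB : 0 < B)
    (χ : g.Cutoff C h) {u d : g.V}
    (hud : ∀ x y, y ≤ g.f x + h → fn (u + d) (x, y) = 0) {x y : ℝ}
    (hbd : ∀ y, g.f x ≤ y → y ≤ g.H → ‖W.wx (x, y)‖ ≤ B ∧ ‖W.wy (x, y)‖ ≤ B) (hy : y ≤ g.H) :
    ‖W.defect u (W.cut hh χ) (x, y)‖
      ≤ ((C + 1 + g.k ^ 2) / h * (‖W.w (x, g.f x)‖ + h * B)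
          * (2 / (1 + (1 / h * (y - g.f x)) ^ 2)))
        * (‖fn d (x, y)‖ + ‖dx d (x, y)‖ + ‖dy d (x, y)‖) := by
  set z := W.cut hh χ
  have ez : fn z (x, y) = W.w (x, y) * χ.η (x, y) := rfl
  have ezx : dx z (x, y) = W.wx (x, y) * χ.η (x, y) + W.w (x, y) * χ.ηx (x, y) := rfl
  have ezy : dy z (x, y) = W.wy (x, y) * χ.η (x, y) + W.w (x, y) * χ.ηy (x, y) := rfl
  have hk := g.k_pos
  by_cases hlow : y ≤ g.f x
  · obtain ⟨δ, hδ, h0⟩ := exists_zero u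
    have : W.defect u z (x, y) = 0 := by
      simp [defect, dens, h0 x y (by linarith)]
    rw [this, norm_zero]
    positivity
  by_cases hhigh : g.f x + h ≤ y
  · have : W.defect u z (x, y) = 0 := by
      rw [defect, dens, ez, ezx, ezy, (χ.one x y hhigh).1, (χ.one x y hhigh).2.1,
        (χ.one x y hhigh).2.2]
      simp
    rw [this, norm_zero]
    positivity
  rw [not_le] at hlow hhigh
  obtain ⟨e0, ex, ey⟩ := eq_neg_of_zero hud hhigh
  have hw := W.norm_le_boundary x (fun y h1 h2 => (hbd y h1 h2).2) hlow.le hy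
  have hw' : ‖W.w (x, y)‖ ≤ ‖W.w (x, g.f x)‖ + h * B := by nlinarith
  set N := ‖W.w (x, g.f x)‖ + h * B with hN
  have hN0 : 0 ≤ N := by positivity
  have hhB : h * B ≤ N := by rw [hN]; linarith [norm_nonneg (W.w (x, g.f x))]
  have hη : ‖((χ.η (x, y) : ℝ) : ℂ) - 1‖ ≤ 1 := by
    rw [← Complex.ofReal_one, ← Complex.ofReal_sub, Complex.norm_real, Real.norm_eq_abs, abs_le]
    have := χ.nonneg (x, y); have := χ.le_one (x, y)
    constructor <;> linarith
  set t := (C + 1 + g.k ^ 2) / h * N with ht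
  have hBt : B ≤ 1 / h * N := by
    rw [one_div, le_inv_mul_iff₀ hh]; exact hhB
  have hg : ∀ a : ℂ, ∀ b : ℝ, ‖a‖ ≤ B → |b| ≤ C / h →
      ‖a * χ.η (x, y) + W.w (x, y) * b - a‖ ≤ t := by
    intro a b ha hb
    have : a * χ.η (x, y) + W.w (x, y) * b - a
        = a * ((χ.η (x, y) : ℝ) - 1) + W.w (x, y) * b := by ring
    rw [this]
    refine (norm_add_le _ _).trans ?_
    rw [norm_mul, norm_mul, Complex.norm_real, Real.norm_eq_abs]
    have i1 : ‖a‖ * ‖((χ.η (x, y) : ℝ) : ℂ) - 1‖ ≤ B * 1 :=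
      mul_le_mul ha hη (norm_nonneg _) hB.le
    have i2 : ‖W.w (x, y)‖ * |b| ≤ N * (C / h) := mul_le_mul hw' hb (abs_nonneg _) hN0
    have i3 : 0 ≤ g.k ^ 2 / h * N := by positivity
    have i4 : t = C / h * N + 1 / h * N + g.k ^ 2 / h * N := by rw [ht]; ring
    linarith
  have hgx := hg _ _ (hbd y hlow.le hy).1 (χ.boundx (x, y))
  have hgy := hg _ _ (hbd y hlow.le hy).2 (χ.boundy (x, y))
  have hg0 : ‖(g.k : ℂ) ^ 2 * (W.w (x, y) * χ.η (x, y) - W.w (x, y))‖ ≤ t := by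
    have : (g.k : ℂ) ^ 2 * (W.w (x, y) * χ.η (x, y) - W.w (x, y))
        = (g.k : ℂ) ^ 2 * (W.w (x, y) * ((χ.η (x, y) : ℝ) - 1)) := by ring
    rw [this, norm_mul, norm_mul, norm_pow, Complex.norm_real, Real.norm_eq_abs, sq_abs]
    have i1 : ‖W.w (x, y)‖ * ‖((χ.η (x, y) : ℝ) : ℂ) - 1‖ ≤ N * 1 :=
      mul_le_mul hw' hη (norm_nonneg _) hN0
    have i2 : g.k ^ 2 ≤ (C + 1 + g.k ^ 2) / h := by
      rw [le_div_iff₀ hh]; nlinarith [sq_nonneg g.k]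
    calc g.k ^ 2 * (‖W.w (x, y)‖ * ‖((χ.η (x, y) : ℝ) : ℂ) - 1‖) ≤ g.k ^ 2 * (N * 1) :=
          mul_le_mul_of_nonneg_left i1 (sq_nonneg _)
      _ ≤ _ := by rw [mul_one]; exact mul_le_mul_of_nonneg_right i2 hN0
  have ht0 : 0 ≤ t := by positivity
  have hwt : 1 ≤ 2 / (1 + (1 / h * (y - g.f x)) ^ 2) := by
    rw [le_div_iff₀ (by positivity)]
    have j0 : 0 ≤ 1 / h * (y - g.f x) := mul_nonneg (by positivity) (by linarith)
    have j1 : 1 / h * (y - g.f x) ≤ 1 := by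
      rw [one_div, inv_mul_le_iff₀ hh]; linarith
    nlinarith
  have hS : 0 ≤ ‖fn d (x, y)‖ + ‖dx d (x, y)‖ + ‖dy d (x, y)‖ := by positivity
  refine le_trans ?_ (mul_le_mul_of_nonneg_right (le_mul_of_one_le_right ht0 hwt) hS)
  have e : W.defect u z (x, y)
      = -(dx z (x, y) - W.wx (x, y)) * conj (dx d (x, y))
        - (dy z (x, y) - W.wy (x, y)) * conj (dy d (x, y))
        + (g.k : ℂ) ^ 2 * (fn z (x, y) - W.w (x, y)) * conj (fn d (x, y)) := by
    rw [defect, dens, e0, ex, ey]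
    simp only [map_neg]; ring
  rw [e]
  refine (norm_add_le _ _).trans ?_
  refine (add_le_add (norm_sub_le _ _) le_rfl).trans ?_
  rw [norm_mul, norm_mul, norm_mul _ (conj (fn d (x, y))), norm_neg, RCLike.norm_conj,
    RCLike.norm_conj, RCLike.norm_conj, ez, ezx, ezy]
  have k1 := mul_le_mul_of_nonneg_right hgx (norm_nonneg (dx d (x, y)))
  have k2 := mul_le_mul_of_nonneg_right hgy (norm_nonneg (dy d (x, y)))
  have k3 := mul_le_mul_of_nonneg_right hg0 (norm_nonneg (fn d (x, y)))
  linarith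

theorem integral_weight_le {h : ℝ} (hh : 0 < h) (a b c : ℝ) :
    ∫ y in a..b, 4 / (1 + (1 / h * (y - c)) ^ 2) ≤ 16 * h := by
  have hd : ∀ y : ℝ, HasDerivAt (fun y => 4 * h * Real.arctan (1 / h * (y - c)))
      (4 / (1 + (1 / h * (y - c)) ^ 2)) y := fun y => by
    refine ((((hasDerivAt_id y).sub_const c).const_mul (1 / h)).arctan.const_mul
      (4 * h)).congr_deriv ?_
    have : 1 + (1 / h * (y - c)) ^ 2 ≠ 0 := by positivity
    simp only [id]
    field_simp
  have hc : Continuous fun y : ℝ => 4 / (1 + (1 / h * (y - c)) ^ 2) :=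
    continuous_const.div (by fun_prop) fun y => by positivity
  rw [intervalIntegral.integral_eq_sub_of_hasDerivAt (fun y _ => hd y)
    (hc.intervalIntegrable _ _)]
  have h1 := Real.arctan_lt_pi_div_two (1 / h * (b - c))
  have h2 := Real.neg_pi_div_two_lt_arctan (1 / h * (a - c))
  have h3 := Real.pi_lt_four
  nlinarith

theorem le_of_forall_small {X Y Z h0 : ℝ} (hh0 : 0 < h0)
    (H : ∀ h, 0 < h → h < h0 → X ≤ Y + h ^ 2 * Z) : X ≤ Y := by
  have hc : Filter.Tendsto (fun h : ℝ => Y + h ^ 2 * Z) (nhdsWithin 0 (Set.Ioi 0)) (nhds Y) := by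
    have : Continuous fun h : ℝ => Y + h ^ 2 * Z := by fun_prop
    have := this.tendsto 0
    simp only [ne_eq, OfNat.ofNat_ne_zero, not_false_eq_true, zero_pow, zero_mul, add_zero] at this
    exact this.mono_left nhdsWithin_le_nhds
  refine ge_of_tendsto hc ?_
  filter_upwards [Ioo_mem_nhdsGT hh0] with h hh using H h hh.1 hh.2

theorem continuous_defect (u z : g.V) : Continuous (W.defect u z) := by
  have h : Continuous fun p => dx z p * conj (dx u p) + dy z p * conj (dy u p)
      - g.k ^ 2 * (fn z p * conj (fn u p)) := by fun_prop
  exact h.sub (W.continuous_dens u)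

theorem continuous_boundary : Continuous fun x => W.w (x, g.f x) := by
  have hf := g.lip.continuous
  rw [← continuousOn_univ]
  exact W.cont.comp (by fun_prop : Continuous fun x : ℝ => (x, g.f x)).continuousOn
    fun x _ => le_refl (g.f x)

theorem sq_norm_integral_defect_le {A h B : ℝ} (hA : 0 < A) (hh : 0 < h) (hB : 0 < B)
    (u z d : g.V)
    (H : ∀ x y, x ∈ Set.Icc 0 g.L → y ≤ g.H → ‖W.defect u z (x, y)‖
      ≤ (A / h * (‖W.w (x, g.f x)‖ + h * B) * (2 / (1 + (1 / h * (y - g.f x)) ^ 2)))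
        * (‖fn d (x, y)‖ + ‖dx d (x, y)‖ + ‖dy d (x, y)‖)) :
    ‖∫ p, W.defect u z p ∂g.box‖ ^ 2 ≤ 48 * A ^ 2 / h * nsq d
      * ∫ x in (0 : ℝ)..g.L, (‖W.w (x, g.f x)‖ + h * B) ^ 2 := by
  have hf := g.lip.continuous
  have hw := W.continuous_boundary
  have hcw : Continuous fun p : ℝ × ℝ => W.w (p.1, g.f p.1) := hw.comp continuous_fst
  set T : ℝ × ℝ → ℝ := fun p => A / h * (‖W.w (p.1, g.f p.1)‖ + h * B)
    * (2 / (1 + (1 / h * (p.2 - g.f p.1)) ^ 2)) with hT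
  set S : ℝ × ℝ → ℝ := fun p => ‖fn d p‖ + ‖dx d p‖ + ‖dy d p‖ with hS
  have cwt : Continuous fun p : ℝ × ℝ => 2 / (1 + (1 / h * (p.2 - g.f p.1)) ^ 2) :=
    continuous_const.div (by fun_prop) fun p => by positivity
  have cT : Continuous T := by
    rw [hT]; fun_prop
  have cS : Continuous S := by rw [hS]; fun_prop
  have i1 : ‖∫ p, W.defect u z p ∂g.box‖ ≤ ∫ p, T p * S p ∂g.box := by
    refine norm_integral_le_of_norm_le (g.integrable_box (cT.mul cS)) ?_
    rw [box_eq]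
    filter_upwards [ae_restrict_mem (measurableSet_Ioc.prod measurableSet_Ioc)] with p hp
    exact H p.1 p.2 ⟨hp.1.1.le, hp.1.2⟩ hp.2.2
  have i2 := sq_integral_mul_le (g.integrable_box (cT.pow 2)) (g.integrable_box (cS.pow 2))
    (g.integrable_box (cT.mul cS))
  have i3 : ∫ p, S p ^ 2 ∂g.box ≤ 3 * nsq d := by
    rw [nsq, ← integral_const_mul]
    refine integral_mono (g.integrable_box (cS.pow 2)) (g.integrable_box (by fun_prop)) fun p => ?_
    simp only [hS]
    nlinarith [sq_nonneg (‖fn d p‖ - ‖dx d p‖), sq_nonneg (‖fn d p‖ - ‖dy d p‖),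
      sq_nonneg (‖dx d p‖ - ‖dy d p‖)]
  have i4 : ∫ p, T p ^ 2 ∂g.box
      ≤ 16 * A ^ 2 / h * ∫ x in (0 : ℝ)..g.L, (‖W.w (x, g.f x)‖ + h * B) ^ 2 := by
    rw [g.integral_box' (F := fun p => T p ^ 2) (cT.pow 2), ← intervalIntegral.integral_const_mul]
    refine intervalIntegral.integral_mono_on g.L_pos.le
      (Continuous.intervalIntegrable (continuous_intervalIntegral_param
        (F := fun p => T (p.2, p.1) ^ 2) (by fun_prop) _ _) _ _)
      (Continuous.intervalIntegrable (by fun_prop) _ _) fun x _ => ?_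
    have c4 : Continuous fun y : ℝ => 4 / (1 + (1 / h * (y - g.f x)) ^ 2) :=
      continuous_const.div (by fun_prop) fun y => by positivity
    calc ∫ y in (0 : ℝ)..g.H, T (x, y) ^ 2
        ≤ ∫ y in (0 : ℝ)..g.H, (A / h * (‖W.w (x, g.f x)‖ + h * B)) ^ 2
            * (4 / (1 + (1 / h * (y - g.f x)) ^ 2)) := by
          refine intervalIntegral.integral_mono_on g.H_pos.le
            (Continuous.intervalIntegrable (by fun_prop) _ _)
            (Continuous.intervalIntegrable (by fun_prop) _ _) fun y _ => ?_
          simp only [hT]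
          rw [mul_pow]
          refine mul_le_mul_of_nonneg_left ?_ (sq_nonneg _)
          rw [div_pow]
          have : 1 ≤ 1 + (1 / h * (y - g.f x)) ^ 2 := by linarith [sq_nonneg (1 / h * (y - g.f x))]
          norm_num
          gcongr
          nlinarith
      _ ≤ (A / h * (‖W.w (x, g.f x)‖ + h * B)) ^ 2 * (16 * h) := by
          rw [intervalIntegral.integral_const_mul]
          exact mul_le_mul_of_nonneg_left (integral_weight_le hh _ _ _) (sq_nonneg _)
      _ = _ := by field_simp
  have hS0 : 0 ≤ ∫ p, S p ^ 2 ∂g.box := integral_nonneg fun p => sq_nonneg _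
  have hI0 : 0 ≤ ∫ x in (0 : ℝ)..g.L, (‖W.w (x, g.f x)‖ + h * B) ^ 2 :=
    intervalIntegral.integral_nonneg g.L_pos.le fun x _ => sq_nonneg _
  calc ‖∫ p, W.defect u z p ∂g.box‖ ^ 2 ≤ (∫ p, T p * S p ∂g.box) ^ 2 :=
        pow_le_pow_left₀ (norm_nonneg _) i1 2
    _ ≤ _ := i2
    _ ≤ (16 * A ^ 2 / h * ∫ x in (0 : ℝ)..g.L, (‖W.w (x, g.f x)‖ + h * B) ^ 2) * (3 * nsq d) :=
        mul_le_mul i4 i3 hS0 (by positivity)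
    _ = _ := by ring

/-- The Fourier coefficients of a field at height `H` are controlled by its boundary values. -/
theorem sq_norm_coef_le (g : Geo) : ∃ C : ℝ, 0 < C ∧ ∀ (W : Field g) (j : ℤ),
    ‖g.coef (fun x => W.w (x, g.H)) j‖ ^ 2
      ≤ C * ∫ x in (0 : ℝ)..g.L, ‖W.w (x, g.f x)‖ ^ 2 := by
  obtain ⟨C1, h0, hC1, hh0, hdual⟩ := exists_dual g
  obtain ⟨C2, hC2, hcut⟩ := exists_cutoff g
  set A := C2 + 1 + g.k ^ 2 with hA
  have hA0 : 0 < A := by positivity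
  set D := 48 * A ^ 2 * (2 * C1) with hD
  have hD0 : 0 < D := by positivity
  refine ⟨4 * D, by positivity, fun W j => ?_⟩
  obtain ⟨B, hB, hbd⟩ := W.exists_bound
  have hbH : 0 < g.H - g.M := by linarith [g.M_lt_b, g.b_lt_H]
  refine le_of_forall_small (Z := 4 * D * g.L * B ^ 2 + 2) (h0 := min (min h0 1) (g.H - g.M))
    (by positivity) fun h hh hh' => ?_
  have h1 : h < h0 := hh'.trans_le ((min_le_left _ _).trans (min_le_left _ _))
  have h2 : h < 1 := hh'.trans_le ((min_le_left _ _).trans (min_le_right _ _))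
  have h3 : h < g.H - g.M := hh'.trans_le (min_le_right _ _)
  obtain ⟨χ⟩ := hcut h hh
  set z := W.cut hh χ with hz
  have hn := nrm_nonneg z
  set ε := h / (nrm z + 1) with hε
  have hε0 : 0 < ε := by positivity
  have hεh : ε ≤ h := div_le_self hh.le (by linarith)
  have hεz : ε * nrm z ≤ h := by
    rw [hε, div_mul_eq_mul_div, div_le_iff₀ (by positivity)]
    nlinarith
  obtain ⟨u, d, hu, hud, hd⟩ := hdual j h ε hh h1 hε0
  have hd' : nsq d ≤ 2 * C1 * h := by
    refine hd.trans ?_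
    have : ε ^ 2 ≤ h := by nlinarith
    nlinarith
  have htop : ∀ x, fn z (x, g.H) = W.w (x, g.H) := by
    intro x
    change W.w (x, g.H) * χ.η (x, g.H) = _
    rw [(χ.one x g.H (by linarith [g.le_M x])).1]; simp
  have ha := W.aform_eq u z htop
  change aform z u = ∫ p, W.defect u z p ∂g.box at ha
  have hdef := W.sq_norm_integral_defect_le hA0 hh hB u z d fun x y hx hy =>
    W.norm_defect_le hC2 hh h2.le hB χ hud (fun y h1 h2 => hbd x y hx h1 h2) hy
  rw [← ha] at hdef
  have hcw := W.continuous_boundary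
  have hI : ∫ x in (0 : ℝ)..g.L, (‖W.w (x, g.f x)‖ + h * B) ^ 2
      ≤ 2 * (∫ x in (0 : ℝ)..g.L, ‖W.w (x, g.f x)‖ ^ 2) + g.L * (2 * (h * B) ^ 2) := by
    have e : 2 * (∫ x in (0 : ℝ)..g.L, ‖W.w (x, g.f x)‖ ^ 2) + g.L * (2 * (h * B) ^ 2)
        = ∫ x in (0 : ℝ)..g.L, (2 * ‖W.w (x, g.f x)‖ ^ 2 + 2 * (h * B) ^ 2) := by
      rw [intervalIntegral.integral_add (Continuous.intervalIntegrable (by fun_prop) _ _)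
        (Continuous.intervalIntegrable (by fun_prop) _ _), intervalIntegral.integral_const_mul,
        intervalIntegral.integral_const]
      simp
    rw [e]
    refine intervalIntegral.integral_mono_on g.L_pos.le
      (Continuous.intervalIntegrable (by fun_prop) _ _)
      (Continuous.intervalIntegrable (by fun_prop) _ _) fun x _ => ?_
    nlinarith [sq_nonneg (‖W.w (x, g.f x)‖ - h * B)]
  have hI0 : 0 ≤ ∫ x in (0 : ℝ)..g.L, (‖W.w (x, g.f x)‖ + h * B) ^ 2 :=
    intervalIntegral.integral_nonneg g.L_pos.le fun x _ => sq_nonneg _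
  have hq : q z j g.H = g.coef (fun x => W.w (x, g.H)) j := by
    rw [q]; congr 1; funext x; exact htop x
  have hcoef : ‖g.coef (fun x => W.w (x, g.H)) j‖ ≤ ‖aform z u‖ + h := by
    rw [← hq]
    have e : q z j g.H = aform z u - (aform z u - q z j g.H) := by ring
    rw [e]
    exact (norm_sub_le _ _).trans (by linarith [hu z])
  have hfac : 48 * A ^ 2 / h * nsq d ≤ D := by
    calc 48 * A ^ 2 / h * nsq d ≤ 48 * A ^ 2 / h * (2 * C1 * h) :=
          mul_le_mul_of_nonneg_left hd' (by positivity)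
      _ = D := by rw [hD]; field_simp
  have hfin := hdef.trans ((mul_le_mul_of_nonneg_right hfac hI0).trans
    (mul_le_mul_of_nonneg_left hI hD0.le))
  have hsq : ‖g.coef (fun x => W.w (x, g.H)) j‖ ^ 2 ≤ 2 * ‖aform z u‖ ^ 2 + 2 * h ^ 2 := by
    have := pow_le_pow_left₀ (norm_nonneg _) hcoef 2
    nlinarith [sq_nonneg (‖aform z u‖ - h)]
  refine hsq.trans ?_
  linarith

end Field

/-- An outgoing quasi-periodic solution of the Helmholtz equation, continuous up to the profile,
together with its derivatives and outgoing amplitudes. -/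
structure Wave (g : Geo) where
  w : ℝ × ℝ → ℂ
  wx : ℝ × ℝ → ℂ
  wy : ℝ × ℝ → ℂ
  wxx : ℝ × ℝ → ℂ
  wyy : ℝ × ℝ → ℂ
  a : ℤ → ℂ
  cont : ContinuousOn w {p : ℝ × ℝ | g.f p.1 ≤ p.2}
  contx : ContinuousOn wx {p : ℝ × ℝ | g.f p.1 < p.2}
  conty : ContinuousOn wy {p : ℝ × ℝ | g.f p.1 < p.2}
  contxx : ContinuousOn wxx {p : ℝ × ℝ | g.f p.1 < p.2}
  contyy : ContinuousOn wyy {p : ℝ × ℝ | g.f p.1 < p.2}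
  derivx : ∀ x y, g.f x < y → HasDerivAt (fun t => w (t, y)) (wx (x, y)) x
  derivy : ∀ x y, g.f x < y → HasDerivAt (fun t => w (x, t)) (wy (x, y)) y
  derivxx : ∀ x y, g.f x < y → HasDerivAt (fun t => wx (t, y)) (wxx (x, y)) x
  derivyy : ∀ x y, g.f x < y → HasDerivAt (fun t => wy (x, t)) (wyy (x, y)) y
  helm : ∀ x y, g.f x < y → wxx (x, y) + wyy (x, y) + (g.k : ℂ) ^ 2 * w (x, y) = 0
  qper : ∀ x y, g.f x < y → w (x + g.L, y) = g.nu * w (x, y)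
  qperx : ∀ x y, g.f x < y → wx (x + g.L, y) = g.nu * wx (x, y)
  outgoing : ∀ j y, g.M < y → g.coef (fun x => w (x, y)) j = a j * Complex.exp (-g.m j * y)

namespace Wave
variable (W : Wave g)

theorem continuous_slice {A : ℝ × ℝ → ℂ} (hA : ContinuousOn A {p : ℝ × ℝ | g.f p.1 < p.2})
    {y : ℝ} (hy : g.M < y) : Continuous fun x => A (x, y) := by
  rw [← continuousOn_univ]
  exact hA.comp (by fun_prop : Continuous fun x : ℝ => (x, y)).continuousOn
    fun x _ => (g.le_M x).trans_lt hy

theorem coef_wy (j : ℤ) {y : ℝ} (hy : g.M < y) :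
    g.coef (fun x => W.wy (x, y)) j = -g.m j * g.coef (fun x => W.w (x, y)) j := by
  set y1 := (g.M + y) / 2 with hy1
  have h1 : g.M < y1 := by linarith
  have h2 : y1 < y := by linarith
  have hlt : ∀ x t, y1 ≤ t → g.f x < t := fun x t ht => (g.le_M x).trans_lt (h1.trans_le ht)
  have cY : Continuous fun p : ℝ × ℝ => W.wy (p.1, max p.2 y1) := by
    rw [← continuousOn_univ]
    exact W.conty.comp (by fun_prop : Continuous fun p : ℝ × ℝ => (p.1, max p.2 y1)).continuousOn
      fun p _ => hlt _ _ (le_max_right _ _)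
  have e : ∀ t, y1 < t → g.coef (fun x => W.w (x, t)) j = g.coef (fun x => W.w (x, y1)) j
      + ∫ s in y1..t, g.coef (fun x => W.wy (x, max s y1)) j := by
    intro t ht
    have e1 : ∀ x, W.w (x, t) = W.w (x, y1) + ∫ s in y1..t, W.wy (x, max s y1) := by
      intro x
      rw [intervalIntegral.integral_eq_sub_of_hasDerivAt (f := fun s => W.w (x, s))]
      · ring
      · intro s hs
        rw [Set.uIcc_of_le ht.le] at hs
        rw [max_eq_left hs.1]
        exact W.derivy x s (hlt x s hs.1)
      · exact (cY.comp (by fun_prop : Continuous fun s : ℝ => (x, s))).intervalIntegrable _ _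
    have c1 : Continuous fun x => ∫ s in y1..t, W.wy (x, max s y1) :=
      continuous_intervalIntegral_param (F := fun p => W.wy (p.2, max p.1 y1))
        (cY.comp continuous_swap) _ _
    simp only [e1]
    rw [g.coef_add (continuous_slice (W.cont.mono Field.open_subset) h1) c1]
    congr 1
    have cF : Continuous fun p : ℝ × ℝ => W.wy (p.1, max p.2 y1) * conj (g.phi j p.1) :=
      cY.mul (Complex.continuous_conj.comp ((g.continuous_phi j).comp continuous_fst))
    have := integral_swap cF 0 g.L y1 t
    simp only [coef]
    rw [← this]
    refine intervalIntegral.integral_congr fun x _ => ?_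
    exact (intervalIntegral.integral_mul_const _ _).symm
  have cc : Continuous fun s => g.coef (fun x => W.wy (x, max s y1)) j :=
    continuous_coef (F := fun p => W.wy (p.1, max p.2 y1)) cY j
  have d1 : HasDerivAt (fun t => g.coef (fun x => W.w (x, t)) j)
      (g.coef (fun x => W.wy (x, y)) j) y := by
    have := (intervalIntegral.integral_hasDerivAt_right (cc.intervalIntegrable y1 y)
      (cc.stronglyMeasurableAtFilter _ _) cc.continuousAt).const_add
        (g.coef (fun x => W.w (x, y1)) j)
    rw [max_eq_left h2.le] at this
    refine this.congr_of_eventuallyEq ?_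
    filter_upwards [Ioi_mem_nhds h2] with t ht using e t ht
  have d2 : HasDerivAt (fun t => g.coef (fun x => W.w (x, t)) j)
      (W.a j * (Complex.exp (-g.m j * y) * (-g.m j))) y := by
    have h := ((((hasDerivAt_id y).ofReal_comp).const_mul (-g.m j)).cexp.const_mul (W.a j))
    simp only [id, Complex.ofReal_one, mul_one] at h
    refine h.congr_of_eventuallyEq ?_
    filter_upwards [Ioi_mem_nhds hy] with t ht using W.outgoing j t ht
  rw [d1.unique d2, W.outgoing j y hy]; ring

/-- The field obtained by translating `W` downwards. -/
noncomputable def shift {s : ℝ} (hs : 0 < s) : Field g :=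
  have key : ∀ {A : ℝ × ℝ → ℂ}, ContinuousOn A {p : ℝ × ℝ | g.f p.1 < p.2} →
      ContinuousOn (fun p : ℝ × ℝ => A (p.1, p.2 + s)) {p : ℝ × ℝ | g.f p.1 ≤ p.2} := fun hA =>
    hA.comp (by fun_prop : Continuous fun p : ℝ × ℝ => (p.1, p.2 + s)).continuousOn
      fun p (hp : g.f p.1 ≤ p.2) => show g.f p.1 < p.2 + s by linarith
  have lt : ∀ {x y}, g.f x < y → g.f x < y + s := fun h => by linarith
  { w := fun p => W.w (p.1, p.2 + s)
    wx := fun p => W.wx (p.1, p.2 + s)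
    wy := fun p => W.wy (p.1, p.2 + s)
    wxx := fun p => W.wxx (p.1, p.2 + s)
    wyy := fun p => W.wyy (p.1, p.2 + s)
    cont := key (W.cont.mono Field.open_subset)
    contx := key W.contx
    conty := key W.conty
    contxx := (key W.contxx).mono Field.open_subset
    contyy := (key W.contyy).mono Field.open_subset
    derivx := fun x y h => W.derivx x (y + s) (lt h)
    derivy := fun x y h => (W.derivy x (y + s) (lt h)).comp_add_const y s
    derivxx := fun x y h => W.derivxx x (y + s) (lt h)
    derivyy := fun x y h => (W.derivyy x (y + s) (lt h)).comp_add_const y s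
    helm := fun x y h => W.helm x (y + s) (lt h)
    qper := fun x y h => W.qper x (y + s) (lt h)
    qperx := fun x y h => W.qperx x (y + s) (lt h)
    top := fun j => W.coef_wy j (y := g.H + s) (by linarith [g.M_lt_b, g.b_lt_H]) }

/-- The outgoing amplitudes are controlled by the boundary values. -/
theorem sq_norm_coef_le (g : Geo) : ∃ C : ℝ, 0 < C ∧ ∀ (W : Wave g) (j : ℤ),
    ‖g.coef (fun x => W.w (x, g.H)) j‖ ^ 2
      ≤ C * ∫ x in (0 : ℝ)..g.L, ‖W.w (x, g.f x)‖ ^ 2 := by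
  obtain ⟨C, hC, h⟩ := Field.sq_norm_coef_le g
  refine ⟨C, hC, fun W j => ?_⟩
  have hf := g.lip.continuous
  have hMH : g.M < g.H := by linarith [g.M_lt_b, g.b_lt_H]
  have c1 : Continuous fun s : ℝ => C * ∫ x in (0 : ℝ)..g.L, ‖W.w (x, g.f x + max s 0)‖ ^ 2 := by
    refine continuous_const.mul (continuous_intervalIntegral_param
      (F := fun p => ‖W.w (p.1, g.f p.1 + max p.2 0)‖ ^ 2) ?_ _ _)
    refine (Continuous.norm ?_).pow 2
    rw [← continuousOn_univ]
    exact W.cont.comp (by fun_prop : Continuous fun p : ℝ × ℝ =>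
      (p.1, g.f p.1 + max p.2 0)).continuousOn
      fun p _ => show g.f p.1 ≤ g.f p.1 + max p.2 0 by linarith [le_max_right p.2 0]
  have c2 : Continuous fun s : ℝ => ‖W.a j * Complex.exp (-g.m j * (g.H + s : ℝ))‖ ^ 2 := by
    fun_prop
  have t1 := (c1.tendsto 0).mono_left (nhdsWithin_le_nhds (s := Set.Ioi 0))
  have t2 := (c2.tendsto 0).mono_left (nhdsWithin_le_nhds (s := Set.Ioi 0))
  simp only [max_self, add_zero] at t1 t2
  rw [← W.outgoing j g.H hMH] at t2
  refine le_of_tendsto_of_tendsto t2 t1 ?_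
  filter_upwards [self_mem_nhdsWithin] with s hs
  have hs : 0 < s := hs
  have := h (W.shift hs) j
  rw [max_eq_left hs.le, ← W.outgoing j (g.H + s) (by linarith)]
  exact this

end Wave

/-- An elementary one-dimensional Sobolev inequality. -/
theorem sq_norm_le_integral {u u' : ℝ → ℂ} {L : ℝ} (hL : 0 < L)
    (hu : ∀ x, HasDerivAt u (u' x) x) (hu' : Continuous u') {x : ℝ} (hx : x ∈ Set.Icc 0 L) :
    L * ‖u x‖ ^ 2 ≤ 2 * (∫ t in (0 : ℝ)..L, ‖u t‖ ^ 2)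
      + 2 * L ^ 2 * ∫ t in (0 : ℝ)..L, ‖u' t‖ ^ 2 := by
  have hc : Continuous u := continuous_iff_continuousAt.2 fun x => (hu x).continuousAt
  set I := ∫ t in (0 : ℝ)..L, ‖u' t‖ ^ 2 with hI
  have key : ∀ t ∈ Set.Icc 0 L, ‖u x‖ ^ 2 ≤ 2 * ‖u t‖ ^ 2 + 2 * L * I := by
    intro t ht
    have h1 : ‖u x - u t‖ ^ 2 ≤ L * I := by
      have main : ∀ a b, a ∈ Set.Icc 0 L → b ∈ Set.Icc 0 L → a ≤ b →
          ‖u b - u a‖ ^ 2 ≤ L * I := by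
        intro a b ha hb hab
        rw [← intervalIntegral.integral_eq_sub_of_hasDerivAt (fun y _ => hu y)
          (hu'.intervalIntegrable _ _)]
        refine (sq_norm_intervalIntegral_le hab hu'.continuousOn).trans ?_
        have h0 : 0 ≤ ∫ t in a..b, ‖u' t‖ ^ 2 := int_nonneg hab fun t => sq_nonneg _
        refine mul_le_mul (by linarith [ha.1, hb.2]) ?_ h0 hL.le
        exact intervalIntegral.integral_mono_interval ha.1 hab hb.2
          (Filter.Eventually.of_forall fun t => sq_nonneg _)
          (Continuous.intervalIntegrable (by fun_prop) _ _)
      rcases le_total t x with h | h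
      · exact main t x ht hx h
      · rw [norm_sub_rev]; exact main x t hx ht h
    have h2 : ‖u x‖ ≤ ‖u t‖ + ‖u x - u t‖ := by
      have := norm_add_le (u t) (u x - u t)
      rwa [add_sub_cancel] at this
    have h3 := pow_le_pow_left₀ (norm_nonneg _) h2 2
    nlinarith [sq_nonneg (‖u t‖ - ‖u x - u t‖)]
  have h := intervalIntegral.integral_mono_on (μ := volume) hL.le
    (continuous_const.intervalIntegrable _ _)
    (Continuous.intervalIntegrable (u := fun t => 2 * ‖u t‖ ^ 2 + 2 * L * I) (by fun_prop) _ _) key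
  rw [intervalIntegral.integral_const, intervalIntegral.integral_add
    (Continuous.intervalIntegrable (by fun_prop) _ _)
    (Continuous.intervalIntegrable (by fun_prop) _ _), intervalIntegral.integral_const_mul,
    intervalIntegral.integral_const] at h
  simp only [sub_zero, smul_eq_mul] at h
  linarith

theorem lam_sq_le_re (j : ℤ) : g.lam j ^ 2 ≤ g.k ^ 2 + (g.m j).re ^ 2 := by
  by_cases h : g.k ^ 2 < g.lam j ^ 2
  · have h1 := congrArg Complex.re (g.m_sq j)
    rw [Complex.ofReal_re, sq, Complex.mul_re, (g.m_evan h).2] at h1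
    nlinarith
  · nlinarith [sq_nonneg (g.m j).re]

theorem sq_weight_le {δ : ℝ} (hδ : 0 < δ) (j : ℤ) :
    (1 + g.lam j ^ 2) ^ 2 * Real.exp (-(2 * δ * (g.m j).re))
      ≤ 2 * (1 + g.k ^ 2) ^ 2 * (1 + 24 / (2 * δ) ^ 4) := by
  set r := (g.m j).re with hr
  have hr0 : 0 ≤ r := g.m_re_nonneg j
  have hx : 0 ≤ 2 * δ * r := by positivity
  have e1 : (2 * δ * r) ^ 4 / 24 ≤ Real.exp (2 * δ * r) := by
    simpa [Nat.factorial] using Real.pow_div_factorial_le_exp (2 * δ * r) hx 4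
  have e2 : 1 ≤ Real.exp (2 * δ * r) := Real.one_le_exp hx
  have hδ4 : 0 < (2 * δ) ^ 4 := by positivity
  have e3 : r ^ 4 ≤ 24 / (2 * δ) ^ 4 * Real.exp (2 * δ * r) := by
    rw [div_mul_eq_mul_div, le_div_iff₀ hδ4]
    rw [mul_pow] at e1
    linarith
  have h1 : 1 + g.lam j ^ 2 ≤ (1 + g.k ^ 2) * (1 + r ^ 2) := by
    nlinarith [lam_sq_le_re (g := g) j, mul_nonneg (sq_nonneg g.k) (sq_nonneg r)]
  have h2 : (1 + g.lam j ^ 2) ^ 2 ≤ 2 * (1 + g.k ^ 2) ^ 2 * (1 + r ^ 4) := by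
    calc _ ≤ ((1 + g.k ^ 2) * (1 + r ^ 2)) ^ 2 := pow_le_pow_left₀ (by positivity) h1 2
      _ = (1 + g.k ^ 2) ^ 2 * (1 + r ^ 2) ^ 2 := by ring
      _ ≤ (1 + g.k ^ 2) ^ 2 * (2 * (1 + r ^ 4)) :=
        mul_le_mul_of_nonneg_left (by nlinarith [sq_nonneg (1 - r ^ 2)]) (by positivity)
      _ = _ := by ring
  rw [Real.exp_neg, ← div_eq_mul_inv, div_le_iff₀ (Real.exp_pos _)]
  refine h2.trans ?_
  rw [mul_assoc _ _ (Real.exp _)]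
  refine mul_le_mul_of_nonneg_left ?_ (by positivity)
  linarith

theorem summable_weight (g : Geo) {δ : ℝ} (hδ : 0 < δ) :
    Summable fun j => (1 + g.lam j ^ 2) * Real.exp (-(2 * δ * (g.m j).re)) := by
  set B := 2 * (1 + g.k ^ 2) ^ 2 * (1 + 24 / (2 * δ) ^ 4) with hB
  have hB0 : 0 ≤ B := by positivity
  set c := 2 * Real.pi / g.L with hc
  have hc0 : 0 < c := div_pos (by positivity) g.L_pos
  have hs : Summable fun j : ℤ => B * (2 * (1 + g.β ^ 2) / c ^ 2 * (1 / (j : ℝ) ^ 2)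
      + if j = 0 then (1 : ℝ) else 0) :=
    (((Real.summable_one_div_int_pow.2 one_lt_two).mul_left _).add
      (hasSum_ite_eq (0 : ℤ) (1 : ℝ)).summable).mul_left B
  refine Summable.of_nonneg_of_le (fun j => by positivity) (fun j => ?_) hs
  have hp : 0 < 1 + g.lam j ^ 2 := by positivity
  have h1 : (1 + g.lam j ^ 2) * Real.exp (-(2 * δ * (g.m j).re)) ≤ B * (1 / (1 + g.lam j ^ 2)) := by
    rw [mul_one_div, le_div_iff₀ hp]
    have := sq_weight_le (g := g) hδ j
    linarith
  refine h1.trans (mul_le_mul_of_nonneg_left ?_ hB0)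
  by_cases hj : j = 0
  · rw [if_pos hj, hj]
    have : 1 / (1 + g.lam 0 ^ 2) ≤ 1 := by
      rw [div_le_one (by positivity)]; nlinarith [sq_nonneg (g.lam 0)]
    simpa using this
  · rw [if_neg hj, add_zero]
    have hj' : (j : ℝ) ≠ 0 := by exact_mod_cast hj
    have hj2 : 0 < (j : ℝ) ^ 2 := by positivity
    rw [div_mul_div_comm, mul_one, div_le_div_iff₀ hp (by positivity), one_mul]
    have e : c * j = g.lam j - g.β := by rw [hc, lam]; ring
    rw [← mul_pow, e]
    nlinarith [sq_nonneg (g.lam j + g.β), mul_nonneg (sq_nonneg g.β) (sq_nonneg (g.lam j))]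

namespace Wave

theorem norm_periodic (W : Wave g) {y : ℝ} (hy : g.M < y) :
    Function.Periodic (fun x => ‖W.w (x, y)‖) g.L := by
  intro x
  simp only
  rw [W.qper x y ((g.le_M x).trans_lt hy), norm_mul, g.norm_nu, one_mul]

theorem norm_coef_le (W : Wave g) {R y : ℝ} (hR : g.H ≤ R) (hy : R ≤ y) (j : ℤ) :
    ‖g.coef (fun x => W.w (x, y)) j‖ ^ 2
      ≤ ‖g.coef (fun x => W.w (x, g.H)) j‖ ^ 2 * Real.exp (-(2 * (R - g.H) * (g.m j).re)) := by
  have hMH : g.M < g.H := g.M_lt_b.trans g.b_lt_H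
  rw [W.outgoing j y (by linarith), W.outgoing j g.H hMH]
  simp only [norm_mul, Complex.norm_exp, mul_pow]
  rw [mul_assoc]
  refine mul_le_mul_of_nonneg_left ?_ (sq_nonneg _)
  rw [← Real.exp_nat_mul, ← Real.exp_nat_mul, ← Real.exp_add, Real.exp_le_exp]
  simp
  nlinarith [mul_nonneg (g.m_re_nonneg j) (sub_nonneg.2 hy)]

/-- Outgoing waves are bounded above the grating by their boundary values. -/
theorem sq_norm_le (g : Geo) {R : ℝ} (hR : g.H < R) : ∃ C : ℝ, 0 < C ∧ ∀ (W : Wave g) (x y : ℝ),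
    R ≤ y → ‖W.w (x, y)‖ ^ 2 ≤ C * ∫ x in (0 : ℝ)..g.L, ‖W.w (x, g.f x)‖ ^ 2 := by
  obtain ⟨C, hC, hcoef⟩ := sq_norm_coef_le g
  have hL := g.L_pos
  have hMH : g.M < g.H := g.M_lt_b.trans g.b_lt_H
  set wt : ℤ → ℝ := fun j => (1 + g.lam j ^ 2) * Real.exp (-(2 * (R - g.H) * (g.m j).re)) with hwt
  have hs : Summable wt := g.summable_weight (sub_pos.2 hR)
  set S := ∑' j, wt j with hS
  have hwt0 : ∀ j, 0 < wt j := fun j => by positivity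
  have hS0 : 0 < S := hs.tsum_pos (fun j => (hwt0 j).le) 0 (hwt0 0)
  refine ⟨(2 + 2 * g.L ^ 2) * (C * S) / g.L, by positivity, fun W x y hy => ?_⟩
  have hMy : g.M < y := by linarith
  obtain ⟨x', hx', e⟩ := (W.norm_periodic hMy).exists_mem_Ico₀ hL x
  rw [e]
  set I := ∫ x in (0 : ℝ)..g.L, ‖W.w (x, g.f x)‖ ^ 2 with hI
  have hI0 : 0 ≤ I := int_nonneg hL.le fun x => sq_nonneg _
  have hlt : ∀ x, g.f x < y := fun x => (g.le_M x).trans_lt hMy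
  have hd : ∀ x, HasDerivAt (fun x => W.w (x, y)) (W.wx (x, y)) x := fun x => W.derivx x y (hlt x)
  have cx := continuous_slice W.contx hMy
  have cw := continuous_slice (W.cont.mono Field.open_subset) hMy
  have hq : W.w (g.L, y) = g.nu * W.w (0, y) := by simpa using W.qper 0 y (hlt 0)
  have b : ∀ j, (1 + g.lam j ^ 2) * ‖g.coef (fun x => W.w (x, y)) j‖ ^ 2 ≤ C * I * wt j := by
    intro j
    have h1 := (W.norm_coef_le hR.le hy j).trans
      (mul_le_mul_of_nonneg_right (hcoef W j) (Real.exp_pos _).le)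
    have h2 := mul_le_mul_of_nonneg_left h1 (show 0 ≤ 1 + g.lam j ^ 2 by positivity)
    refine h2.trans (le_of_eq ?_)
    simp only [hwt]; ring
  have s1 := g.hasSum_norm_coef_sq (u := fun x => W.w (x, y)) cw.continuousOn
  have s2 := g.hasSum_norm_coef_sq (u := fun x => W.wx (x, y)) cx.continuousOn
  have s3 : HasSum (fun j => C * I * wt j) (C * I * S) := hs.hasSum.mul_left _
  have i1 : ∫ x in (0 : ℝ)..g.L, ‖W.w (x, y)‖ ^ 2 ≤ C * I * S := by
    refine hasSum_le (fun j => le_trans ?_ (b j)) s1 s3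
    have h0 := mul_nonneg (sq_nonneg (g.lam j)) (sq_nonneg ‖g.coef (fun x => W.w (x, y)) j‖)
    linarith
  have i2 : ∫ x in (0 : ℝ)..g.L, ‖W.wx (x, y)‖ ^ 2 ≤ C * I * S := by
    refine hasSum_le (fun j => le_trans ?_ (b j)) s2 s3
    rw [coef_deriv hd cx hq j, norm_mul, norm_mul, Complex.norm_I, one_mul, Complex.norm_real,
      mul_pow, Real.norm_eq_abs, sq_abs]
    nlinarith [sq_nonneg ‖g.coef (fun x => W.w (x, y)) j‖]
  have h := sq_norm_le_integral hL hd cx ⟨hx'.1, hx'.2.le⟩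
  have h' : g.L * ‖W.w (x', y)‖ ^ 2 ≤ (2 + 2 * g.L ^ 2) * (C * S) * I := by
    have := mul_le_mul_of_nonneg_left i2 (show 0 ≤ 2 * g.L ^ 2 by positivity)
    nlinarith
  rw [div_mul_eq_mul_div, le_div_iff₀ hL]
  linarith

/-- The wave obtained by subtracting one Rayleigh mode. -/
theorem exists_sub_mode (W : Wave g) (i : ℤ) (c : ℂ) :
    ∃ W' : Wave g, ∀ p, W'.w p = W.w p - c * Complex.exp (-g.m i * p.2) * g.phi i p.1 := by
  have dE : ∀ y : ℝ, HasDerivAt (fun y : ℝ => Complex.exp (-g.m i * y))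
      (-g.m i * Complex.exp (-g.m i * y)) y := by
    intro y
    have h := (((hasDerivAt_id y).ofReal_comp).const_mul (-g.m i)).cexp
    simp only [id, Complex.ofReal_one, mul_one] at h
    exact h.congr_deriv (by ring)
  have cE : ∀ c : ℂ, Continuous fun p : ℝ × ℝ => c * Complex.exp (-g.m i * p.2) * g.phi i p.1 := by
    intro c
    exact (Continuous.mul (by fun_prop) ((g.continuous_phi i).comp continuous_fst))
  have dx : ∀ (c : ℂ) (x y : ℝ), HasDerivAt (fun t => c * Complex.exp (-g.m i * y) * g.phi i t)
      ((c * (Complex.I * g.lam i)) * Complex.exp (-g.m i * y) * g.phi i x) x := fun c x y =>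
    ((g.hasDerivAt_phi i x).const_mul (c * Complex.exp (-g.m i * y))).congr_deriv (by ring)
  have dy : ∀ (c : ℂ) (x y : ℝ), HasDerivAt (fun t : ℝ => c * Complex.exp (-g.m i * t) * g.phi i x)
      ((c * (-g.m i)) * Complex.exp (-g.m i * y) * g.phi i x) y := fun c x y =>
    (((dE y).const_mul c).mul_const (g.phi i x)).congr_deriv (by ring)
  refine ⟨{
    w := fun p => W.w p - c * Complex.exp (-g.m i * p.2) * g.phi i p.1
    wx := fun p => W.wx p - (c * (Complex.I * g.lam i)) * Complex.exp (-g.m i * p.2) * g.phi i p.1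
    wy := fun p => W.wy p - (c * (-g.m i)) * Complex.exp (-g.m i * p.2) * g.phi i p.1
    wxx := fun p => W.wxx p - (c * (Complex.I * g.lam i) * (Complex.I * g.lam i))
      * Complex.exp (-g.m i * p.2) * g.phi i p.1
    wyy := fun p => W.wyy p - (c * (-g.m i) * (-g.m i)) * Complex.exp (-g.m i * p.2) * g.phi i p.1
    a := fun j => W.a j - if j = i then c else 0
    cont := W.cont.sub (cE _).continuousOn
    contx := W.contx.sub (cE _).continuousOn
    conty := W.conty.sub (cE _).continuousOn
    contxx := W.contxx.sub (cE _).continuousOn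
    contyy := W.contyy.sub (cE _).continuousOn
    derivx := fun x y h => (W.derivx x y h).sub (dx _ x y)
    derivy := fun x y h => (W.derivy x y h).sub (dy _ x y)
    derivxx := fun x y h => (W.derivxx x y h).sub (dx _ x y)
    derivyy := fun x y h => (W.derivyy x y h).sub (dy _ x y)
    helm := ?_
    qper := ?_
    qperx := ?_
    outgoing := ?_ }, fun p => rfl⟩
  · intro x y h
    have h1 := W.helm x y h
    have h2 := g.m_sq i
    push_cast at h2
    have h3 : Complex.I ^ 2 = -1 := Complex.I_sq
    linear_combination h1 - c * Complex.exp (-g.m i * y) * g.phi i x * h2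
      - c * Complex.exp (-g.m i * y) * g.phi i x * g.lam i ^ 2 * h3
  · intro x y h
    simp only [W.qper x y h, g.phi_add_L]; ring
  · intro x y h
    simp only [W.qperx x y h, g.phi_add_L]; ring
  · intro j y hy
    have cw := continuous_slice (W.cont.mono Field.open_subset) hy
    have : (fun x => W.w (x, y) - c * Complex.exp (-g.m i * y) * g.phi i x)
        = fun x => W.w (x, y) + (-(c * Complex.exp (-g.m i * y))) * g.phi i x := by
      funext x; ring
    simp only [this]
    rw [g.coef_add cw (by fun_prop), g.coef_const_mul, W.outgoing j y hy, coef_phi]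
    split_ifs with hji
    · rw [hji]; ring
    · ring

theorem exists_sub_modes (W : Wave g) (F : Finset ℤ) (c : ℤ → ℂ) :
    ∃ W' : Wave g, ∀ p, W'.w p
      = W.w p - ∑ j ∈ F, c j * Complex.exp (-g.m j * p.2) * g.phi j p.1 := by
  induction F using Finset.induction_on with
  | empty => exact ⟨W, fun p => by simp⟩
  | insert i F hi ih =>
    obtain ⟨W1, h1⟩ := ih
    obtain ⟨W2, h2⟩ := W1.exists_sub_mode i (c i)
    refine ⟨W2, fun p => ?_⟩
    rw [h2, h1, Finset.sum_insert hi]; ring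

end Wave

/-- If the Rayleigh sums converge in mean square, the Fourier coefficients are those of the sum. -/
theorem coef_eq_of_tendsto {u : ℝ → ℂ} (hu : Continuous u) {a : ℤ → ℂ}
    (h : Filter.Tendsto (fun s : Finset ℤ =>
      ∫ x in (0 : ℝ)..g.L, ‖u x - ∑ j ∈ s, a j * g.phi j x‖ ^ 2)
      Filter.atTop (nhds 0)) (i : ℤ) : g.coef u i = a i := by
  have hsum : ∀ s : Finset ℤ, g.coef (fun x => ∑ j ∈ s, a j * g.phi j x) i
      = if i ∈ s then a i else 0 := by
    intro s
    induction s using Finset.induction_on with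
    | empty => simp [coef]
    | insert j s hj ih =>
      simp only [Finset.sum_insert hj]
      rw [g.coef_add (by fun_prop) (by fun_prop), ih, g.coef_const_mul, coef_phi]
      by_cases hij : i = j
      · subst hij; simp [hj]
      · simp [hij]
  have key : ∀ᶠ s : Finset ℤ in Filter.atTop, ‖g.coef u i - a i‖ ^ 2
      ≤ ∫ x in (0 : ℝ)..g.L, ‖u x - ∑ j ∈ s, a j * g.phi j x‖ ^ 2 := by
    filter_upwards [Filter.eventually_ge_atTop {i}] with s hs
    have his : i ∈ s := hs (Finset.mem_singleton_self i)
    have cS : Continuous fun x => ∑ j ∈ s, a j * g.phi j x := by fun_prop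
    have e : g.coef (fun x => u x - ∑ j ∈ s, a j * g.phi j x) i = g.coef u i - a i := by
      have : (fun x => u x - ∑ j ∈ s, a j * g.phi j x)
          = fun x => u x + (-1) * ∑ j ∈ s, a j * g.phi j x := by funext x; ring
      rw [this, g.coef_add hu (by fun_prop), g.coef_const_mul, hsum, if_pos his]; ring
    rw [← e]
    have hS := g.hasSum_norm_coef_sq (u := fun x => u x - ∑ j ∈ s, a j * g.phi j x)
      (hu.sub cS).continuousOn
    exact le_hasSum hS i fun j _ => sq_nonneg _
  have h0 := ge_of_tendsto h key
  have h1 : ‖g.coef u i - a i‖ = 0 := by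
    have := sq_nonneg ‖g.coef u i - a i‖
    exact pow_eq_zero_iff (two_ne_zero) |>.1 (le_antisymm h0 this)
  exact sub_eq_zero.1 (norm_eq_zero.1 h1)

end Geo
end Rayleigh

/- STATEMENT 15 (Modified Rayleigh Conjecture, Theorem 4.4, sup-norm form):
Context: L > 0, k > 0, θ ∈ (0,π/2), ν = e^{ikL cos θ}, λ_j = k cos θ + 2πj/L,
φ_j(x) = e^{iλ_j x}/√L, λ_j² ≠ k² for all j, μ_j = √(k²−λ_j²) for λ_j² < k² and
μ_j = i√(λ_j²−k²) otherwise; f Lipschitz, L-periodic, nonnegative,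
M = sup_{0≤x≤L} f(x); D = {y > f(x)}, closure Dbar = {y ≥ f(x)}.
u₀(x,y) = e^{ik(x cos θ − y sin θ)}; v is a scattered field: continuous on Dbar, C² in D,
quasiperiodic, outgoing (net of finite partial sums of Σ_j c_j e^{iμ_j y} φ_j(x) converges
to v(·,y) in L²(0,L) for each y > M), Δv + k²v = 0 in D, v = −u₀ on S.
The boundary L²(S_L) norm is rendered (equivalently up to constants absorbed in c, since
f is Lipschitz) as the L²(0,L) norm with Lebesgue measure.
Fix R > M.  Then there is c > 0, independent of ε, p and the coefficients, such that
whenever ε > 0, p ∈ ℕ, and c_j ∈ ℂ (|j| ≤ p) satisfy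
‖u₀(·,f(·)) + Σ_{|j|≤p} c_j e^{iμ_j f(·)} φ_j‖_{L²(0,L)} ≤ ε, then
|v(x,y) − Σ_{|j|≤p} c_j e^{iμ_j y} φ_j(x)| ≤ c ε for all (x,y) ∈ D with y ≥ R. -/
theorem statement15
    (L k θ : ℝ) (hL : 0 < L) (hk : 0 < k) (hθ : θ ∈ Set.Ioo 0 (Real.pi / 2))
    (ν : ℂ) (hν : ν = Complex.exp (Complex.I * k * L * Real.cos θ))
    (lam : ℤ → ℝ) (hlam : ∀ j : ℤ, lam j = k * Real.cos θ + 2 * Real.pi * j / L)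
    (hnr : ∀ j : ℤ, (lam j) ^ 2 ≠ k ^ 2)
    (φ : ℤ → ℝ → ℂ)
    (hφ : ∀ (j : ℤ) (x : ℝ), φ j x = Complex.exp (Complex.I * lam j * x) / Real.sqrt L)
    (μ : ℤ → ℂ)
    (hμ1 : ∀ j : ℤ, (lam j) ^ 2 < k ^ 2 → μ j = (Real.sqrt (k ^ 2 - (lam j) ^ 2) : ℝ))
    (hμ2 : ∀ j : ℤ, k ^ 2 < (lam j) ^ 2 → μ j = Complex.I * (Real.sqrt ((lam j) ^ 2 - k ^ 2) : ℝ))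
    (f : ℝ → ℝ) (hlip : ∃ K : NNReal, LipschitzWith K f)
    (hper : ∀ x : ℝ, f (x + L) = f x) (hpos : ∀ x : ℝ, 0 ≤ f x)
    (M : ℝ) (hM : M = sSup (f '' Set.Icc 0 L))
    (D Dbar : Set (ℝ × ℝ))
    (hD : D = {p : ℝ × ℝ | f p.1 < p.2})
    (hDbar : Dbar = {p : ℝ × ℝ | f p.1 ≤ p.2})
    (u₀ : ℝ × ℝ → ℂ)
    (hu₀ : ∀ p : ℝ × ℝ, u₀ p =
      Complex.exp (Complex.I * k * (p.1 * Real.cos θ - p.2 * Real.sin θ)))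
    -- the scattered field v and its derivative data
    (v vx vy vxx vyy : ℝ × ℝ → ℂ)
    (hcv : ContinuousOn v Dbar)
    (hd1 : ∀ p ∈ D, HasDerivAt (fun t => v (t, p.2)) (vx p) p.1)
    (hd2 : ∀ p ∈ D, HasDerivAt (fun t => v (p.1, t)) (vy p) p.2)
    (hd11 : ∀ p ∈ D, HasDerivAt (fun t => vx (t, p.2)) (vxx p) p.1)
    (hd22 : ∀ p ∈ D, HasDerivAt (fun t => vy (p.1, t)) (vyy p) p.2)
    (hcvx : ContinuousOn vx D) (hcvy : ContinuousOn vy D)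
    (hcvxx : ContinuousOn vxx D) (hcvyy : ContinuousOn vyy D)
    (helm : ∀ p ∈ D, vxx p + vyy p + (k : ℂ) ^ 2 * v p = 0)
    (hdir : ∀ x : ℝ, v (x, f x) = -u₀ (x, f x))
    (hqp : ∀ p ∈ Dbar, v (p.1 + L, p.2) = ν * v p)
    (hqpx : ∀ p ∈ D, vx (p.1 + L, p.2) = ν * vx p)
    (cv : ℤ → ℂ)
    (hout : ∀ y : ℝ, M < y → Filter.Tendsto
      (fun s : Finset ℤ => ∫ x in (0 : ℝ)..L,
        ‖v (x, y) - ∑ j ∈ s, cv j * Complex.exp (Complex.I * μ j * y) * φ j x‖ ^ 2)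
      Filter.atTop (nhds 0))
    (R : ℝ) (hR : M < R) :
    ∃ c : ℝ, 0 < c ∧
      ∀ ε : ℝ, 0 < ε →
        ∀ (p : ℕ) (cj : ℤ → ℂ),
          (∫ x in (0 : ℝ)..L,
              ‖u₀ (x, f x) + ∑ j ∈ Finset.Icc (-(p : ℤ)) (p : ℤ),
                  cj j * Complex.exp (Complex.I * μ j * f x) * φ j x‖ ^ 2) ≤ ε ^ 2 →
          ∀ q ∈ D, R ≤ q.2 →
            ‖v q - ∑ j ∈ Finset.Icc (-(p : ℤ)) (p : ℤ),
                cj j * Complex.exp (Complex.I * μ j * q.2) * φ j q.1‖ ≤ c * ε := by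
  obtain ⟨K, hK⟩ := hlip
  have hfc : Continuous f := hK.continuous
  have hfM : ∀ x, f x ≤ M := by
    intro x
    obtain ⟨x', hx', e⟩ := (show Function.Periodic f L from hper).exists_mem_Ico₀ hL x
    rw [e, hM]
    exact le_csSup (isCompact_Icc.image hfc).bddAbove ⟨x', Set.Ico_subset_Icc_self hx', rfl⟩
  let g : Rayleigh.Geo :=
    { L := L, k := k, β := k * Real.cos θ, M := M, b := M + (R - M) / 3,
      H := M + 2 * (R - M) / 3, f := f, K := K, L_pos := hL, k_pos := hk,
      nonres := fun j => by rw [← hlam]; exact hnr j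
      lip := hK, per := hper, nonneg := hpos, le_M := hfM
      M_lt_b := by linarith, b_lt_H := by linarith }
  have gL : g.L = L := rfl
  have gk : g.k = k := rfl
  have gM : g.M = M := rfl
  have gf : g.f = f := rfl
  have glam : ∀ j, g.lam j = lam j := fun j => (hlam j).symm
  have gphi : ∀ j x, g.phi j x = φ j x := by
    intro j x
    rw [hφ, Rayleigh.Geo.phi, glam, gL]; push_cast; ring_nf
  have gnu : g.nu = ν := by
    rw [hν, Rayleigh.Geo.nu]
    change Complex.exp (Complex.I * ((k * Real.cos θ * L : ℝ) : ℂ)) = _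
    push_cast; ring_nf
  have gm : ∀ j, -g.m j = Complex.I * μ j := by
    intro j
    unfold Rayleigh.Geo.m
    rw [glam, gk]
    split_ifs with h
    · rw [hμ2 j h, ← mul_assoc, Complex.I_mul_I]; ring
    · rw [hμ1 j (lt_of_le_of_ne (not_lt.1 h) (hnr j))]; ring
  subst hD hDbar
  have hsub : {p : ℝ × ℝ | f p.1 < p.2} ⊆ {p | f p.1 ≤ p.2} :=
    fun p (hp : f p.1 < p.2) => show f p.1 ≤ p.2 from hp.le
  let W : Rayleigh.Geo.Wave g :=
    { w := v, wx := vx, wy := vy, wxx := vxx, wyy := vyy, a := cv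
      cont := hcv, contx := hcvx, conty := hcvy, contxx := hcvxx, contyy := hcvyy
      derivx := fun x y h => hd1 (x, y) h
      derivy := fun x y h => hd2 (x, y) h
      derivxx := fun x y h => hd11 (x, y) h
      derivyy := fun x y h => hd22 (x, y) h
      helm := fun x y h => helm (x, y) h
      qper := fun x y h => by rw [gnu]; exact hqp (x, y) (hsub h)
      qperx := fun x y h => by rw [gnu]; exact hqpx (x, y) h
      outgoing := fun j y hy => by
        rw [gm]
        refine Rayleigh.Geo.coef_eq_of_tendsto (g := g)
          (a := fun j => cv j * Complex.exp (Complex.I * μ j * y))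
          (Rayleigh.Geo.Wave.continuous_slice (g := g) (hcv.mono hsub) hy) ?_ j
        simpa only [gphi] using hout y hy }
  have gH : g.H < R := by change M + 2 * (R - M) / 3 < R; linarith
  obtain ⟨C, hC, hbound⟩ := Rayleigh.Geo.Wave.sq_norm_le g gH
  refine ⟨Real.sqrt C, Real.sqrt_pos.2 hC, fun ε hε p cj hint q _ hq => ?_⟩
  obtain ⟨W', hW'⟩ := W.exists_sub_modes (Finset.Icc (-(p : ℤ)) (p : ℤ)) cj
  simp only [gm, gphi] at hW'
  have h1 := hbound W' q.1 q.2 hq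
  have h2 : (∫ x in (0 : ℝ)..g.L, ‖W'.w (x, g.f x)‖ ^ 2) ≤ ε ^ 2 := by
    refine le_trans (le_of_eq ?_) hint
    refine intervalIntegral.integral_congr fun x _ => ?_
    simp only [hW', gf]
    rw [show W.w (x, f x) = -u₀ (x, f x) from hdir x, ← norm_neg]
    congr 2; ring
  have h3 := h1.trans (mul_le_mul_of_nonneg_left h2 hC.le)
  rw [Prod.mk.eta, hW'] at h3
  refine le_of_pow_le_pow_left₀ two_ne_zero (by positivity) ?_
  rw [mul_pow, Real.sq_sqrt hC.le]
  exact h3
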